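/- arXiv:1707.04783 — 3 statements merged into one kernel-verified Lean document; each statement's English description precedes it below -/
import Mathlib

section
/- Let a ∈ F_{3^n}, a ≠ 0. Define g : F_{3^n} → F_3 as follows, where for an integer j, ē(j) denotes the unique integer with 0 < ē(j) ≤ 3^n−1 and ē(j) ≡ −jd (mod 3^n−1). If |A ∩ {n−k, …, n−1}| is even, set g(x) = ∑_{j ∈ U_0} Tr((−1)^{N_2(j)+1} η(a) a^j x^{ē(j)}) + ∑_{j ∈ V_0} Tr((−1)^{N_2(j)} η(a) a^j x^{ē(j)}); if |A ∩ {n−k, …, n−1}| is odd, set g(x) = ∑_{j ∈ U_1} Tr((−1)^{N_2(j)+1} η(a) a^j x^{ē(j)}) + ∑_{j ∈ V_1} Tr((−1)^{N_2(j)} η(a) a^j x^{ē(j)}). Then for every λ ∈ F_{3^n}, ∑_{x ∈ F_{3^n}} ω_3^{Tr(a x^d + λ x)} = (−1)^{n+1} η(a) i^n 3^{n/2} ω_3^{g(λ)} (as complex numbers, where η(a) ∈ {±1} ⊂ ℂ on the right-hand side); i.e., g is the dual of the Coulter–Matthews bent function Tr(a x^d). -/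
/-- The `i`-th ternary digit (indices read modulo `n`) of the residue of `j` modulo `3^n - 1`. -/
def dig (n : ℕ) (j : ℤ) (i : ℕ) : ℕ :=
  ((j % ((3 : ℤ) ^ n - 1)).toNat / 3 ^ (i % n)) % 3

/-- The ternary weight of (the residue modulo `3^n - 1` of) `j`. -/
def wt (n : ℕ) (j : ℤ) : ℕ := ∑ i ∈ Finset.range n, dig n j i

/-- `d = (3^k + 1)/2`. -/
def cmD (k : ℕ) : ℤ := ((3 : ℤ) ^ k + 1) / 2

/-- The set `A = { ik mod n : 0 ≤ i ≤ w-1 }`. -/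
def Aset (n k w : ℕ) : Finset ℕ := (Finset.range w).image (fun i => i * k % n)

/-- The set `U_0`. -/
def U0set (n k w : ℕ) : Set ℤ :=
  {j | 0 < j ∧ j < 3 ^ n - 1 ∧
    (∀ i, w ≤ i → i ≤ n - 1 → dig n j (i * k) = 1) ∧
    dig n j 0 = 0 ∧ dig n j ((w - 1) * k) = 0 ∧
    (∀ i, 1 ≤ i → i ≤ w - 2 → dig n j (i * k) = 0 ∨ dig n j (i * k) = 2) ∧
    (∀ i, 1 ≤ i → i + 1 ≤ w - 2 → ¬(dig n j (i * k) = 2 ∧ dig n j ((i + 1) * k) = 2))}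

/-- The set `U_1`. -/
def U1set (n k w : ℕ) : Set ℤ :=
  {j | 0 < j ∧ j < 3 ^ n - 1 ∧
    (∀ i, i ≤ w - 1 → dig n j (i * k) = 1) ∧
    dig n j (w * k) = 0 ∧ dig n j ((n - 1) * k) = 0 ∧
    (∀ i, w + 1 ≤ i → i ≤ n - 2 → dig n j (i * k) = 0 ∨ dig n j (i * k) = 2) ∧
    (∀ i, w + 1 ≤ i → i + 1 ≤ n - 2 → ¬(dig n j (i * k) = 2 ∧ dig n j ((i + 1) * k) = 2))}

/-- The set `V_0`. -/
def V0set (n k w : ℕ) : Set ℤ :=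
  {j | 0 < j ∧ j < 3 ^ n - 1 ∧
    (∀ i, w ≤ i → i ≤ n - 1 → dig n j (i * k) = 1) ∧
    dig n j 0 = 2 ∧ dig n j k = 0 ∧ dig n j ((w - 1) * k) = 0 ∧
    (∀ i, 2 ≤ i → i ≤ w - 2 → dig n j (i * k) = 0 ∨ dig n j (i * k) = 2) ∧
    (∀ i, 2 ≤ i → i + 1 ≤ w - 2 → ¬(dig n j (i * k) = 2 ∧ dig n j ((i + 1) * k) = 2))}

/-- The set `V_1`. -/
def V1set (n k w : ℕ) : Set ℤ :=
  {j | 0 < j ∧ j < 3 ^ n - 1 ∧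
    (∀ i, i ≤ w - 1 → dig n j (i * k) = 1) ∧
    dig n j (w * k) = 0 ∧ dig n j ((n - 2) * k) = 0 ∧
    (∀ i, w + 1 ≤ i → i ≤ n - 3 → dig n j (i * k) = 0 ∨ dig n j (i * k) = 2) ∧
    dig n j ((n - 1) * k) = 2 ∧
    (∀ i, w + 1 ≤ i → i + 1 ≤ n - 3 → ¬(dig n j (i * k) = 2 ∧ dig n j ((i + 1) * k) = 2))}
/-- `N_2(j)`: the number of ternary digits of (the residue of) `j` equal to 2. -/
def N2 (n : ℕ) (j : ℤ) : ℕ := ((Finset.range n).filter (fun i => dig n j i = 2)).card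

open Classical in
/-- `U_0` as a finite set. -/
noncomputable def U0fin (n k w : ℕ) : Finset ℤ :=
  (Finset.Ioo 0 ((3 : ℤ) ^ n - 1)).filter (fun j => j ∈ U0set n k w)

open Classical in
/-- `U_1` as a finite set. -/
noncomputable def U1fin (n k w : ℕ) : Finset ℤ :=
  (Finset.Ioo 0 ((3 : ℤ) ^ n - 1)).filter (fun j => j ∈ U1set n k w)

open Classical in
/-- `V_0` as a finite set. -/
noncomputable def V0fin (n k w : ℕ) : Finset ℤ :=
  (Finset.Ioo 0 ((3 : ℤ) ^ n - 1)).filter (fun j => j ∈ V0set n k w)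

open Classical in
/-- `V_1` as a finite set. -/
noncomputable def V1fin (n k w : ℕ) : Finset ℤ :=
  (Finset.Ioo 0 ((3 : ℤ) ^ n - 1)).filter (fun j => j ∈ V1set n k w)

open Classical in
/-- The quadratic character `η` (with value `1` at squares, `-1` elsewhere), as an integer. -/
noncomputable def qchar {F : Type*} [Monoid F] (a : F) : ℤ := if IsSquare a then 1 else -1

/-- `ē(j)`: the unique integer with `0 < ē(j) ≤ 3^n - 1` and `ē(j) ≡ -jd (mod 3^n - 1)`. -/
def eExp (n k : ℕ) (j : ℤ) : ℕ :=
  if (-(j * cmD k)) % ((3 : ℤ) ^ n - 1) = 0 then 3 ^ n - 1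
  else ((-(j * cmD k)) % ((3 : ℤ) ^ n - 1)).toNat

/-- `ω_3 = e^{2πi/3}`. -/
noncomputable def omega3 : ℂ := Complex.exp (2 * Real.pi * Complex.I / 3)

section SemilinearTransfer

variable {K : Type*} [Field K] {ι : Type*} [Fintype ι] [DecidableEq ι]

/-- The product `σ^(i-1)(T) ⋯ σ(T) T`. -/
def twistedProd (σ : K →+* K) (T : Matrix ι ι K) : ℕ → Matrix ι ι K
  | 0 => 1
  | i + 1 => T.map ⇑(σ ^ i) * twistedProd σ T i

theorem twistedProd_add (σ : K →+* K) (T : Matrix ι ι K) (i j : ℕ) :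
    twistedProd σ T (i + j) = (twistedProd σ T j).map ⇑(σ ^ i) * twistedProd σ T i := by
  induction j with
  | zero =>
    simp [twistedProd]
  | succ j ih =>
    rw [← add_assoc, twistedProd, ih, twistedProd, Matrix.map_mul, Matrix.mul_assoc,
      Matrix.map_map]
    congr 2
    rw [pow_add]; rfl

/-- Hilbert 90 for a semilinear system with a given fixed vector of the norm matrix. -/
theorem exists_semilinear_solution (σ : K →+* K) {N : ℕ} (hN0 : 0 < N) (hσ : σ ^ N = 1)
    (hinj : ∀ i j, i < N → j < N → σ ^ i = σ ^ j → i = j)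
    (T : Matrix ι ι K) (X : ι → K) (hX : X ≠ 0) (hfix : (twistedProd σ T N).mulVec X = X) :
    ∃ Y : ι → K, Y ≠ 0 ∧ (fun i => σ (Y i)) = T.mulVec Y := by
  have hfun : ∀ i x, (σ ^ (i + 1)) x = (σ ^ i) (σ x) := fun i x => by rw [pow_succ]; rfl
  have hfun' : ∀ i x, (σ ^ (i + 1)) x = σ ((σ ^ i) x) := fun i x => by rw [pow_succ']; rfl
  let v : ℕ → ι → K := fun i l => (σ ^ (N - i)) ((twistedProd σ T i).mulVec X l)
  have hv0 : v N = v 0 := by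
    funext l
    simp only [v, hfix, Nat.sub_self, pow_zero, Nat.sub_zero, hσ, twistedProd, Matrix.one_mulVec]
  have hstep : ∀ i < N, T.mulVec (v i) = fun l => σ (v (i + 1) l) := by
    intro i hi
    funext l
    have e1 : σ ((σ ^ (N - (i + 1))) ((twistedProd σ T (i + 1)).mulVec X l)) =
        (σ ^ (N - i)) ((twistedProd σ T (i + 1)).mulVec X l) := by
      rw [← hfun', show N - (i + 1) + 1 = N - i by omega]
    change _ = σ ((σ ^ (N - (i + 1))) ((twistedProd σ T (i + 1)).mulVec X l))
    rw [e1]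
    simp only [v, twistedProd, ← Matrix.mulVec_mulVec]
    simp only [Matrix.mulVec, dotProduct, map_sum, map_mul, Matrix.map_apply]
    refine Finset.sum_congr rfl fun m _ => ?_
    congr 1
    change _ = ((σ ^ (N - i)) * σ ^ i) (T l m)
    rw [← pow_add, Nat.sub_add_cancel hi.le, hσ]; rfl
  obtain ⟨l, hl⟩ : ∃ l, X l ≠ 0 := by
    by_contra! h
    exact hX (funext h)
  have hind := linearIndependent_monoidHom K K
  obtain ⟨c, hc⟩ : ∃ c : K, ∑ i ∈ Finset.range N, (σ ^ (N - i)) c * v i l ≠ 0 := by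
    by_contra! h
    have hinj2 : Function.Injective (fun i : Fin N => ((σ ^ (N - (i : ℕ)) : K →+* K) : K →* K)) := by
      intro i j hij
      have h1 : (σ ^ (N - (i : ℕ)) : K →+* K) = σ ^ (N - (j : ℕ)) := by
        ext x; exact DFunLike.congr_fun hij x
      have hi := i.2
      have hj := j.2
      by_cases hi0 : (i : ℕ) = 0 <;> by_cases hj0 : (j : ℕ) = 0
      · exact Fin.ext (by omega)
      · rw [hi0, Nat.sub_zero, hσ, ← pow_zero σ] at h1
        have := hinj _ _ hN0 (by omega) h1
        omega
      · rw [hj0, Nat.sub_zero, hσ, ← pow_zero σ] at h1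
        have := hinj _ _ (by omega) hN0 h1
        omega
      · have := hinj _ _ (by omega) (by omega) h1
        exact Fin.ext (by omega)
    have h2 := (Fintype.linearIndependent_iff.1 (hind.comp _ hinj2)) (fun i => v i l) (by
      funext x
      have := h x
      rw [Finset.sum_range] at this
      simp only [Finset.sum_apply, Pi.smul_apply, Function.comp, smul_eq_mul, Pi.zero_apply]
      rw [← this]
      exact Finset.sum_congr rfl fun i _ => mul_comm _ _) ⟨0, hN0⟩
    have h3 : v 0 l = X l := by
      simp only [v, Nat.sub_zero, hσ, twistedProd, Matrix.one_mulVec]; rfl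
    exact hl (h3 ▸ h2)
  refine ⟨fun m => ∑ i ∈ Finset.range N, (σ ^ (N - i)) c * v i m, fun h => hc (congrFun h l), ?_⟩
  funext m
  have e2 : T.mulVec (fun m => ∑ i ∈ Finset.range N, (σ ^ (N - i)) c * v i m) m =
      ∑ i ∈ Finset.range N, (σ ^ (N - i)) c * T.mulVec (v i) m := by
    simp only [Matrix.mulVec, dotProduct, Finset.mul_sum]
    rw [Finset.sum_comm]
    exact Finset.sum_congr rfl fun i _ => Finset.sum_congr rfl fun _ _ => by ring
  rw [e2, map_sum]
  have e3 : ∑ i ∈ Finset.range N, (σ ^ (N - i)) c * T.mulVec (v i) m =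
      ∑ i ∈ Finset.range N, σ ((σ ^ (N - (i + 1))) c * v (i + 1) m) := by
    refine Finset.sum_congr rfl fun i hi => ?_
    have hi := Finset.mem_range.1 hi
    rw [hstep i hi, map_mul, ← hfun', show N - (i + 1) + 1 = N - i by omega]
  rw [e3]
  have e4 := (Finset.sum_range_succ (fun i => σ ((σ ^ (N - i)) c * v i m)) N).symm.trans
    (Finset.sum_range_succ' (fun i => σ ((σ ^ (N - i)) c * v i m)) N)
  simp only [hv0, Nat.sub_zero, Nat.sub_self, hσ, pow_zero] at e4
  exact add_right_cancel e4

end SemilinearTransfer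

section TransferMatrix

variable {K : Type*} [Field K]

/-- The matrix of the recurrence `σ(a) y₂ = y₁ - a y₀` in the variables `(y₀, a y₁)`. -/
def transferMat (a : K) : Matrix (Fin 2) (Fin 2) K := !![0, a⁻¹; -a, a⁻¹]

theorem RingHom.pow_succ_apply_left {K : Type*} [Semiring K] (σ : K →+* K) (i : ℕ) (x : K) :
    (σ ^ (i + 1)) x = σ ((σ ^ i) x) := by rw [pow_succ']; rfl

theorem RingHom.pow_succ_apply_right {K : Type*} [Semiring K] (σ : K →+* K) (i : ℕ) (x : K) :
    (σ ^ (i + 1)) x = (σ ^ i) (σ x) := by rw [pow_succ]; rfl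

theorem transferMat_map (σ : K →+* K) (a : K) : (transferMat a).map ⇑σ = transferMat (σ a) := by
  ext i j
  fin_cases i <;> fin_cases j <;> simp [transferMat]

theorem twistedProd_transfer_zero (σ : K →+* K) (a : K) (i : ℕ) (m : Fin 2) :
    twistedProd σ (transferMat a) (i + 1) 0 m =
      ((σ ^ i) a)⁻¹ * twistedProd σ (transferMat a) i 1 m := by
  rw [twistedProd, transferMat_map]
  simp only [transferMat, Matrix.mul_apply, Fin.sum_univ_two, Matrix.of_apply, Matrix.cons_val',
    Matrix.cons_val_zero, Matrix.cons_val_one]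
  ring

theorem twistedProd_transfer_one (σ : K →+* K) (a : K) (i : ℕ) (m : Fin 2) :
    twistedProd σ (transferMat a) (i + 1) 1 m =
      -(σ ^ i) a * twistedProd σ (transferMat a) i 0 m +
      ((σ ^ i) a)⁻¹ * twistedProd σ (transferMat a) i 1 m := by
  rw [twistedProd, transferMat_map]
  simp only [transferMat, Matrix.mul_apply, Fin.sum_univ_two, Matrix.of_apply, Matrix.cons_val',
    Matrix.cons_val_zero, Matrix.cons_val_one]

theorem det_transferMat {a : K} (ha : a ≠ 0) : (transferMat a).det = 1 := by
  simp [transferMat, Matrix.det_fin_two_of, ha]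

theorem det_twistedProd_transfer (σ : K →+* K) {a : K} (ha : a ≠ 0) (i : ℕ) :
    (twistedProd σ (transferMat a) i).det = 1 := by
  induction i with
  | zero => simp [twistedProd]
  | succ i ih =>
    rw [twistedProd, Matrix.det_mul, ih, transferMat_map,
      det_transferMat ((map_ne_zero _).2 ha), mul_one]

/-- A twisted eigenvector of the transfer matrix is transported along the products. -/
theorem twistedProd_transfer_solution (σ : K →+* K) {a h t : K} (ha : a ≠ 0)
    (hker : σ a * h * σ h * σ (σ t) + a * t = h * σ t) (i : ℕ) :
    (∏ j ∈ Finset.range i, (σ ^ j) h) * (σ ^ i) t =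
        t * twistedProd σ (transferMat a) i 0 0 +
          a * h * σ t * twistedProd σ (transferMat a) i 0 1 ∧
    (σ ^ i) a * (∏ j ∈ Finset.range (i + 1), (σ ^ j) h) * (σ ^ (i + 1)) t =
        t * twistedProd σ (transferMat a) i 1 0 +
          a * h * σ t * twistedProd σ (transferMat a) i 1 1 := by
  induction i with
  | zero => simp [twistedProd]
  | succ i ih =>
    obtain ⟨h1, h2⟩ := ih
    have hb : (σ ^ i) a ≠ 0 := (map_ne_zero _).2 ha
    have hk := congrArg (⇑(σ ^ i)) hker
    simp only [map_add, map_mul, ← RingHom.pow_succ_apply_right] at hk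
    simp only [twistedProd_transfer_zero, twistedProd_transfer_one]
    constructor
    · have : (∏ j ∈ Finset.range (i + 1), (σ ^ j) h) * (σ ^ (i + 1)) t =
          ((σ ^ i) a)⁻¹ * ((σ ^ i) a * (∏ j ∈ Finset.range (i + 1), (σ ^ j) h) *
            (σ ^ (i + 1)) t) := by
        field_simp
      rw [this, h2]; ring
    · have e : (∏ j ∈ Finset.range (i + 1), (σ ^ j) h) * (σ ^ (i + 1)) t =
          ((σ ^ i) a)⁻¹ * ((σ ^ i) a * (∏ j ∈ Finset.range (i + 1), (σ ^ j) h) *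
            (σ ^ (i + 1)) t) := by
        field_simp
      have e2 : (σ ^ (i + 1)) a * (∏ j ∈ Finset.range (i + 1 + 1), (σ ^ j) h) *
          (σ ^ (i + 1 + 1)) t =
          -(σ ^ i) a * ((∏ j ∈ Finset.range i, (σ ^ j) h) * (σ ^ i) t) +
          (∏ j ∈ Finset.range (i + 1), (σ ^ j) h) * (σ ^ (i + 1)) t := by
        rw [Finset.prod_range_succ _ (i + 1), Finset.prod_range_succ _ i]
        linear_combination (∏ j ∈ Finset.range i, (σ ^ j) h) * hk
      rw [e2, e, h1, h2]; ring

theorem map_pow_eq_prod_sq_mul (σ : K →+* K) {c h : K} (hc : σ c = h ^ 2 * c) (i : ℕ) :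
    (σ ^ i) c = (∏ j ∈ Finset.range i, (σ ^ j) h) ^ 2 * c := by
  induction i with
  | zero => simp
  | succ i ih =>
    rw [RingHom.pow_succ_apply_right, hc, map_mul, map_pow, ih, Finset.prod_range_succ]
    ring

theorem twistedProd_transfer_zero_one (σ : K →+* K) {a h c t : K} (ha : a ≠ 0) (hh : h ≠ 0)
    (hc0 : c ≠ 0) (ht : t ≠ 0) (hc : σ c = h ^ 2 * c)
    (hker : σ a * h * σ h * σ (σ t) + a * t = h * σ t) (i : ℕ) :
    twistedProd σ (transferMat a) i 0 1 =
      (∏ j ∈ Finset.range i, (σ ^ j) h) * c * t * (σ ^ i) t *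
        ∑ j ∈ Finset.range i, (σ ^ j) (a * c * h * t * σ t)⁻¹ := by
  induction i with
  | zero => simp [twistedProd]
  | succ i ih =>
    obtain ⟨h1, h2⟩ := twistedProd_transfer_solution σ ha hker i
    have hdet := det_twistedProd_transfer σ ha i
    rw [Matrix.det_fin_two] at hdet
    have hb : (σ ^ i) a ≠ 0 := (map_ne_zero _).2 ha
    have hhi : (σ ^ i) h ≠ 0 := (map_ne_zero _).2 hh
    have hti : (σ ^ i) t ≠ 0 := (map_ne_zero _).2 ht
    have hti' : (σ ^ (i + 1)) t ≠ 0 := (map_ne_zero _).2 ht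
    have hH : (∏ j ∈ Finset.range i, (σ ^ j) h) ≠ 0 :=
      Finset.prod_ne_zero_iff.2 fun j _ => (map_ne_zero _).2 hh
    have hci := map_pow_eq_prod_sq_mul σ hc i
    rw [twistedProd_transfer_zero, Finset.sum_range_succ, mul_add]
    have e1 : (∏ j ∈ Finset.range i, (σ ^ j) h) * (σ ^ i) t *
        twistedProd σ (transferMat a) i 1 1 = t + twistedProd σ (transferMat a) i 0 1 *
        ((σ ^ i) a * (∏ j ∈ Finset.range (i + 1), (σ ^ j) h) * (σ ^ (i + 1)) t) := by
      rw [h1, h2]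
      linear_combination t * hdet
    have e2 : twistedProd σ (transferMat a) i 1 1 = ((∏ j ∈ Finset.range i, (σ ^ j) h) *
        (σ ^ i) t)⁻¹ * (t + twistedProd σ (transferMat a) i 0 1 *
        ((σ ^ i) a * (∏ j ∈ Finset.range (i + 1), (σ ^ j) h) * (σ ^ (i + 1)) t)) := by
      rw [← e1]; field_simp
    rw [e2, ih, map_inv₀]
    simp only [map_mul, ← RingHom.pow_succ_apply_right]
    rw [hci, Finset.prod_range_succ]
    field_simp
    ring

theorem sum_pow_map_eq (σ : K →+* K) {N : ℕ} (hσ : σ ^ N = 1) (x : K) :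
    ∑ i ∈ Finset.range N, (σ ^ i) (σ x) = ∑ i ∈ Finset.range N, (σ ^ i) x := by
  have e := (Finset.sum_range_succ (fun i => (σ ^ i) x) N).symm.trans
    (Finset.sum_range_succ' (fun i => (σ ^ i) x) N)
  simp only [hσ, pow_zero, RingHom.pow_succ_apply_right] at e
  exact (add_right_cancel e).symm

theorem sum_pow_transfer_eq (σ : K →+* K) (h3 : (3 : K) = 0) {a h c t : K} (ha : a ≠ 0)
    (hh : h ≠ 0) (hc0 : c ≠ 0) (ht : t ≠ 0) (hc : σ c = h ^ 2 * c)
    (hker : σ a * h * σ h * σ (σ t) + a * t = h * σ t) {w : ℕ}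
    (hw : ∀ x, (σ ^ w) x = x ^ 3) (hprod : ∏ j ∈ Finset.range w, (σ ^ j) h = c)
    {N : ℕ} (hσ : σ ^ N = 1) :
    ∑ i ∈ Finset.range N, (σ ^ i) (twistedProd σ (transferMat a) w 0 1 -
        twistedProd σ (transferMat a) w 0 0) =
      ∑ i ∈ Finset.range N, (σ ^ i) (a * c * h * t * σ t)⁻¹ := by
  set f := a * c * h * t * σ t with hf
  have hf0 : f ≠ 0 := by simp [hf, ha, hh, hc0, ht]
  obtain ⟨p1, -⟩ := twistedProd_transfer_solution σ ha hker w
  have p2 := twistedProd_transfer_zero_one σ ha hh hc0 ht hc hker w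
  rw [hprod, hw] at p1 p2
  rw [← hf] at p2
  set β := twistedProd σ (transferMat a) w 0 1
  set p := twistedProd σ (transferMat a) w 0 0
  set E := ∑ j ∈ Finset.range w, (σ ^ j) f⁻¹ with hE
  have hsE : σ E = E + (f⁻¹ ^ 3 - f⁻¹) := by
    have e := (Finset.sum_range_succ (fun i => (σ ^ i) f⁻¹) w).symm.trans
      (Finset.sum_range_succ' (fun i => (σ ^ i) f⁻¹) w)
    simp only [hw, pow_zero, RingHom.pow_succ_apply_left, ← map_sum] at e
    rw [← hE] at e
    have : (1 : K →+* K) f⁻¹ = f⁻¹ := rfl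
    rw [this] at e
    linear_combination -e
  -- `σ(c t²) = σ f + f`
  have hct : σ (c * t ^ 2) = σ f + f := by
    rw [hf]
    simp only [map_mul, map_pow, hc]
    linear_combination (-(h * c * σ t)) * hker
  have hβ : σ (β - p) = σ E * (f ^ 2 - (σ f) ^ 2) - σ f - f := by
    have hp : t ^ 2 * c * (β - p) = t ^ 2 * c * β + t * c * (a * h * σ t * β - c * t ^ 3) := by
      linear_combination (t * c) * p1
    have hp2 : t ^ 2 * c * (β - p) =
        t ^ 2 * c * ((c * t ^ 2) * (c * t ^ 2 + f) * E - c * t ^ 2) := by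
      rw [hp, p2, hf]; ring
    have hp3 : β - p = (c * t ^ 2) * (c * t ^ 2 + f) * E - c * t ^ 2 :=
      mul_left_cancel₀ (by simp [hc0, ht]) hp2
    rw [hp3]
    have : σ ((c * t ^ 2) * (c * t ^ 2 + f) * E - c * t ^ 2) =
        σ (c * t ^ 2) * (σ (c * t ^ 2) + σ f) * σ E - σ (c * t ^ 2) := by
      simp only [map_mul, map_add, map_sub]
    rw [this, hct]
    linear_combination (σ E * (σ f + f) * σ f) * h3
  have hτ := sum_pow_map_eq σ hσ
  rw [← hτ (β - p), hβ]
  have h4 : σ E * (f ^ 2 - σ f ^ 2) - σ f - f =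
      E * f ^ 2 - σ (E * f ^ 2) + (f⁻¹ - f) - σ f - f := by
    rw [map_mul σ E, map_pow σ f, hsE]
    have : f⁻¹ * f = 1 := inv_mul_cancel₀ hf0
    linear_combination (f⁻¹ * (f⁻¹ * f + 1) - f) * this
  rw [h4]
  simp only [map_sub, map_add, Finset.sum_sub_distrib, Finset.sum_add_distrib]
  rw [hτ, hτ]
  linear_combination (-∑ i ∈ Finset.range N, (σ ^ i) f) * h3

/-- Existence of twisted eigenvectors of the transfer matrix. -/
theorem exists_kernel_of_twistedProd (σ : K →+* K) {N : ℕ} (hN0 : 0 < N) (hσ : σ ^ N = 1)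
    (hinj : ∀ i j, i < N → j < N → σ ^ i = σ ^ j → i = j) {a h : K} (ha : a ≠ 0) (hh : h ≠ 0)
    (X : Fin 2 → K) (hX : X ≠ 0)
    (hfix : (twistedProd σ (transferMat a) N).mulVec X =
      (∏ j ∈ Finset.range N, (σ ^ j) h) • X) :
    ∃ t : K, t ≠ 0 ∧ σ a * h * σ h * σ (σ t) + a * t = h * σ t := by
  have hP : ∀ i, twistedProd σ (h⁻¹ • transferMat a) i =
      (∏ j ∈ Finset.range i, (σ ^ j) h)⁻¹ • twistedProd σ (transferMat a) i := by
    intro i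
    induction i with
    | zero => simp [twistedProd]
    | succ i ih =>
      have : (h⁻¹ • transferMat a).map ⇑(σ ^ i) =
          ((σ ^ i) h)⁻¹ • (transferMat a).map ⇑(σ ^ i) := by
        ext l m
        simp only [Matrix.map_apply, Matrix.smul_apply, smul_eq_mul, map_mul, map_inv₀]
      rw [twistedProd, twistedProd, ih, this, Finset.prod_range_succ, Matrix.smul_mul,
        Matrix.mul_smul, smul_smul, mul_inv, mul_comm]
  have hH : (∏ j ∈ Finset.range N, (σ ^ j) h) ≠ 0 :=
    Finset.prod_ne_zero_iff.2 fun j _ => (map_ne_zero _).2 hh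
  obtain ⟨Y, hY0, hY⟩ := exists_semilinear_solution σ hN0 hσ hinj (h⁻¹ • transferMat a) X hX (by
    rw [hP, Matrix.smul_mulVec, hfix, smul_smul, inv_mul_cancel₀ hH, one_smul])
  have y0 := congrFun hY 0
  have y1 := congrFun hY 1
  simp only [transferMat, Matrix.mulVec, dotProduct, Fin.sum_univ_two, Matrix.smul_apply,
    Matrix.of_apply, Matrix.cons_val', Matrix.cons_val_zero, Matrix.cons_val_one,
    smul_eq_mul, mul_zero, zero_mul, zero_add] at y0 y1
  refine ⟨Y 0, fun h0 => hY0 ?_, ?_⟩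
  · rw [h0, map_zero] at y0
    have : Y 1 = 0 := by
      simpa [ha, hh] using y0.symm
    funext l
    fin_cases l <;> simp [h0, this]
  · have y2 : h * a * σ (Y 0) = Y 1 := by rw [y0]; field_simp
    have y3 : h * σ (Y 1) = -a * Y 0 + h * σ (Y 0) := by rw [y1, y0]; field_simp
    rw [← y2] at y3
    simp only [map_mul] at y3
    linear_combination y3

end TransferMatrix

section TraceCharacter

theorem omega3_pow_three : omega3 ^ 3 = 1 := by
  rw [omega3, ← Complex.exp_nat_mul, ← Complex.exp_two_pi_mul_I]
  congr 1
  push_cast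
  ring

theorem omega3_eq : omega3 = -1 / 2 + (Real.sqrt 3 / 2 : ℝ) * Complex.I := by
  rw [omega3, show (2 * Real.pi * Complex.I / 3 : ℂ) = ((2 * Real.pi / 3 : ℝ) : ℂ) * Complex.I by
    push_cast; ring, Complex.exp_mul_I, ← Complex.ofReal_cos, ← Complex.ofReal_sin,
    show (2 * Real.pi / 3 : ℝ) = Real.pi - Real.pi / 3 by ring, Real.cos_pi_sub,
    Real.sin_pi_sub, Real.cos_pi_div_three, Real.sin_pi_div_three]
  push_cast
  ring

theorem omega3_ne_one : omega3 ≠ 1 := by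
  intro h
  have := congrArg Complex.re (omega3_eq.symm.trans h)
  simp at this
  norm_num at this

theorem one_add_omega3_add_sq : 1 + omega3 + omega3 ^ 2 = 0 := by
  have h : (omega3 - 1) * (1 + omega3 + omega3 ^ 2) = 0 := by
    linear_combination omega3_pow_three
  exact (mul_eq_zero.1 h).resolve_left (sub_ne_zero.2 omega3_ne_one)

variable (F : Type*) [Field F] [Fintype F] [Algebra (ZMod 3) F]

/-- The canonical additive character `x ↦ ω₃ ^ Tr x`. -/
noncomputable def traceChar : AddChar F ℂ :=
  (AddChar.zmodChar 3 omega3_pow_three).compAddMonoidHom (Algebra.trace (ZMod 3) F).toAddMonoidHom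

variable {F}

theorem traceChar_apply (x : F) : traceChar F x = omega3 ^ (Algebra.trace (ZMod 3) F x).val := by
  simp [traceChar, AddChar.compAddMonoidHom_apply, AddChar.zmodChar_apply]

theorem charP_three (F : Type*) [Field F] [Algebra (ZMod 3) F] : CharP F 3 :=
  charP_of_injective_algebraMap (algebraMap (ZMod 3) F).injective 3

theorem three_eq_zero (F : Type*) [Field F] [Algebra (ZMod 3) F] : (3 : F) = 0 := by
  have := charP_three F
  exact_mod_cast CharP.cast_eq_zero F 3

/-- The `k`-th power of the Frobenius map `x ↦ x ^ 3`. -/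
noncomputable def frobPow (F : Type*) [Field F] [Algebra (ZMod 3) F] (k : ℕ) : F →+* F :=
  haveI := charP_three F
  iterateFrobenius F 3 k

theorem frobPow_apply (F : Type*) [Field F] [Algebra (ZMod 3) F] (k : ℕ) (x : F) :
    frobPow F k x = x ^ 3 ^ k := by
  have := charP_three F
  simp [frobPow, iterateFrobenius_def]

theorem frobPow_pow_apply (F : Type*) [Field F] [Algebra (ZMod 3) F] (k i : ℕ) (x : F) :
    (frobPow F k ^ i) x = x ^ 3 ^ (k * i) := by
  induction i with
  | zero => simp
  | succ i ih =>
    rw [RingHom.pow_succ_apply_left, ih, frobPow_apply, ← pow_mul, ← pow_add, mul_add, mul_one]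

theorem trace_pow_three (x : F) :
    Algebra.trace (ZMod 3) F (x ^ 3) = Algebra.trace (ZMod 3) F x := by
  have h := Algebra.trace_eq_of_algEquiv
    (FiniteField.frobeniusAlgEquivOfAlgebraic (ZMod 3) F) x
  simpa [ZMod.card] using h

theorem trace_frobPow (k : ℕ) (x : F) :
    Algebra.trace (ZMod 3) F (frobPow F k x) = Algebra.trace (ZMod 3) F x := by
  rw [frobPow_apply]
  induction k with
  | zero => simp
  | succ k ih => rw [pow_succ, pow_mul, trace_pow_three, ih]

theorem traceChar_frobPow (k : ℕ) (x : F) : traceChar F (frobPow F k x) = traceChar F x := by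
  rw [traceChar_apply, trace_frobPow, traceChar_apply]

theorem traceChar_eq_of_frobPow (k : ℕ) {x y : F} (z : F) (h : x - y = frobPow F k z - z) :
    traceChar F x = traceChar F y := by
  rw [traceChar_apply, traceChar_apply, show x = y + (frobPow F k z - z) by linear_combination h,
    map_add, map_sub, trace_frobPow, sub_self, add_zero]

theorem traceChar_cube (x : F) : traceChar F x ^ 3 = 1 := by
  rw [traceChar_apply, ← pow_mul, mul_comm, pow_mul, omega3_pow_three, one_pow]

theorem norm_traceChar (x : F) : ‖traceChar F x‖ = 1 := by
  have := congrArg norm (traceChar_cube x)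
  rw [norm_pow, norm_one] at this
  exact (pow_eq_one_iff_of_nonneg (norm_nonneg _) (by norm_num)).1 this

theorem traceChar_neg (x : F) : traceChar F (-x) = starRingEnd ℂ (traceChar F x) :=
  AddChar.map_neg_eq_conj _ x

theorem traceChar_isPrimitive : (traceChar F).IsPrimitive := by
  apply AddChar.IsPrimitive.of_ne_one
  intro h
  obtain ⟨x, hx⟩ : ∃ x : F, Algebra.trace (ZMod 3) F x = 1 := Algebra.trace_surjective _ _ 1
  have h1 := DFunLike.congr_fun h x
  rw [traceChar_apply, hx] at h1
  simp only [AddChar.one_apply] at h1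
  have : (1 : ZMod 3).val = 1 := rfl
  rw [this, pow_one] at h1
  exact omega3_ne_one h1

theorem sum_traceChar_mul (b : F) [Decidable (b = 0)] :
    ∑ x, traceChar F (x * b) = if b = 0 then (Fintype.card F : ℂ) else 0 := by
  classical
  rw [AddChar.sum_mulShift b traceChar_isPrimitive]
  split_ifs <;> simp

end TraceCharacter

section QuadraticSums

theorem ringChar_ne_two (F : Type*) [Field F] [Algebra (ZMod 3) F] : ringChar F ≠ 2 := by
  have := charP_three F
  rw [ringChar.eq F 3]; norm_num

theorem two_ne_zero_of_three (F : Type*) [Field F] [Algebra (ZMod 3) F] : (2 : F) ≠ 0 :=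
  Ring.two_ne_zero (ringChar_ne_two F)

theorem one_ne_neg_one_of_three (F : Type*) [Field F] [Algebra (ZMod 3) F] : (1 : F) ≠ -1 := by
  intro h
  exact two_ne_zero_of_three F (by linear_combination h)

variable {F : Type*} [Field F]

theorem qchar_mul_sq (a : F) {u : F} (hu : u ≠ 0) : qchar (a * u ^ 2) = qchar a := by
  have : IsSquare (a * u ^ 2) ↔ IsSquare a := by
    constructor
    · rintro ⟨r, hr⟩
      exact ⟨r / u, by field_simp; linear_combination hr⟩
    · rintro ⟨r, hr⟩
      exact ⟨r * u, by rw [hr]; ring⟩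
  unfold qchar
  by_cases h : IsSquare a <;> simp [this, h]

theorem qchar_sq (a : F) : qchar a ^ 2 = 1 := by
  unfold qchar; split_ifs <;> norm_num

theorem qchar_cast_sq (a : F) : (qchar a : ℂ) ^ 2 = 1 := by
  exact_mod_cast congrArg (Int.cast : ℤ → ℂ) (qchar_sq a)

theorem qchar_eq_quadraticChar [Fintype F] [DecidableEq F] {a : F} (ha : a ≠ 0) :
    qchar a = quadraticChar F a := by
  rw [quadraticChar_apply, quadraticCharFun, if_neg ha, qchar]
  by_cases h : IsSquare a <;> simp [h]

theorem qchar_mul_nonsquare [Fintype F] {a c : F} (ha : a ≠ 0) (hc : ¬IsSquare c) :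
    qchar (a * c) = -qchar a := by
  classical
  have hc0 : c ≠ 0 := by rintro rfl; exact hc ⟨0, by simp⟩
  rw [qchar_eq_quadraticChar (mul_ne_zero ha hc0), map_mul, ← qchar_eq_quadraticChar ha,
    ← qchar_eq_quadraticChar hc0]
  simp [qchar, hc]

theorem sum_comp_sq [Fintype F] [DecidableEq F] (hF : ringChar F ≠ 2) (f : F → ℂ) :
    ∑ y, f (y ^ 2) = ∑ x, ((quadraticChar F x : ℂ) + 1) * f x := by
  rw [← Finset.sum_fiberwise (Finset.univ : Finset F) (fun y => y ^ 2)]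
  refine Finset.sum_congr rfl fun x _ => ?_
  rw [Finset.sum_congr rfl (g := fun _ => f x) (fun y hy => by
    rw [(Finset.mem_filter.1 hy).2]), Finset.sum_const, nsmul_eq_mul]
  congr 1
  have h := quadraticChar_card_sqrts hF x
  have h2 : ({y : F | y ^ 2 = x}.toFinset) = Finset.univ.filter (fun y => y ^ 2 = x) := by
    ext; simp
  rw [h2] at h
  exact_mod_cast congrArg (Int.cast : ℤ → ℂ) h

theorem sum_comp_sq_add_nonsquare [Fintype F] (hF : ringChar F ≠ 2) {c : F} (hc : ¬IsSquare c)
    (f : F → ℂ) : ∑ y, f (y ^ 2) + ∑ y, f (c * y ^ 2) = 2 * ∑ x, f x := by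
  classical
  have hc0 : c ≠ 0 := by rintro rfl; exact hc ⟨0, by simp⟩
  rw [sum_comp_sq hF f, sum_comp_sq hF (fun x => f (c * x))]
  have : ∑ x, ((quadraticChar F x : ℂ) + 1) * f (c * x) =
      ∑ x, (-(quadraticChar F x : ℂ) + 1) * f x := by
    refine Fintype.sum_equiv (Equiv.mulLeft₀ c hc0) _ _ fun x => ?_
    simp only [Equiv.mulLeft₀_apply, map_mul]
    have h : quadraticChar F c = -1 := by
      rw [← qchar_eq_quadraticChar hc0, qchar, if_neg hc]
    rw [h]; push_cast; ring
  rw [this, Finset.mul_sum, ← Finset.sum_add_distrib]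
  exact Finset.sum_congr rfl fun x _ => by ring

variable [Fintype F] [Algebra (ZMod 3) F]

variable (F) in
/-- The quadratic Gauss sum of the canonical additive character. -/
noncomputable def traceGauss : ℂ := ∑ x : F, traceChar F (x ^ 2)

theorem sum_traceChar : ∑ x, traceChar F x = 0 := by
  classical
  simpa using sum_traceChar_mul (F := F) 1

theorem sum_traceChar_mul_sq {f : F} (hf : f ≠ 0) :
    ∑ x, traceChar F (f * x ^ 2) = qchar f * traceGauss F := by
  by_cases h : IsSquare f
  · obtain ⟨r, rfl⟩ := h
    have hr : r ≠ 0 := by rintro rfl; simp at hf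
    have h1 : qchar (r * r) = 1 := by simp [qchar]
    rw [h1, traceGauss]
    push_cast
    rw [one_mul]
    exact Fintype.sum_equiv (Equiv.mulLeft₀ r hr) _ _ fun x => by
      simp only [Equiv.mulLeft₀_apply]; congr 1; ring
  · have h1 := sum_comp_sq_add_nonsquare (ringChar_ne_two F) h (traceChar F)
    rw [sum_traceChar, mul_zero] at h1
    rw [qchar, if_neg h, traceGauss]
    push_cast
    linear_combination h1

theorem sum_traceChar_quadratic {f : F} (hf : f ≠ 0) (b : F) :
    ∑ x, traceChar F (f * x ^ 2 + b * x) =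
      qchar f * traceGauss F * traceChar F (-(b ^ 2 * f⁻¹)) := by
  rw [← sum_traceChar_mul_sq hf, Finset.sum_mul]
  refine Fintype.sum_equiv (Equiv.subRight (b * f⁻¹)) _ _ fun x => ?_
  rw [← AddChar.map_add_eq_mul, Equiv.subRight_apply]
  congr 1
  have h3 := three_eq_zero F
  field_simp
  linear_combination (b * f * x) * h3

end QuadraticSums

section CoulterMatthews

theorem three_pow_odd_mod {k : ℕ} (hk : Odd k) : ∃ t, 3 ^ k = 8 * t + 3 := by
  obtain ⟨m, rfl⟩ := hk
  have : 3 ^ (2 * m + 1) % 8 = 3 := by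
    rw [pow_succ, pow_mul, Nat.mul_mod, Nat.pow_mod]; norm_num
  exact ⟨3 ^ (2 * m + 1) / 8, by
    have h := Nat.div_add_mod (3 ^ (2 * m + 1)) 8
    rw [this] at h
    exact h.symm⟩

variable {F : Type*} [Field F] [Algebra (ZMod 3) F]

theorem frobPow_bijective [Finite F] (k : ℕ) : Function.Bijective (frobPow F k) :=
  Finite.injective_iff_bijective.1 (frobPow F k).injective

theorem mul_frobPow_eq_sq {k : ℕ} (hk : Odd k) (u : F) :
    u * frobPow F k u = (u ^ 2) ^ ((3 ^ k + 1) / 2) := by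
  obtain ⟨t, ht⟩ := three_pow_odd_mod hk
  rw [frobPow_apply, ← pow_succ', ← pow_mul]
  congr 1; omega

theorem pow_half_succ {k : ℕ} (hk : Odd k) (c : F) :
    c ^ ((3 ^ k + 1) / 2) = c * c ^ ((3 ^ k - 1) / 2) := by
  obtain ⟨t, ht⟩ := three_pow_odd_mod hk
  rw [← pow_succ']
  congr 1; omega

theorem frobPow_eq_half_sq {k : ℕ} (hk : Odd k) (c : F) :
    frobPow F k c = (c ^ ((3 ^ k - 1) / 2)) ^ 2 * c := by
  obtain ⟨t, ht⟩ := three_pow_odd_mod hk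
  rw [frobPow_apply, ← pow_mul, ← pow_succ]
  congr 1; omega

theorem qchar_mul_pow {k : ℕ} (hk : Odd k) (a : F) {c : F} (hc : c ≠ 0) :
    qchar (a * c ^ ((3 ^ k + 1) / 2)) = qchar a := by
  obtain ⟨t, ht⟩ := three_pow_odd_mod hk
  rw [show (3 ^ k + 1) / 2 = (2 * t + 1) * 2 by omega, pow_mul]
  exact qchar_mul_sq a (pow_ne_zero _ hc)

theorem eq_of_frobPow_eq_self [Fintype F] {n k : ℕ} (hcop : Nat.Coprime n k)
    (hcard : Fintype.card F = 3 ^ n) {x : F} (hx : frobPow F k x = x) :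
    x = 0 ∨ x = 1 ∨ x = -1 := by
  by_cases h0 : x = 0
  · exact Or.inl h0
  right
  have h1 : x ^ (3 ^ k - 1) = 1 := by
    apply mul_left_cancel₀ h0
    rw [← pow_succ', Nat.sub_add_cancel (Nat.one_le_pow _ _ (by norm_num)), ← frobPow_apply, hx, mul_one]
  have h2 : x ^ (3 ^ n - 1) = 1 := by
    rw [← hcard]; exact FiniteField.pow_card_sub_one_eq_one x h0
  have h3 : x ^ (Nat.gcd (3 ^ n - 1) (3 ^ k - 1)) = 1 := pow_gcd_eq_one.2 ⟨h2, h1⟩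
  rw [Nat.pow_sub_one_gcd_pow_sub_one, hcop.gcd_eq_one] at h3
  have h4 : (x - 1) * (x + 1) = 0 := by
    norm_num at h3
    rcases h3 with rfl | rfl <;> ring
  rcases mul_eq_zero.1 h4 with h | h
  · exact Or.inl (by linear_combination h)
  · exact Or.inr (by linear_combination h)

/-- A nonzero vector of the radical of `y ↦ Tr (a y^(3^k+1) + lam y^2)`. -/
def InRadical (k : ℕ) (a lam u : F) : Prop :=
  u ≠ 0 ∧ frobPow F k a * frobPow F k (frobPow F k u) + a * u = frobPow F k lam * frobPow F k u

variable [Fintype F]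

/-- The exponential sum of `a x^d + lam x`, where `d = (3^k+1)/2`. -/
noncomputable def cmSum (k : ℕ) (a lam : F) : ℂ :=
  ∑ x, traceChar F (a * x ^ ((3 ^ k + 1) / 2) + lam * x)

/-- The exponential sum of the quadratic form `a y^(3^k+1) + lam y^2`. -/
noncomputable def cmQuad (k : ℕ) (a lam : F) : ℂ :=
  ∑ y, traceChar F (a * (y * frobPow F k y) + lam * y ^ 2)

theorem two_mul_cmSum {k : ℕ} (hk : Odd k) (a lam : F) {c : F} (hc : ¬IsSquare c) :
    2 * cmSum k a lam = cmQuad k a lam + cmQuad k (a * c ^ ((3 ^ k + 1) / 2)) (c * lam) := by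
  rw [cmSum, ← sum_comp_sq_add_nonsquare (ringChar_ne_two F) hc]
  congr 1
  · refine Finset.sum_congr rfl fun y _ => ?_
    rw [mul_frobPow_eq_sq hk]
  · refine Finset.sum_congr rfl fun y _ => ?_
    rw [mul_frobPow_eq_sq hk, mul_pow c]
    congr 1; ring

theorem cmSum_scale (k : ℕ) (a lam : F) {c : F} (hc : c ≠ 0) :
    cmSum k (a * c ^ ((3 ^ k + 1) / 2)) (c * lam) = cmSum k a lam := by
  refine Fintype.sum_equiv (Equiv.mulLeft₀ c hc) _ _ fun x => ?_
  simp only [Equiv.mulLeft₀_apply]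
  congr 1; ring

theorem sum_comp_sub_frobPow {n k : ℕ} (hcop : Nat.Coprime n k)
    (hcard : Fintype.card F = 3 ^ n) (Φ : F → ℂ) :
    ∑ z, Φ (z - frobPow F k z) = ∑ x, Φ x * (1 + traceChar F x + traceChar F (-x)) := by
  classical
  have hq : (Fintype.card F : ℂ) ≠ 0 := by simp
  apply mul_left_cancel₀ hq
  have h1 : ∀ z, (Fintype.card F : ℂ) * Φ (z - frobPow F k z) =
      ∑ x, ∑ b, Φ x * (traceChar F (-x * b) * traceChar F (b * (z - frobPow F k z))) := by
    intro z
    simp_rw [← Finset.mul_sum]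
    rw [Finset.sum_eq_single (z - frobPow F k z)]
    · rw [mul_comm]
      congr 1
      rw [← Finset.card_univ, Finset.cast_card]
      refine Finset.sum_congr rfl fun b _ => ?_
      rw [← AddChar.map_add_eq_mul, show -(z - frobPow F k z) * b + b * (z - frobPow F k z) = 0 by
        ring, AddChar.map_zero_eq_one]
    · intro x _ hx
      have := sum_traceChar_mul (z - frobPow F k z - x)
      rw [if_neg (sub_ne_zero.2 (Ne.symm hx))] at this
      rw [← mul_zero (Φ x), ← this]
      congr 1
      refine Finset.sum_congr rfl fun b _ => ?_
      rw [← AddChar.map_add_eq_mul]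
      congr 1; ring
    · simp
  have h2 : ∀ b : F, ∑ z, traceChar F (b * (z - frobPow F k z)) =
      if frobPow F k b - b = 0 then (Fintype.card F : ℂ) else 0 := by
    intro b
    rw [← sum_traceChar_mul (frobPow F k b - b)]
    refine Fintype.sum_equiv (Equiv.ofBijective _ (frobPow_bijective k)) _ _ fun z => ?_
    rw [Equiv.ofBijective_apply]
    refine traceChar_eq_of_frobPow k (-(b * z)) ?_
    simp only [map_neg, map_mul]; ring
  rw [Finset.mul_sum, Finset.sum_congr rfl fun z _ => h1 z, Finset.sum_comm, Finset.mul_sum]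
  refine Finset.sum_congr rfl fun x _ => ?_
  rw [Finset.sum_comm]
  simp_rw [← Finset.mul_sum, h2]
  have hfix : (Finset.univ.filter fun b : F => frobPow F k b - b = 0) = {0, 1, -1} := by
    ext b
    simp only [Finset.mem_filter, Finset.mem_univ, true_and, Finset.mem_insert,
      Finset.mem_singleton, sub_eq_zero]
    constructor
    · exact eq_of_frobPow_eq_self hcop hcard
    · rintro (rfl | rfl | rfl) <;> simp
  simp only [mul_ite, mul_zero]
  rw [← Finset.sum_filter, hfix, Finset.sum_insert, Finset.sum_insert, Finset.sum_singleton]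
  · simp only [mul_zero, AddChar.map_zero_eq_one, mul_one, mul_neg, neg_neg]
    ring
  · simpa using one_ne_neg_one_of_three F
  · simp

theorem cmQuad_scale_eq {k : ℕ} (hk : Odd k) {a lam u : F} (hu : InRadical k a lam u) (c : F) :
    cmQuad k (a * c ^ ((3 ^ k + 1) / 2)) (c * lam) =
      ∑ z, traceChar F (c * (a * (u * frobPow F k u)) *
        (z - c ^ ((3 ^ k - 1) / 2) * frobPow F k z) ^ 2) := by
  obtain ⟨hu0, hu⟩ := hu
  symm
  refine Fintype.sum_equiv (Equiv.mulLeft₀ u hu0) _ _ fun z => ?_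
  rw [Equiv.mulLeft₀_apply, pow_half_succ hk]
  have hc := frobPow_eq_half_sq hk c
  generalize c ^ ((3 ^ k - 1) / 2) = h at *
  refine traceChar_eq_of_frobPow k (c * lam * u ^ 2 * z ^ 2 - c * (a * (u * frobPow F k u)) * z ^ 2)
    ?_
  have h3 := three_eq_zero F
  simp only [map_sub, map_mul, map_pow, hc]
  linear_combination (h ^ 2 * c * frobPow F k u * (frobPow F k z) ^ 2) * hu -
    (a * c * h * u * frobPow F k u * z * frobPow F k z) * h3

theorem qchar_radical {k : ℕ} (hk : Odd k) (a : F) {u : F} (hu : u ≠ 0) :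
    qchar (a * (u * frobPow F k u)) = qchar a := by
  rw [mul_frobPow_eq_sq hk]; exact qchar_mul_pow hk a (pow_ne_zero 2 hu)

theorem cmQuad_of_radical {n k : ℕ} (hk : Odd k) (hcop : Nat.Coprime n k)
    (hcard : Fintype.card F = 3 ^ n) {a lam u : F} (ha : a ≠ 0) (hu : InRadical k a lam u) :
    cmQuad k a lam = qchar a * traceGauss F *
      (1 + 2 * traceChar F (-(a * (u * frobPow F k u))⁻¹)) := by
  have h := cmQuad_scale_eq hk hu 1
  simp only [one_pow, mul_one, one_mul] at h
  rw [h, sum_comp_sub_frobPow hcop hcard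
    (fun x => traceChar F (a * (u * frobPow F k u) * x ^ 2))]
  have hf : a * (u * frobPow F k u) ≠ 0 :=
    mul_ne_zero ha (mul_ne_zero hu.1 ((map_ne_zero _).2 hu.1))
  have q0 := sum_traceChar_mul_sq hf
  have q1 := sum_traceChar_quadratic hf 1
  have q2 := sum_traceChar_quadratic hf (-1)
  rw [qchar_radical hk a hu.1] at q0 q1 q2
  simp only [AddChar.map_add_eq_mul, one_mul, neg_mul, even_two.neg_pow, one_pow] at q1 q2
  simp only [mul_add, mul_one, Finset.sum_add_distrib, q0, q1, q2]
  ring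

theorem cmQuad_nonsquare_of_radical {n k : ℕ} (hk : Odd k) (hcop : Nat.Coprime n k)
    (hcard : Fintype.card F = 3 ^ n) {a lam u c : F} (ha : a ≠ 0) (hu : InRadical k a lam u)
    (hc : ¬IsSquare c) :
    cmQuad k (a * c ^ ((3 ^ k + 1) / 2)) (c * lam) = -(qchar a * traceGauss F) := by
  have hc0 : c ≠ 0 := by rintro rfl; exact hc ⟨0, by simp⟩
  have hf : a * (u * frobPow F k u) ≠ 0 :=
    mul_ne_zero ha (mul_ne_zero hu.1 ((map_ne_zero _).2 hu.1))
  rw [cmQuad_scale_eq hk hu c]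
  have hinj : Function.Injective (fun z => z - c ^ ((3 ^ k - 1) / 2) * frobPow F k z) := by
    intro x y hxy
    simp only at hxy
    by_contra hne
    have hz0 : x - y ≠ 0 := sub_ne_zero.2 hne
    have hz : x - y = c ^ ((3 ^ k - 1) / 2) * frobPow F k (x - y) := by
      rw [map_sub]; linear_combination hxy
    generalize x - y = z at *
    have hfix : frobPow F k (c * z ^ 2) = c * z ^ 2 := by
      rw [map_mul, map_pow, frobPow_eq_half_sq hk]
      linear_combination (-c * (z + c ^ ((3 ^ k - 1) / 2) * frobPow F k z)) * hz
    rcases eq_of_frobPow_eq_self hcop hcard hfix with h | h | h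
    · exact mul_ne_zero hc0 (pow_ne_zero 2 hz0) h
    · exact hc ⟨z⁻¹, by field_simp; linear_combination h⟩
    · have h1 : (c * z ^ 2) ^ ((3 ^ k - 1) / 2) = 1 := by
        obtain ⟨t, ht⟩ := three_pow_odd_mod hk
        apply mul_left_cancel₀ hz0
        have h2 : z * (z ^ 2) ^ ((3 ^ k - 1) / 2) = frobPow F k z := by
          rw [frobPow_apply, ← pow_mul, ← pow_succ']
          congr 1; omega
        rw [mul_pow, mul_one]
        linear_combination c ^ ((3 ^ k - 1) / 2) * h2 - hz
      rw [h] at h1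
      obtain ⟨t, ht⟩ := three_pow_odd_mod hk
      rw [show (3 ^ k - 1) / 2 = 2 * (2 * t) + 1 by omega, pow_succ, pow_mul] at h1
      simp only [even_two.neg_pow, one_pow, one_mul] at h1
      exact one_ne_neg_one_of_three F h1.symm
  have h1 := Fintype.sum_equiv (Equiv.ofBijective _ (Finite.injective_iff_bijective.1 hinj))
    (fun z => traceChar F (c * (a * (u * frobPow F k u)) *
        (z - c ^ ((3 ^ k - 1) / 2) * frobPow F k z) ^ 2))
    (fun x => traceChar F (c * (a * (u * frobPow F k u)) * x ^ 2)) (fun z => rfl)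
  rw [h1, sum_traceChar_mul_sq (mul_ne_zero hc0 hf), mul_comm c, qchar_mul_nonsquare hf hc,
    qchar_radical hk a hu.1]
  push_cast; ring

theorem cmSum_of_radical {n k : ℕ} (hk : Odd k) (hcop : Nat.Coprime n k)
    (hcard : Fintype.card F = 3 ^ n) {a lam u : F} (ha : a ≠ 0) (hu : InRadical k a lam u) :
    cmSum k a lam = qchar a * traceGauss F * traceChar F (-(a * (u * frobPow F k u))⁻¹) := by
  obtain ⟨c, hc⟩ := FiniteField.exists_nonsquare (ringChar_ne_two F)
  have h := two_mul_cmSum hk a lam hc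
  rw [cmQuad_of_radical hk hcop hcard ha hu,
    cmQuad_nonsquare_of_radical hk hcop hcard ha hu hc] at h
  linear_combination h / 2

theorem cmQuad_mul_conj {k : ℕ} {a lam : F} (h : ∀ u, ¬InRadical k a lam u) :
    cmQuad k a lam * starRingEnd ℂ (cmQuad k a lam) = Fintype.card F := by
  classical
  set Q : F → F := fun y => a * (y * frobPow F k y) + lam * y ^ 2 with hQ
  set L : F → F := fun v => frobPow F k a * frobPow F k (frobPow F k v) + a * v -
    frobPow F k lam * frobPow F k v with hL
  have h1 : cmQuad k a lam * starRingEnd ℂ (cmQuad k a lam) =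
      ∑ z, ∑ v, traceChar F (Q v) * traceChar F (frobPow F k z * L v) := by
    rw [cmQuad, map_sum, Finset.sum_mul_sum, Finset.sum_comm]
    refine Finset.sum_congr rfl fun z _ => ?_
    refine Fintype.sum_equiv (Equiv.subRight z) _ _ fun y => ?_
    rw [← traceChar_neg, ← AddChar.map_add_eq_mul, ← AddChar.map_add_eq_mul, Equiv.subRight_apply]
    obtain ⟨v, rfl⟩ : ∃ v, y = v + z := ⟨y - z, by ring⟩
    rw [add_sub_cancel_right]
    refine traceChar_eq_of_frobPow k (-(a * z * frobPow F k v) + lam * z * v) ?_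
    have h3 := three_eq_zero F
    simp only [hQ, hL, map_add, map_mul, map_neg]
    linear_combination (lam * v * z) * h3
  rw [h1, Finset.sum_comm]
  simp_rw [← Finset.mul_sum]
  have h2 : ∀ v, ∑ z, traceChar F (frobPow F k z * L v) =
      if v = 0 then (Fintype.card F : ℂ) else 0 := by
    intro v
    have e := Fintype.sum_equiv (Equiv.ofBijective _ (frobPow_bijective (F := F) k))
      (fun z => traceChar F (frobPow F k z * L v)) (fun z => traceChar F (z * L v)) (fun z => rfl)
    rw [e, sum_traceChar_mul]
    by_cases hv : v = 0
    · simp [hv, hL]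
    · rw [if_neg hv, if_neg]
      intro h0
      exact h v ⟨hv, by simp only [hL] at h0; linear_combination h0⟩
  simp_rw [h2]
  simp [hQ]

theorem norm_sq_cmQuad {k : ℕ} {a lam : F} (h : ∀ u, ¬InRadical k a lam u) :
    ‖cmQuad k a lam‖ ^ 2 = Fintype.card F := by
  have := cmQuad_mul_conj h
  rw [Complex.mul_conj] at this
  rw [← Complex.normSq_eq_norm_sq]
  exact_mod_cast this

theorem traceGauss_eq_cmQuad : traceGauss F = cmQuad 0 (0 : F) 1 := by
  simp [traceGauss, cmQuad]

theorem not_isRadical_zero_one (k : ℕ) (u : F) : ¬InRadical k 0 1 u := by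
  rintro ⟨h0, h⟩
  rw [map_zero, map_one, zero_mul, zero_mul, add_zero, one_mul] at h
  exact h0 ((map_eq_zero _).1 h.symm)

theorem traceGauss_mul_conj : traceGauss F * starRingEnd ℂ (traceGauss F) = Fintype.card F := by
  rw [traceGauss_eq_cmQuad]
  exact cmQuad_mul_conj (not_isRadical_zero_one 0)

theorem norm_sq_traceGauss : ‖traceGauss F‖ ^ 2 = Fintype.card F := by
  rw [traceGauss_eq_cmQuad]
  exact norm_sq_cmQuad (not_isRadical_zero_one 0)

theorem traceGauss_ne_zero : traceGauss F ≠ 0 := by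
  intro h
  have := traceGauss_mul_conj (F := F)
  rw [h, zero_mul] at this
  exact Nat.cast_ne_zero.2 Fintype.card_ne_zero this.symm

end CoulterMatthews

section RadicalCounting

variable {F : Type*} [Field F] [Algebra (ZMod 3) F] [Fintype F]

theorem coprime_quarter {n k : ℕ} (hk : Odd k) (hcop : Nat.Coprime n k) :
    Nat.Coprime ((3 ^ k + 1) / 4) (3 ^ n - 1) := by
  obtain ⟨t, ht⟩ := three_pow_odd_mod hk
  set g := Nat.gcd ((3 ^ k + 1) / 4) (3 ^ n - 1) with hg
  have hodd : ¬ 2 ∣ g := by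
    intro h
    have := h.trans (Nat.gcd_dvd_left _ _)
    omega
  have hd : ∀ m : ℕ, 3 ^ (2 * m) - 1 = (3 ^ m + 1) * (3 ^ m - 1) := by
    intro m
    rw [mul_comm 2, pow_mul, ← Nat.sq_sub_sq, one_pow]
  have h1 : g ∣ 3 ^ (2 * k) - 1 := by
    rw [hd]
    exact (((Nat.gcd_dvd_left _ _).trans ⟨4, by omega⟩).mul_right _)
  have h2 : g ∣ 3 ^ (2 * n) - 1 := by
    rw [hd]
    exact (Nat.gcd_dvd_right _ _).mul_left _
  have h3 := Nat.dvd_gcd h1 h2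
  rw [Nat.pow_sub_one_gcd_pow_sub_one, Nat.gcd_mul_left, Nat.gcd_comm, hcop.gcd_eq_one] at h3
  norm_num at h3
  have h4 : g ∣ 2 ^ 3 := by norm_num; exact h3
  obtain ⟨i, -, hi⟩ := (Nat.dvd_prime_pow Nat.prime_two).1 h4
  rcases Nat.eq_zero_or_pos i with rfl | hi0
  · exact hi
  · exact absurd (hi ▸ dvd_pow_self 2 hi0.ne') hodd

theorem cmSum_zero {n k : ℕ} (hk : Odd k) (hcop : Nat.Coprime n k)
    (hcard : Fintype.card F = 3 ^ n) {a : F} (ha : a ≠ 0) :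
    cmSum k a 0 = qchar a * traceGauss F := by
  obtain ⟨t, ht⟩ := three_pow_odd_mod hk
  have hm : (3 ^ k + 1) / 4 ≠ 0 := by omega
  have hinj : Function.Injective (fun x : F => x ^ ((3 ^ k + 1) / 4)) := by
    intro x y hxy
    simp only at hxy
    by_cases hy : y = 0
    · rw [hy, zero_pow hm] at hxy
      rw [hy]; exact eq_zero_of_pow_eq_zero hxy
    · have hx : x ≠ 0 := by
        rintro rfl
        rw [zero_pow hm] at hxy
        exact hy (eq_zero_of_pow_eq_zero hxy.symm)
      have h1 : (x / y) ^ ((3 ^ k + 1) / 4) = 1 := by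
        rw [div_pow, hxy, div_self (pow_ne_zero _ hy)]
      have h2 : (x / y) ^ (3 ^ n - 1) = 1 := by
        rw [← hcard]; exact FiniteField.pow_card_sub_one_eq_one _ (div_ne_zero hx hy)
      have h3 := pow_gcd_eq_one.2 ⟨h1, h2⟩
      rw [(coprime_quarter hk hcop).gcd_eq_one, pow_one] at h3
      exact (div_eq_one_iff_eq hy).1 h3
  rw [cmSum, ← sum_traceChar_mul_sq ha]
  refine Fintype.sum_equiv (Equiv.ofBijective _ (Finite.injective_iff_bijective.1 hinj)) _ _
    fun x => ?_
  rw [Equiv.ofBijective_apply, ← pow_mul, zero_mul, add_zero]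
  congr 3
  omega

theorem sum_cmSum (k : ℕ) (a : F) : ∑ lam, cmSum k a lam = Fintype.card F := by
  classical
  simp only [cmSum]
  rw [Finset.sum_comm]
  have : ∀ x : F, ∑ lam : F, traceChar F (a * x ^ ((3 ^ k + 1) / 2) + lam * x) =
      traceChar F (a * x ^ ((3 ^ k + 1) / 2)) * if x = 0 then (Fintype.card F : ℂ) else 0 := by
    intro x
    rw [← sum_traceChar_mul x, Finset.mul_sum]
    simp only [AddChar.map_add_eq_mul]
  simp_rw [this]
  have hd : (3 ^ k + 1) / 2 ≠ 0 := by have := Nat.one_le_pow k 3 (by norm_num); omega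
  simp [hd]

open Classical in
theorem sum_radical_le {n k : ℕ} (hk : Odd k) (hcop : Nat.Coprime n k)
    (hcard : Fintype.card F = 3 ^ n) {a lam u : F} (ha : a ≠ 0) (hu : InRadical k a lam u) :
    ∑ v ∈ Finset.univ.filter (InRadical k a lam),
        (1 - (traceChar F (a * (v * frobPow F k v))⁻¹).re) ≤
      2 * (1 - (cmSum k a lam / (qchar a * traceGauss F)).re) := by
  have hD : (qchar a : ℂ) * traceGauss F ≠ 0 :=
    mul_ne_zero (fun h => by have := qchar_cast_sq a; simp [h] at this) traceGauss_ne_zero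
  have hτ : ∀ v, InRadical k a lam v → cmSum k a lam / (qchar a * traceGauss F) =
      starRingEnd ℂ (traceChar F (a * (v * frobPow F k v))⁻¹) := by
    intro v hv
    rw [cmSum_of_radical hk hcop hcard ha hv, mul_div_cancel_left₀ _ hD, traceChar_neg]
  set τ := cmSum k a lam / (qchar a * traceGauss F)
  have hsum : ∑ v ∈ Finset.univ.filter (InRadical k a lam),
        (1 - (traceChar F (a * (v * frobPow F k v))⁻¹).re) =
      (Finset.univ.filter (InRadical k a lam)).card * (1 - τ.re) := by
    rw [Finset.sum_congr rfl (g := fun _ => 1 - τ.re), Finset.sum_const, nsmul_eq_mul]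
    intro v hv
    rw [hτ v (Finset.mem_filter.1 hv).2, Complex.conj_re]
  have hnn : 0 ≤ 1 - τ.re := by
    have h1 : ‖τ‖ = 1 := by rw [hτ u hu, RCLike.norm_conj, norm_traceChar]
    have := (Complex.re_le_norm τ)
    linarith
  rw [hsum]
  by_cases h1 : τ.re = 1
  · simp [h1]
  refine mul_le_mul_of_nonneg_right ?_ hnn
  have hsub : Finset.univ.filter (InRadical k a lam) ⊆ {u, -u} := by
    intro v hv
    have hv := (Finset.mem_filter.1 hv).2
    have hu1 : frobPow F k u ≠ 0 := (map_ne_zero _).2 hu.1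
    obtain ⟨ζ, rfl⟩ : ∃ ζ, v = ζ * u := ⟨v / u, by field_simp [hu.1]⟩
    have hfix : frobPow F k (a * (u * frobPow F k u) * (frobPow F k ζ - ζ)) =
        a * (u * frobPow F k u) * (frobPow F k ζ - ζ) := by
      have e1 := hu.2
      have e2 := hv.2
      simp only [map_mul, map_sub] at e2 ⊢
      linear_combination frobPow F k u * e2 - frobPow F k u * frobPow F k ζ * e1
    have hf : a * (u * frobPow F k u) ≠ 0 := mul_ne_zero ha (mul_ne_zero hu.1 hu1)
    have hne : traceChar F (a * (u * frobPow F k u))⁻¹ ≠ 1 := by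
      intro h
      apply h1
      rw [hτ u hu, h]; simp
    rw [Finset.mem_insert, Finset.mem_singleton]
    rcases eq_of_frobPow_eq_self hcop hcard hfix with h | h | h
    · have h2 : frobPow F k ζ = ζ :=
        sub_eq_zero.1 ((mul_eq_zero.1 h).resolve_left hf)
      rcases eq_of_frobPow_eq_self hcop hcard h2 with rfl | rfl | rfl
      · exact absurd (zero_mul u) hv.1
      · exact Or.inl (one_mul u)
      · exact Or.inr (by ring)
    · refine absurd ?_ hne
      rw [← AddChar.map_zero_eq_one (traceChar F)]
      refine traceChar_eq_of_frobPow k ζ ?_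
      rw [sub_zero]; exact inv_eq_of_mul_eq_one_right h
    · refine absurd ?_ hne
      rw [← AddChar.map_zero_eq_one (traceChar F)]
      refine traceChar_eq_of_frobPow k (-ζ) ?_
      rw [sub_zero, map_neg]
      refine inv_eq_of_mul_eq_one_right ?_
      linear_combination -h
  exact_mod_cast (Finset.card_le_card hsub).trans Finset.card_le_two

theorem not_inRadical_both {n k : ℕ} (hk : Odd k) (hcop : Nat.Coprime n k)
    (hcard : Fintype.card F = 3 ^ n) {a lam u c t : F} (ha : a ≠ 0) (hc : ¬IsSquare c)
    (hu : InRadical k a lam u) : ¬InRadical k (a * c ^ ((3 ^ k + 1) / 2)) (c * lam) t := by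
  intro ht
  have hc0 : c ≠ 0 := by rintro rfl; exact hc ⟨0, by simp⟩
  have hD : (qchar a : ℂ) * traceGauss F ≠ 0 :=
    mul_ne_zero (fun h => by have := qchar_cast_sq a; simp [h] at this) traceGauss_ne_zero
  have h1 := cmQuad_nonsquare_of_radical hk hcop hcard ha hu hc
  have h2 := cmQuad_of_radical hk hcop hcard (mul_ne_zero ha (pow_ne_zero _ hc0)) ht
  rw [qchar_mul_pow hk a hc0, h1] at h2
  generalize hx : -(a * c ^ ((3 ^ k + 1) / 2) * (t * frobPow F k t))⁻¹ = x at h2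
  have h3 : traceChar F x = -1 := by
    apply mul_left_cancel₀ hD
    linear_combination -h2 / 2
  have h4 := traceChar_cube x
  rw [h3] at h4
  norm_num at h4

theorem norm_cmSum_div_le {k : ℕ} (hk : Odd k) {a lam c : F} (hc : ¬IsSquare c)
    (h1 : ∀ u, ¬InRadical k a lam u)
    (h2 : ∀ u, ¬InRadical k (a * c ^ ((3 ^ k + 1) / 2)) (c * lam) u) :
    ‖cmSum k a lam / (qchar a * traceGauss F)‖ ≤ 1 := by
  have e1 := norm_sq_cmQuad h1
  have e2 := norm_sq_cmQuad h2
  have e3 := norm_sq_traceGauss (F := F)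
  have e4 : ‖(qchar a : ℂ)‖ = 1 := by
    have := congrArg norm (qchar_cast_sq a)
    rw [norm_pow, norm_one] at this
    exact (pow_eq_one_iff_of_nonneg (norm_nonneg _) (by norm_num)).1 this
  have f1 : ‖cmQuad k a lam‖ = ‖traceGauss F‖ :=
    (pow_left_inj₀ (norm_nonneg _) (norm_nonneg _) two_ne_zero).1 (e1.trans e3.symm)
  have f2 : ‖cmQuad k (a * c ^ ((3 ^ k + 1) / 2)) (c * lam)‖ = ‖traceGauss F‖ :=
    (pow_left_inj₀ (norm_nonneg _) (norm_nonneg _) two_ne_zero).1 (e2.trans e3.symm)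
  have h := congrArg norm (two_mul_cmSum hk a lam hc)
  have h' := norm_add_le (cmQuad k a lam) (cmQuad k (a * c ^ ((3 ^ k + 1) / 2)) (c * lam))
  rw [← h, f1, f2, norm_mul] at h'
  norm_num at h'
  rw [norm_div, norm_mul, e4, one_mul]
  exact div_le_one_of_le₀ (by linarith) (norm_nonneg _)

open Classical in
theorem sum_sum_radical (k : ℕ) {b c : F} (hc : c ≠ 0) :
    ∑ lam, ∑ v ∈ Finset.univ.filter (InRadical k b (c * lam)),
        (1 - (traceChar F (b * (v * frobPow F k v))⁻¹).re) =
      Fintype.card F - (cmQuad k b⁻¹ 0).re := by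
  simp_rw [Finset.sum_filter]
  rw [Finset.sum_comm]
  have h1 : ∀ v : F, (∑ lam, if InRadical k b (c * lam) v then
      (1 - (traceChar F (b * (v * frobPow F k v))⁻¹).re) else 0) =
      1 - (traceChar F (b * (v * frobPow F k v))⁻¹).re := by
    intro v
    by_cases hv : v = 0
    · simp [hv]
    have hv1 : frobPow F k v ≠ 0 := (map_ne_zero _).2 hv
    obtain ⟨μ, hμ⟩ := (frobPow_bijective (F := F) k).2
      ((frobPow F k b * frobPow F k (frobPow F k v) + b * v) / frobPow F k v)
    rw [Finset.sum_eq_single (c⁻¹ * μ)]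
    · rw [if_pos]
      refine ⟨hv, ?_⟩
      rw [mul_inv_cancel_left₀ hc, hμ, div_mul_cancel₀ _ hv1]
    · intro lam _ hne
      rw [if_neg]
      rintro ⟨-, h⟩
      apply hne
      rw [eq_inv_mul_iff_mul_eq₀ hc]
      apply (frobPow_bijective (F := F) k).1
      rw [hμ, h, mul_div_cancel_right₀ _ hv1]
    · simp
  simp_rw [h1]
  rw [Finset.sum_sub_distrib, cmQuad, Complex.re_sum]
  congr 1
  · simp
  · refine Fintype.sum_equiv (Equiv.inv F) _ _ fun v => ?_
    simp only [Equiv.inv_apply, map_inv₀, zero_mul, add_zero, mul_inv]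

theorem cmSum_of_not_radical {n k : ℕ} (hk : Odd k) (hcop : Nat.Coprime n k)
    (hcard : Fintype.card F = 3 ^ n) {a lam : F} (ha : a ≠ 0)
    (h : ∀ c, c ≠ 0 → ∀ u, ¬InRadical k (a * c ^ ((3 ^ k + 1) / 2)) (c * lam) u) :
    cmSum k a lam = qchar a * traceGauss F := by
  classical
  obtain ⟨c, hc⟩ := FiniteField.exists_nonsquare (ringChar_ne_two F)
  have hc0 : c ≠ 0 := by rintro rfl; exact hc ⟨0, by simp⟩
  have hac : a * c ^ ((3 ^ k + 1) / 2) ≠ 0 := mul_ne_zero ha (pow_ne_zero _ hc0)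
  set D := (qchar a : ℂ) * traceGauss F with hDdef
  have hD : D ≠ 0 :=
    mul_ne_zero (fun h => by have := qchar_cast_sq a; simp [h] at this) traceGauss_ne_zero
  have hDD : D * starRingEnd ℂ D = Fintype.card F := by
    rw [hDdef, map_mul, ← traceGauss_mul_conj]
    have : starRingEnd ℂ (qchar a : ℂ) = qchar a := by simp
    rw [this]
    linear_combination traceGauss F * starRingEnd ℂ (traceGauss F) * qchar_cast_sq a
  let A : F → ℝ := fun l => ∑ v ∈ Finset.univ.filter (InRadical k a (1 * l)),
        (1 - (traceChar F (a * (v * frobPow F k v))⁻¹).re)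
  let B : F → ℝ := fun l => ∑ v ∈ Finset.univ.filter
        (InRadical k (a * c ^ ((3 ^ k + 1) / 2)) (c * l)),
        (1 - (traceChar F (a * c ^ ((3 ^ k + 1) / 2) * (v * frobPow F k v))⁻¹).re)
  have hle : ∀ l ∈ Finset.univ, A l + B l ≤ 2 * (1 - (cmSum k a l / D).re) := by
    intro l _
    by_cases h1 : ∃ u, InRadical k a l u
    · obtain ⟨u, hu⟩ := h1
      have hB : B l = 0 := by
        apply Finset.sum_eq_zero
        intro v hv
        exact absurd (Finset.mem_filter.1 hv).2 (not_inRadical_both hk hcop hcard ha hc hu)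
      rw [hB, add_zero]
      simp only [A, one_mul]
      exact sum_radical_le hk hcop hcard ha hu
    · push Not at h1
      have hA : A l = 0 := by
        apply Finset.sum_eq_zero
        intro v hv
        refine absurd (Finset.mem_filter.1 hv).2 ?_
        rw [one_mul]; exact h1 v
      rw [hA, zero_add]
      by_cases h2 : ∃ u, InRadical k (a * c ^ ((3 ^ k + 1) / 2)) (c * l) u
      · obtain ⟨u, hu⟩ := h2
        have := sum_radical_le hk hcop hcard hac hu
        rw [cmSum_scale k a l hc0, qchar_mul_pow hk a hc0] at this
        exact this
      · push Not at h2
        have hB : B l = 0 := by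
          apply Finset.sum_eq_zero
          intro v hv
          exact absurd (Finset.mem_filter.1 hv).2 (h2 v)
        rw [hB]
        have := (Complex.re_le_norm _).trans (norm_cmSum_div_le hk hc h1 h2)
        linarith
  have htot : ∑ l, (A l + B l) = ∑ l, 2 * (1 - (cmSum k a l / D).re) := by
    rw [Finset.sum_add_distrib, sum_sum_radical k one_ne_zero, sum_sum_radical k hc0]
    have hr : ∑ l, 2 * (1 - (cmSum k a l / D).re) = 2 * Fintype.card F - 2 * D.re := by
      rw [← Finset.mul_sum, Finset.sum_sub_distrib, ← Complex.re_sum, ← Finset.sum_div, sum_cmSum,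
        ← hDD, mul_div_cancel_left₀ _ hD, Complex.conj_re]
      simp; ring
    rw [hr]
    have h3 := two_mul_cmSum hk a⁻¹ 0 (c := c⁻¹) (by
      rw [isSquare_inv]; exact hc)
    rw [cmSum_zero hk hcop hcard (inv_ne_zero ha), mul_zero] at h3
    have h4 : qchar a⁻¹ = qchar a := by
      rw [← qchar_mul_sq a (inv_ne_zero ha)]
      congr 1; field_simp
    have h5 : a⁻¹ * c⁻¹ ^ ((3 ^ k + 1) / 2) = (a * c ^ ((3 ^ k + 1) / 2))⁻¹ := by
      rw [mul_inv, inv_pow]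
    rw [h4, h5, ← hDdef] at h3
    have h6 := congrArg Complex.re h3
    have h7 : (2 * D).re = 2 * D.re := by simp
    rw [Complex.add_re, h7] at h6
    linarith
  have heq := (Finset.sum_eq_sum_iff_of_le hle).1 htot lam (Finset.mem_univ _)
  have h1 : ∀ u, ¬InRadical k a lam u := by
    have := h 1 one_ne_zero
    simpa using this
  have h2 := h c hc0
  have hA : A lam = 0 := by
    apply Finset.sum_eq_zero
    intro v hv
    refine absurd (Finset.mem_filter.1 hv).2 ?_
    rw [one_mul]; exact h1 v
  have hB : B lam = 0 := by
    apply Finset.sum_eq_zero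
    intro v hv
    exact absurd (Finset.mem_filter.1 hv).2 (h2 v)
  rw [hA, hB] at heq
  have hn := norm_cmSum_div_le hk hc h1 h2
  rw [← hDdef] at hn
  have hre : (cmSum k a lam / D).re = 1 := by linarith
  have him : (cmSum k a lam / D).im = 0 := by
    have hsq : ‖cmSum k a lam / D‖ ^ 2 ≤ 1 := pow_le_one₀ (norm_nonneg _) hn
    rw [← Complex.normSq_eq_norm_sq, Complex.normSq_apply, hre] at hsq
    have : (cmSum k a lam / D).im * (cmSum k a lam / D).im ≤ 0 := by linarith
    exact mul_self_eq_zero.1 (le_antisymm this (mul_self_nonneg _))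
  have : cmSum k a lam / D = 1 := Complex.ext hre him
  rwa [div_eq_one_iff_eq hD] at this

end RadicalCounting

section GaussSumValue

open Module

variable {F : Type*} [Field F] [Fintype F] [Algebra (ZMod 3) F]

theorem addChar_map_sum {A M ι : Type*} [AddCommMonoid A] [CommMonoid M] (ψ : AddChar A M)
    (s : Finset ι) (f : ι → A) : ψ (∑ i ∈ s, f i) = ∏ i ∈ s, ψ (f i) := by
  classical
  induction s using Finset.induction_on with
  | empty => simp
  | insert a s ha ih => rw [Finset.sum_insert ha, Finset.prod_insert ha, AddChar.map_add_eq_mul, ih]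

theorem sum_omega3_mul_sq (d : ZMod 3) (hd : d ≠ 0) :
    ∑ t : ZMod 3, omega3 ^ (d * t ^ 2).val =
      ((quadraticChar (ZMod 3) d : ℤ) : ℂ) * (Complex.I * (Real.sqrt 3 : ℂ)) := by
  have h1 : omega3 ^ 1 = -1 / 2 + (Real.sqrt 3 / 2 : ℝ) * Complex.I := by rw [pow_one, omega3_eq]
  have h2 : omega3 ^ 2 = -1 / 2 - (Real.sqrt 3 / 2 : ℝ) * Complex.I := by
    linear_combination one_add_omega3_add_sq - h1
  have hd' : d = 1 ∨ d = 2 := by revert hd; revert d; decide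
  have e : ∀ f : ZMod 3 → ℂ, ∑ t : ZMod 3, f t = f 0 + f 1 + f 2 := fun f => Fin.sum_univ_three f
  rcases hd' with rfl | rfl
  · rw [e, show (1 * 0 ^ 2 : ZMod 3).val = 0 from by decide,
      show (1 * 1 ^ 2 : ZMod 3).val = 1 from by decide,
      show (1 * 2 ^ 2 : ZMod 3).val = 1 from by decide,
      show quadraticChar (ZMod 3) 1 = 1 from by decide, h1]
    push_cast
    ring
  · rw [e, show (2 * 0 ^ 2 : ZMod 3).val = 0 from by decide,
      show (2 * 1 ^ 2 : ZMod 3).val = 2 from by decide,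
      show (2 * 2 ^ 2 : ZMod 3).val = 2 from by decide,
      show quadraticChar (ZMod 3) 2 = -1 from by decide, h2]
    push_cast
    ring

theorem algebraMap_trace_eq_sum {n : ℕ} (hcard : Fintype.card F = 3 ^ n) (x : F) :
    algebraMap (ZMod 3) F (Algebra.trace (ZMod 3) F x) = ∑ i ∈ Finset.range n, x ^ 3 ^ i := by
  have hfin : finrank (ZMod 3) F = n := by
    have := Module.card_eq_pow_finrank (K := ZMod 3) (V := F)
    rw [hcard, ZMod.card] at this
    exact (Nat.pow_right_injective (le_refl 2 |>.trans (by norm_num)) this).symm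
  rw [FiniteField.algebraMap_trace_eq_sum_pow, hfin, Nat.card_zmod]

theorem prod_trace_sq_of_isOrtho {n : ℕ} (hcard : Fintype.card F = 3 ^ (n + 1))
    (v : Fin (n + 1) → F)
    (hv : ∀ i j, i ≠ j → Algebra.trace (ZMod 3) F (v i * v j) = 0)
    (hv0 : ∀ i, Algebra.trace (ZMod 3) F (v i * v i) ≠ 0) :
    ∏ i, Algebra.trace (ZMod 3) F (v i * v i) = (-1) ^ n := by
  let M : Matrix (Fin (n + 1)) (Fin (n + 1)) F := Matrix.of fun i j => v j ^ 3 ^ (i : ℕ)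
  have hM : M.transpose * M = Matrix.diagonal fun j =>
      algebraMap (ZMod 3) F (Algebra.trace (ZMod 3) F (v j * v j)) := by
    ext i j
    have : (M.transpose * M) i j =
        algebraMap (ZMod 3) F (Algebra.trace (ZMod 3) F (v i * v j)) := by
      rw [algebraMap_trace_eq_sum hcard, Matrix.mul_apply, Finset.sum_range]
      simp [M, mul_pow]
    rw [this, Matrix.diagonal_apply]
    split_ifs with h
    · rw [h]
    · rw [hv i j h, map_zero]
  have hdet : M.det * M.det = algebraMap (ZMod 3) F
      (∏ i, Algebra.trace (ZMod 3) F (v i * v i)) := by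
    have := congrArg Matrix.det hM
    rwa [Matrix.det_mul, Matrix.det_transpose, Matrix.det_diagonal, ← map_prod] at this
  have hcube : M.det ^ 3 = (-1) ^ n * M.det := by
    have h1 : M.map (frobPow F 1) = M.submatrix (finRotate (n + 1)) id := by
      ext i j
      simp only [Matrix.map_apply, frobPow_apply, Matrix.submatrix_apply, id, M, Matrix.of_apply,
        ← pow_mul, coe_finRotate]
      split_ifs with h
      · rw [h, Fin.val_last, ← pow_add, ← hcard, FiniteField.pow_card, pow_zero, pow_one]
      · rw [pow_add]
    have h2 : frobPow F 1 M.det = (M.map (frobPow F 1)).det := by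
      rw [RingHom.map_det, RingHom.mapMatrix_apply]
    rw [h1, Matrix.det_permute, frobPow_apply, sign_finRotate] at h2
    simpa using h2
  have hne : M.det ≠ 0 := by
    intro h
    rw [h, mul_zero, eq_comm, map_eq_zero, Finset.prod_eq_zero_iff] at hdet
    obtain ⟨i, _, hi⟩ := hdet
    exact hv0 i hi
  apply (algebraMap (ZMod 3) F).injective
  rw [← hdet, map_pow, map_neg, map_one]
  apply mul_right_cancel₀ hne
  linear_combination hcube

/-- The quadratic Gauss sum of the canonical additive character in characteristic three. -/
theorem traceGauss_eq {n : ℕ} (hn : 0 < n) (hcard : Fintype.card F = 3 ^ n) :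
    traceGauss F = (-1) ^ (n + 1) * Complex.I ^ n * (Real.sqrt 3 : ℂ) ^ n := by
  obtain ⟨n, rfl⟩ : ∃ m, n = m + 1 := ⟨n - 1, by omega⟩
  have hfin : finrank (ZMod 3) F = n + 1 := by
    have := Module.card_eq_pow_finrank (K := ZMod 3) (V := F)
    rw [hcard, ZMod.card] at this
    exact (Nat.pow_right_injective (le_refl 2 |>.trans (by norm_num)) this).symm
  let _ : Invertible (2 : ZMod 3) := invertibleOfNonzero (by decide)
  have hbasis := LinearMap.BilinForm.exists_orthogonal_basis (K := ZMod 3) (V := F)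
    (B := Algebra.traceForm (ZMod 3) F)
    ⟨fun x y => (Algebra.traceForm_isSymm (ZMod 3)).eq x y⟩
  rw [hfin] at hbasis
  obtain ⟨v, hv⟩ := hbasis
  have hv0 := hv.not_isOrtho_basis_self_of_separatingLeft (traceForm_nondegenerate (ZMod 3) F).1
  rw [LinearMap.isOrthoᵢ_def] at hv
  have hprod := prod_trace_sq_of_isOrtho hcard v hv hv0
  have htr : ∀ c : Fin (n + 1) → ZMod 3, traceChar F ((v.equivFun.symm c) ^ 2) =
      ∏ i, omega3 ^ (Algebra.trace (ZMod 3) F (v i * v i) * c i ^ 2).val := by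
    intro c
    have h1 : Algebra.trace (ZMod 3) F ((v.equivFun.symm c) ^ 2) =
        ∑ i, Algebra.trace (ZMod 3) F (v i * v i) * c i ^ 2 := by
      rw [Basis.equivFun_symm_apply, sq, Finset.sum_mul_sum, map_sum]
      refine Finset.sum_congr rfl fun i _ => ?_
      rw [map_sum, Finset.sum_eq_single i]
      · rw [smul_mul_smul_comm, map_smul, smul_eq_mul]
        ring
      · intro j _ hj
        rw [smul_mul_smul_comm, map_smul]
        have := hv i j hj.symm
        rw [Algebra.traceForm_apply] at this
        rw [this, smul_zero]
      · simp
    rw [traceChar_apply, h1]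
    simp only [← AddChar.zmodChar_apply omega3_pow_three]
    rw [addChar_map_sum]
  rw [traceGauss, ← Equiv.sum_comp v.equivFun.symm.toEquiv]
  calc _ = ∑ c : Fin (n + 1) → ZMod 3,
        ∏ i, omega3 ^ (Algebra.trace (ZMod 3) F (v i * v i) * c i ^ 2).val :=
      Finset.sum_congr rfl fun c _ => htr c
    _ = ∏ i, ∑ t : ZMod 3, omega3 ^ (Algebra.trace (ZMod 3) F (v i * v i) * t ^ 2).val := by
      rw [Finset.prod_univ_sum, Fintype.piFinset_univ]
    _ = ∏ i, (((quadraticChar (ZMod 3) (Algebra.trace (ZMod 3) F (v i * v i)) : ℤ) : ℂ) *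
          (Complex.I * (Real.sqrt 3 : ℂ))) :=
      Finset.prod_congr rfl fun i _ => sum_omega3_mul_sq _ (hv0 i)
    _ = _ := by
      rw [Finset.prod_mul_distrib, Finset.prod_const, Finset.card_univ, Fintype.card_fin,
        ← Int.cast_prod, ← map_prod, hprod, map_pow,
        show quadraticChar (ZMod 3) (-1) = -1 from by decide]
      push_cast
      ring

end GaussSumValue

section FrobeniusPowers

theorem RingHom.pow_add_apply {K : Type*} [Semiring K] (σ : K →+* K) (i j : ℕ) (x : K) :
    (σ ^ (i + j)) x = (σ ^ i) ((σ ^ j) x) := by rw [pow_add]; rfl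

variable {F : Type*} [Field F] [Algebra (ZMod 3) F] [Fintype F]

theorem pow_three_pow_mul {n : ℕ} (hcard : Fintype.card F = 3 ^ n) (m : ℕ) (x : F) :
    x ^ 3 ^ (n * m) = x := by
  rw [pow_mul, ← hcard, FiniteField.pow_card_pow]

theorem pow_three_pow_mod {n : ℕ} (hcard : Fintype.card F = 3 ^ n) (m : ℕ) (x : F) :
    x ^ 3 ^ (m % n) = x ^ 3 ^ m := by
  conv_rhs => rw [← Nat.div_add_mod m n, pow_add, pow_mul, pow_three_pow_mul hcard]

theorem frobPow_pow_card {n : ℕ} (hcard : Fintype.card F = 3 ^ n) (k : ℕ) :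
    frobPow F k ^ n = 1 := by
  ext x
  rw [frobPow_pow_apply, mul_comm, pow_three_pow_mul hcard]
  rfl

theorem frobPow_pow_eq_cube {n : ℕ} (hcard : Fintype.card F = 3 ^ n) {k w m : ℕ}
    (hm : k * w = 1 + n * m) (x : F) : (frobPow F k ^ w) x = x ^ 3 := by
  rw [frobPow_pow_apply, hm, pow_add, mul_comm, pow_mul, pow_three_pow_mul hcard, pow_one]

theorem algebraMap_trace_eq_sum_frobPow {n k : ℕ} (hn : 0 < n) (hcop : Nat.Coprime n k)
    (hcard : Fintype.card F = 3 ^ n) (x : F) :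
    algebraMap (ZMod 3) F (Algebra.trace (ZMod 3) F x) =
      ∑ i ∈ Finset.range n, (frobPow F k ^ i) x := by
  rw [algebraMap_trace_eq_sum hcard]
  have hmaps : ∀ i ∈ Finset.range n, k * i % n ∈ Finset.range n := fun i _ =>
    Finset.mem_range.2 (Nat.mod_lt _ hn)
  have hinj : Set.InjOn (fun i => k * i % n) (Finset.range n : Set ℕ) := by
    intro i hi j hj h
    simp only [Finset.coe_range, Set.mem_Iio] at hi hj
    have h' : k * i ≡ k * j [MOD n] := h
    have := Nat.ModEq.cancel_left_of_coprime hcop h'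
    rwa [Nat.ModEq, Nat.mod_eq_of_lt hi, Nat.mod_eq_of_lt hj] at this
  symm
  refine Finset.sum_nbij (fun i => k * i % n) hmaps hinj
    (Finset.surjOn_of_injOn_of_card_le _ hmaps hinj le_rfl) fun i _ => ?_
  rw [frobPow_pow_apply, pow_three_pow_mod hcard]

theorem frobPow_pow_injOn {n : ℕ} (hcard : Fintype.card F = 3 ^ n) {k w m : ℕ}
    (hm : k * w = 1 + n * m) (i j : ℕ) (hi : i < n) (hj : j < n)
    (hij : frobPow F k ^ i = frobPow F k ^ j) : i = j := by
  classical
  wlog hlt : i < j generalizing i j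
  · rcases (not_lt.1 hlt).lt_or_eq with h | h
    · exact (this j i hj hi hij.symm h).symm
    · exact h.symm
  have hfix : ∀ x : F, (frobPow F k ^ (j - i)) x = x := by
    intro x
    have h1 : (frobPow F k ^ i) ((frobPow F k ^ (j - i)) x) = (frobPow F k ^ i) x := by
      have := congrArg (fun f : F →+* F => f x) hij
      rw [← RingHom.pow_add_apply, show i + (j - i) = j by omega]
      exact this.symm
    exact (frobPow F k ^ i).injective h1
  set r := j - i with hr
  have hr0 : 0 < r := by omega
  have hrn : r < n := by omega
  have hfix2 : ∀ s : ℕ, ∀ x : F, (frobPow F k ^ (r * s)) x = x := by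
    intro s x
    induction s with
    | zero => simp
    | succ s ih => rw [Nat.mul_succ, RingHom.pow_add_apply, hfix, ih]
  have hpow : ∀ x : F, x ^ 3 ^ r = x := by
    intro x
    have := hfix2 w x
    rw [frobPow_pow_apply, show k * (r * w) = r + n * (m * r) by
      rw [show k * (r * w) = r * (k * w) by ring, hm]; ring, pow_add, mul_comm, pow_mul,
      pow_three_pow_mul hcard] at this
    exact this
  obtain ⟨g, hg⟩ := IsCyclic.exists_ofOrder_eq_natCard (α := Fˣ)
  have h1 : g ^ (3 ^ r - 1) = 1 := by
    have h3 : 1 ≤ 3 ^ r := Nat.one_le_pow _ _ (by norm_num)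
    have h2 : g ^ (3 ^ r - 1) * g = 1 * g := by
      rw [← pow_succ, Nat.sub_add_cancel h3, one_mul]
      ext
      push_cast
      exact hpow _
    exact mul_right_cancel h2
  have h2 := orderOf_dvd_of_pow_eq_one h1
  rw [hg, Nat.card_eq_fintype_card, Fintype.card_units, hcard] at h2
  have h3 := Nat.le_of_dvd (Nat.sub_pos_of_lt (Nat.one_lt_pow hr0.ne' (by norm_num))) h2
  have h4 : 3 ^ r < 3 ^ n := Nat.pow_lt_pow_right (by norm_num) hrn
  have h5 : 1 ≤ 3 ^ r := Nat.one_le_pow _ _ (by norm_num)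
  omega

theorem prod_frobPow_pow_half (k : ℕ) (c : F) (i : ℕ) :
    ∏ j ∈ Finset.range i, (frobPow F k ^ j) (c ^ ((3 ^ k - 1) / 2)) =
      c ^ ((3 ^ (k * i) - 1) / 2) := by
  induction i with
  | zero => simp
  | succ i ih =>
    have hodd : ∀ e : ℕ, ∃ u, 3 ^ e = 2 * u + 1 := fun e =>
      Odd.pow (by decide : Odd 3)
    obtain ⟨u, hu⟩ := hodd k
    obtain ⟨v, hv⟩ := hodd (k * i)
    rw [Finset.prod_range_succ, ih, map_pow, frobPow_pow_apply, ← pow_mul, ← pow_add]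
    congr 1
    rw [Nat.mul_succ, pow_add, hv, hu, show (2 * v + 1) * (2 * u + 1) - 1 =
      2 * (v + (2 * v + 1) * u) by rw [Nat.sub_eq_iff_eq_add (by nlinarith)]; ring]
    simp

theorem exists_pow_even_eq {n : ℕ} {m : ℕ} (hm : Even m) :
    ∃ s, 3 ^ (n * m) = 2 * (3 ^ n - 1) * s + 1 := by
  obtain ⟨r, rfl⟩ := hm
  obtain ⟨u, hu⟩ : Odd (3 ^ n) := Odd.pow (by decide : Odd 3)
  obtain ⟨s, hs⟩ : (3 ^ n) ^ 2 - 1 ∣ ((3 ^ n) ^ 2) ^ r - 1 ^ r := by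
    simpa using Nat.sub_dvd_pow_sub_pow ((3 ^ n) ^ 2) 1 r
  rw [one_pow] at hs
  refine ⟨(u + 1) * s, ?_⟩
  have h1 : 1 ≤ ((3 ^ n) ^ 2) ^ r := Nat.one_le_pow _ _ (by positivity)
  have h2 : (3 ^ n) ^ 2 - 1 = 2 * (3 ^ n - 1) * (u + 1) := by
    rw [hu, Nat.add_sub_cancel, Nat.sub_eq_iff_eq_add (by nlinarith)]
    ring
  rw [show n * (r + r) = n * 2 * r by ring, pow_mul, pow_mul, ← mul_assoc, ← h2, ← hs,
    Nat.sub_add_cancel h1]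

theorem prod_frobPow_half_eq_self {n : ℕ} (hcard : Fintype.card F = 3 ^ n) {k w m : ℕ}
    (hm : k * w = 1 + n * m) (hme : Even m) {c : F} (hc : c ≠ 0) :
    ∏ j ∈ Finset.range w, (frobPow F k ^ j) (c ^ ((3 ^ k - 1) / 2)) = c := by
  obtain ⟨s, hs⟩ := exists_pow_even_eq (n := n) hme
  have h1 : c ^ (3 ^ n - 1) = 1 := by rw [← hcard]; exact FiniteField.pow_card_sub_one_eq_one c hc
  rw [prod_frobPow_pow_half, hm, pow_add, hs,
    show (3 ^ 1 * (2 * (3 ^ n - 1) * s + 1) - 1) / 2 = (3 ^ n - 1) * (3 * s) + 1 by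
      rw [show 3 ^ 1 * (2 * (3 ^ n - 1) * s + 1) = 2 * ((3 ^ n - 1) * (3 * s) + 1) + 1 by ring]
      simp,
    pow_succ, pow_mul, h1, one_pow, one_mul]

theorem prod_frobPow_half_eq_neg_one {n : ℕ} (hcard : Fintype.card F = 3 ^ n) {k : ℕ}
    (hk : Odd k) {c : F} (hc : ¬IsSquare c) :
    ∏ j ∈ Finset.range n, (frobPow F k ^ j) (c ^ ((3 ^ k - 1) / 2)) = -1 := by
  have hc0 : c ≠ 0 := by rintro rfl; exact hc ⟨0, by simp⟩
  obtain ⟨r, rfl⟩ := hk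
  obtain ⟨s, hs⟩ := exists_pow_even_eq (n := n) (even_two_mul r)
  have h1 : c ^ (3 ^ n - 1) = 1 := by rw [← hcard]; exact FiniteField.pow_card_sub_one_eq_one c hc0
  have h2 : c ^ (Fintype.card F / 2) = -1 :=
    (FiniteField.pow_dichotomy (ringChar_ne_two F) hc0).resolve_left fun h =>
      hc ((FiniteField.isSquare_iff (ringChar_ne_two F) hc0).2 h)
  obtain ⟨u, hu⟩ : Odd (3 ^ n) := Odd.pow (by decide : Odd 3)
  have h3 : Fintype.card F / 2 = u := by rw [hcard, hu]; omega
  rw [prod_frobPow_pow_half, mul_comm, mul_add, pow_add, hs, mul_one,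
    show ((2 * (3 ^ n - 1) * s + 1) * 3 ^ n - 1) / 2 = (3 ^ n - 1) * (s * 3 ^ n) + u by
      rw [show (2 * (3 ^ n - 1) * s + 1) * 3 ^ n = 2 * ((3 ^ n - 1) * (s * 3 ^ n)) + 3 ^ n by ring]
      omega,
    pow_add, pow_mul, h1, one_pow, one_mul, ← h3, h2]

theorem inRadical_scale_iff {k : ℕ} (hk : Odd k) (a : F) {c t : F} (hc : c ≠ 0) :
    InRadical k (a * c ^ ((3 ^ k + 1) / 2)) (c * 1) t ↔
      t ≠ 0 ∧ frobPow F k a * c ^ ((3 ^ k - 1) / 2) * frobPow F k (c ^ ((3 ^ k - 1) / 2)) *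
        frobPow F k (frobPow F k t) + a * t = c ^ ((3 ^ k - 1) / 2) * frobPow F k t := by
  have h1 := pow_half_succ hk c
  have h2 := frobPow_eq_half_sq hk c
  have h0 : c ^ ((3 ^ k - 1) / 2) ≠ 0 := pow_ne_zero _ hc
  rw [InRadical, h1, mul_one, map_mul, map_mul, h2]
  generalize c ^ ((3 ^ k - 1) / 2) = h at *
  refine and_congr_right fun _ => ⟨fun H => ?_, fun H => ?_⟩
  · apply mul_left_cancel₀ (mul_ne_zero hc h0)
    linear_combination H
  · linear_combination c * h * H

end FrobeniusPowers

section RadicalEvaluation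

variable {F : Type*} [Field F] [Algebra (ZMod 3) F] [Fintype F]

theorem trace_transfer_eq {n : ℕ} (hn : 0 < n) (hcard : Fintype.card F = 3 ^ n) {k w m : ℕ}
    (hcop : Nat.Coprime n k) (hm : k * w = 1 + n * m) {a h c t : F} (ha : a ≠ 0)
    (hh : h ≠ 0) (hc0 : c ≠ 0) (ht : t ≠ 0) (hc : frobPow F k c = h ^ 2 * c)
    (hker : frobPow F k a * h * frobPow F k h * frobPow F k (frobPow F k t) + a * t =
      h * frobPow F k t)
    (hprod : ∏ j ∈ Finset.range w, (frobPow F k ^ j) h = c) :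
    Algebra.trace (ZMod 3) F (twistedProd (frobPow F k) (transferMat a) w 0 1 -
        twistedProd (frobPow F k) (transferMat a) w 0 0) =
      Algebra.trace (ZMod 3) F (a * c * h * t * frobPow F k t)⁻¹ := by
  apply (algebraMap (ZMod 3) F).injective
  rw [algebraMap_trace_eq_sum_frobPow hn hcop hcard,
    algebraMap_trace_eq_sum_frobPow hn hcop hcard]
  exact sum_pow_transfer_eq _ (three_eq_zero F) ha hh hc0 ht hc hker
    (frobPow_pow_eq_cube hcard hm) hprod (frobPow_pow_card hcard k)

theorem cmSum_one_of_inRadical {n : ℕ} (hn : 0 < n) (hcard : Fintype.card F = 3 ^ n)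
    {k w m : ℕ} (hk : Odd k) (hcop : Nat.Coprime n k) (hm : k * w = 1 + n * m) (hme : Even m)
    {a c t : F} (ha : a ≠ 0) (hc : c ≠ 0)
    (ht : InRadical k (a * c ^ ((3 ^ k + 1) / 2)) (c * 1) t) :
    cmSum k a 1 = qchar a * traceGauss F * traceChar F
      (-(twistedProd (frobPow F k) (transferMat a) w 0 1 -
        twistedProd (frobPow F k) (transferMat a) w 0 0)) := by
  have h1 := cmSum_of_radical hk hcop hcard (mul_ne_zero ha (pow_ne_zero _ hc)) ht
  rw [cmSum_scale k a 1 hc, qchar_mul_pow hk a hc] at h1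
  obtain ⟨ht0, hker⟩ := (inRadical_scale_iff hk a hc).1 ht
  rw [h1, traceChar_apply, traceChar_apply, map_neg, map_neg,
    trace_transfer_eq hn hcard hcop hm ha (pow_ne_zero _ hc) hc ht0 (frobPow_eq_half_sq hk c) hker
      (prod_frobPow_half_eq_self hcard hm hme hc), pow_half_succ hk c]
  simp only [mul_assoc]

end RadicalEvaluation

section TransferTrace

/-- The trace of a full twisted product of transfer matrices is fixed by `σ`. -/
theorem map_trace_twistedProd {K : Type*} [Field K] (σ : K →+* K) {n : ℕ} (hσ : σ ^ n = 1)
    {a : K} (ha : a ≠ 0) :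
    σ (twistedProd σ (transferMat a) n).trace = (twistedProd σ (transferMat a) n).trace := by
  have h1 := twistedProd_add σ (transferMat a) 1 n
  have h2 := twistedProd_add σ (transferMat a) n 1
  have hone : twistedProd σ (transferMat a) 1 = transferMat a := by
    simp [twistedProd]
  rw [add_comm, h2, hσ, hone] at h1
  have h3 : (transferMat a).map ⇑(1 : K →+* K) = transferMat a := by
    rw [transferMat_map]; rfl
  rw [h3, pow_one] at h1
  set N := twistedProd σ (transferMat a) n
  have hdet : (transferMat a).det = 1 := det_transferMat ha
  have hinv : transferMat a * (transferMat a)⁻¹ = 1 :=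
    Matrix.mul_nonsing_inv _ (by rw [hdet]; exact isUnit_one)
  have hmap : N.map σ = transferMat a * N * (transferMat a)⁻¹ := by
    rw [h1, mul_assoc, hinv, mul_one]
  have htr : σ N.trace = (N.map σ).trace := by
    simp [Matrix.trace, Matrix.diag]
  rw [htr, hmap, Matrix.trace_mul_comm, ← mul_assoc,
    Matrix.nonsing_inv_mul _ (by rw [hdet]; exact isUnit_one), one_mul]

theorem twistedProd_map_algebraMap {K L : Type*} [Field K] [Field L] [Algebra K L]
    (σ : K →+* K) (τ : L →+* L) (hτ : ∀ x, τ (algebraMap K L x) = algebraMap K L (σ x))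
    (a : K) (i : ℕ) :
    twistedProd τ (transferMat (algebraMap K L a)) i =
      (twistedProd σ (transferMat a) i).map (algebraMap K L) := by
  have hpow : ∀ i x, (τ ^ i) (algebraMap K L x) = algebraMap K L ((σ ^ i) x) := by
    intro i
    induction i with
    | zero => intro x; rfl
    | succ i ih =>
      intro x
      rw [RingHom.pow_succ_apply_left, ih, hτ, ← RingHom.pow_succ_apply_left]
  induction i with
  | zero => simp [twistedProd]
  | succ i ih =>
    rw [twistedProd, twistedProd, ih, Matrix.map_mul]
    congr 1
    rw [transferMat_map, transferMat_map, hpow]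
    ext p q
    fin_cases p <;> fin_cases q <;> simp [transferMat]

theorem exists_coprime_lift {n k w m : ℕ} (hw : Odd w) (hn : 0 < n) (hm : k * w = 1 + n * m) :
    ∃ k' m' r s, k' * w = 1 + n * 4 * m' ∧ k' + n * r = k + n * s := by
  have hwn : Nat.Coprime w n := by
    have h1 : Nat.gcd w n ∣ 1 + n * m := hm ▸ (Nat.gcd_dvd_left w n).mul_left k
    exact Nat.dvd_one.1 ((Nat.dvd_add_left ((Nat.gcd_dvd_right w n).mul_right m)).1 h1)
  have hw4 : Nat.Coprime w (n * 4) := by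
    refine Nat.Coprime.mul_right hwn ?_
    rw [show 4 = 2 ^ 2 by norm_num]
    exact Nat.Coprime.pow_right 2 (Nat.coprime_two_right.2 hw)
  obtain ⟨k', -, hk'⟩ := Nat.exists_mul_mod_eq_one_of_coprime hw4 (by omega)
  have hdiv := Nat.div_add_mod (w * k') (n * 4)
  rw [hk'] at hdiv
  refine ⟨k', w * k' / (n * 4), k / n, k' / n, by linarith, ?_⟩
  have hmod : k' % n = k % n := by
    apply Nat.ModEq.cancel_left_of_coprime (c := w) (Nat.coprime_comm.1 hwn)
    rw [Nat.ModEq, ← hdiv, mul_comm w k, hm, mul_assoc, Nat.mul_add_mod, Nat.add_mul_mod_self_left]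
  have h1 := Nat.div_add_mod k n
  have h2 := Nat.div_add_mod k' n
  linarith

end TransferTrace

section MainEvaluation

variable {F : Type*} [Field F] [Algebra (ZMod 3) F] [Fintype F]

theorem trace_transfer_eq_zero {n : ℕ} (hn : 0 < n) (hcard : Fintype.card F = 3 ^ n)
    {k w m : ℕ} (hcop : Nat.Coprime n k) (hm : k * w = 1 + n * m) (hw : Odd w) {a : F} (ha : a ≠ 0)
    (htr : (twistedProd (frobPow F k) (transferMat a) n).trace = 0) :
    Algebra.trace (ZMod 3) F (twistedProd (frobPow F k) (transferMat a) w 0 1 -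
        twistedProd (frobPow F k) (transferMat a) w 0 0) = 0 := by
  have hF3 := charP_three F
  obtain ⟨k', m', r, s, hm', hkk⟩ := exists_coprime_lift hw hn hm
  let E := FiniteField.Extension F 3 4
  let _ : Fintype E := Fintype.ofFinite E
  have hcardE : Fintype.card E = 3 ^ (n * 4) := by
    rw [Fintype.card_eq_nat_card, FiniteField.natCard_extension, Nat.card_eq_fintype_card, hcard,
      pow_mul]
  set σ := frobPow F k with hσdef
  set τ := frobPow E k' with hτdef
  have hτ : ∀ x, τ (algebraMap F E x) = algebraMap F E (σ x) := by
    intro x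
    rw [hτdef, hσdef, frobPow_apply, frobPow_apply, ← map_pow]
    congr 1
    rw [← pow_three_pow_mod hcard k', ← pow_three_pow_mod hcard k]
    congr 2
    rw [← Nat.add_mul_mod_self_left k' n r, hkk, Nat.add_mul_mod_self_left]
  set z := twistedProd σ (transferMat a) w 0 1 - twistedProd σ (transferMat a) w 0 0 with hz
  set N := twistedProd σ (transferMat a) n with hN
  have hσn : σ ^ n = 1 := frobPow_pow_card hcard k
  have hdet : N.det = 1 := det_twistedProd_transfer σ ha n
  have hNN : N * N = -1 := by
    rw [Matrix.trace_fin_two] at htr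
    rw [Matrix.det_fin_two] at hdet
    have h11 : N 1 1 = - N 0 0 := by linear_combination htr
    ext i j
    fin_cases i <;> fin_cases j <;>
      simp [Matrix.mul_apply, Fin.sum_univ_two, h11] <;> rw [h11] at hdet <;>
      first | ring1 | linear_combination -hdet
  have hadd : ∀ i j, σ ^ i = 1 → twistedProd σ (transferMat a) (i + j) =
      twistedProd σ (transferMat a) j * twistedProd σ (transferMat a) i := by
    intro i j hi
    rw [twistedProd_add, hi]
    congr 1
  have h2 : twistedProd σ (transferMat a) (n + n) = -1 := by rw [hadd _ _ hσn, ← hN, hNN]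
  have h4 : twistedProd σ (transferMat a) (n * 4) = 1 := by
    rw [show n * 4 = (n + n) + (n + n) by ring, hadd _ _ (by rw [pow_add, hσn, one_mul]), h2]
    simp
  have h4E : twistedProd τ (transferMat (algebraMap F E a)) (n * 4) = 1 := by
    rw [twistedProd_map_algebraMap σ τ hτ, h4]
    ext i j
    simp [Matrix.one_apply]
  have haE : algebraMap F E a ≠ 0 := (map_ne_zero _).2 ha
  have hτn : τ ^ (n * 4) = 1 := frobPow_pow_card hcardE k'
  obtain ⟨t, ht, hker⟩ := exists_kernel_of_twistedProd τ (by omega : 0 < n * 4) hτn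
    (frobPow_pow_injOn hcardE hm') haE one_ne_zero ![1, 0] (by simp) (by rw [h4E]; simp)
  have hone : τ 1 = 1 ^ 2 * 1 := by simp
  have hS := sum_pow_transfer_eq τ (three_eq_zero E) haE one_ne_zero one_ne_zero ht hone hker
    (frobPow_pow_eq_cube hcardE hm') (by simp) hτn
  have hZ := twistedProd_transfer_zero_one τ haE one_ne_zero one_ne_zero ht hone hker (n * 4)
  rw [h4E, hτn] at hZ
  have hE0 : ∑ j ∈ Finset.range (n * 4),
      (τ ^ j) (algebraMap F E a * 1 * 1 * t * τ t)⁻¹ = 0 := by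
    simpa [ht] using hZ
  rw [hE0, twistedProd_map_algebraMap σ τ hτ, Matrix.map_apply, Matrix.map_apply,
    ← map_sub, ← hz] at hS
  have hpow : ∀ i x, (τ ^ i) (algebraMap F E x) = algebraMap F E ((σ ^ i) x) := by
    intro i
    induction i with
    | zero => intro x; rfl
    | succ i ih =>
      intro x
      rw [RingHom.pow_succ_apply_left, ih, hτ, ← RingHom.pow_succ_apply_left]
  simp only [hpow] at hS
  rw [← map_sum, map_eq_zero] at hS
  have hper : ∀ i, (σ ^ (n + i)) z = (σ ^ i) z := fun i => by
    rw [RingHom.pow_add_apply, hσn]; rfl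
  have hquad : ∑ i ∈ Finset.range (n * 4), (σ ^ i) z =
      4 * ∑ i ∈ Finset.range n, (σ ^ i) z := by
    rw [show n * 4 = n + (n + (n + n)) by ring]
    simp only [Finset.sum_range_add, hper]
    ring
  apply (algebraMap (ZMod 3) F).injective
  rw [algebraMap_trace_eq_sum_frobPow hn hcop hcard, map_zero]
  linear_combination hS - hquad - (∑ i ∈ Finset.range n, (σ ^ i) z) * three_eq_zero F

/-- The exponential sum of `a x^d + x`, expressed through the product of transfer matrices. -/
theorem cmSum_one_eq {n : ℕ} (hn : 0 < n) (hcard : Fintype.card F = 3 ^ n)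
    {k w m : ℕ} (hk : Odd k) (hcop : Nat.Coprime n k) (hm : k * w = 1 + n * m) (hme : Even m)
    {a : F} (ha : a ≠ 0) :
    cmSum k a 1 = qchar a * traceGauss F * traceChar F
      (-(twistedProd (frobPow F k) (transferMat a) w 0 1 -
        twistedProd (frobPow F k) (transferMat a) w 0 0)) := by
  by_cases hrad : ∀ c : F, c ≠ 0 → ∀ u, ¬InRadical k (a * c ^ ((3 ^ k + 1) / 2)) (c * 1) u
  swap
  · push Not at hrad
    obtain ⟨c, hc, t, ht⟩ := hrad
    exact cmSum_one_of_inRadical hn hcard hk hcop hm hme ha hc ht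
  rw [cmSum_of_not_radical hk hcop hcard ha hrad]
  have hw : Odd w := by
    have h : Odd (k * w) := by rw [hm]; exact (hme.mul_left n).one_add
    exact (Nat.odd_mul.1 h).2
  have hσn : frobPow F k ^ n = 1 := frobPow_pow_card hcard k
  set N := twistedProd (frobPow F k) (transferMat a) n with hN
  have hdet : N.det = 1 := det_twistedProd_transfer _ ha n
  have h3 := three_eq_zero F
  rcases eq_of_frobPow_eq_self hcop hcard (map_trace_twistedProd _ hσn ha) with h | h | h
  · rw [traceChar_apply, map_neg, trace_transfer_eq_zero hn hcard hcop hm hw ha h]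
    simp
  · exfalso
    obtain ⟨c, hc⟩ := FiniteField.exists_nonsquare (ringChar_ne_two F)
    have hc0 : c ≠ 0 := by rintro rfl; exact hc ⟨0, by simp⟩
    have hd : (N + 1).det = 0 := by
      rw [Matrix.trace_fin_two] at h
      rw [Matrix.det_fin_two] at hdet ⊢
      simp
      linear_combination hdet + h + h3
    obtain ⟨X, hX, hNX⟩ := Matrix.exists_mulVec_eq_zero_iff.2 hd
    obtain ⟨t, ht, hker⟩ := exists_kernel_of_twistedProd (frobPow F k) hn hσn
      (frobPow_pow_injOn hcard hm) ha (pow_ne_zero ((3 ^ k - 1) / 2) hc0) X hX (by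
        rw [prod_frobPow_half_eq_neg_one hcard hk hc, ← hN, neg_one_smul,
          eq_neg_iff_add_eq_zero, ← hNX, Matrix.add_mulVec, Matrix.one_mulVec])
    exact hrad c hc0 t ((inRadical_scale_iff hk a hc0).2 ⟨ht, hker⟩)
  · exfalso
    have hd : (N - 1).det = 0 := by
      rw [Matrix.trace_fin_two] at h
      rw [Matrix.det_fin_two] at hdet ⊢
      simp
      linear_combination hdet - h + h3
    obtain ⟨X, hX, hNX⟩ := Matrix.exists_mulVec_eq_zero_iff.2 hd
    obtain ⟨t, ht, hker⟩ := exists_kernel_of_twistedProd (frobPow F k) hn hσn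
      (frobPow_pow_injOn hcard hm) ha one_ne_zero X hX (by
        rw [← hN, ← sub_eq_zero, ← hNX, Matrix.sub_mulVec, Matrix.one_mulVec]
        simp)
    refine hrad 1 one_ne_zero t ((inRadical_scale_iff hk a one_ne_zero).2 ⟨ht, ?_⟩)
    simpa using hker

end MainEvaluation

section SparseSums

variable {K : Type*} [CommRing K]

open Classical in
/-- The sum of the products `∏ i ∈ S, x i` over the subsets `S` of `[r, m)` without two
consecutive elements. -/
noncomputable def sparseSum (x : ℕ → K) (r m : ℕ) : K :=
  ∑ S ∈ (Finset.Ico r m).powerset with ∀ i ∈ S, i + 1 ∉ S, ∏ i ∈ S, x i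

theorem sparseSum_of_le (x : ℕ → K) {r m : ℕ} (h : m ≤ r) : sparseSum x r m = 1 := by
  rw [sparseSum, Finset.Ico_eq_empty_of_le h, Finset.sum_filter]
  simp

theorem sparseSum_add_two (x : ℕ → K) {r m : ℕ} (h : r ≤ m + 1) :
    sparseSum x r (m + 2) = sparseSum x r (m + 1) + x (m + 1) * sparseSum x r m := by
  classical
  simp only [sparseSum, Finset.sum_filter]
  rw [show m + 2 = m + 1 + 1 from rfl, ← Finset.insert_Ico_right_eq_Ico_add_one h,
    Finset.sum_powerset_insert (by simp)]
  congr 1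
  have key : ∀ S ∈ (Finset.Ico r m).powerset,
      (if ∀ i ∈ insert (m + 1) S, i + 1 ∉ insert (m + 1) S then
        ∏ i ∈ insert (m + 1) S, x i else 0) =
      x (m + 1) * if ∀ i ∈ S, i + 1 ∉ S then ∏ i ∈ S, x i else 0 := by
    intro S hS
    have hS' : ∀ i ∈ S, i < m := fun i hi => (Finset.mem_Ico.1 (Finset.mem_powerset.1 hS hi)).2
    have h1 : m + 1 ∉ S := fun hi => by have := hS' _ hi; omega
    have h2 : m + 1 + 1 ∉ S := fun hi => by have := hS' _ hi; omega
    rw [Finset.prod_insert h1, mul_ite, mul_zero]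
    refine if_congr ⟨fun H i hi h3 => ?_, fun H i hi h3 => ?_⟩ rfl rfl
    · exact H i (Finset.mem_insert_of_mem hi) (Finset.mem_insert_of_mem h3)
    · rcases Finset.mem_insert.1 hi with rfl | hi
      · rcases Finset.mem_insert.1 h3 with h4 | h4
        · omega
        · exact h2 h4
      · rcases Finset.mem_insert.1 h3 with h4 | h4
        · have := hS' _ hi
          omega
        · exact H i hi h4
  rw [Finset.mul_sum]
  rcases h.lt_or_eq with h | rfl
  · rw [← Finset.insert_Ico_right_eq_Ico_add_one (Nat.lt_succ_iff.1 h),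
      Finset.sum_powerset_insert (by simp), ← Finset.sum_congr rfl key]
    refine add_eq_left.2 (Finset.sum_eq_zero fun S _ => if_neg fun H => ?_)
    exact H m (by simp) (by simp)
  · rw [← Finset.sum_congr rfl key]
    simp

theorem transfer_recurrence {K : Type*} [Field K] (σ : K →+* K) {a : K} (ha : a ≠ 0) (i : ℕ)
    (q : Fin 2) :
    twistedProd σ (transferMat a) (i + 2) 0 q * ∏ j ∈ Finset.range (i + 2), (σ ^ j) a =
      twistedProd σ (transferMat a) (i + 1) 0 q * ∏ j ∈ Finset.range (i + 1), (σ ^ j) a -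
      ((σ ^ i) a) ^ 2 *
        (twistedProd σ (transferMat a) i 0 q * ∏ j ∈ Finset.range i, (σ ^ j) a) := by
  have h0 : (σ ^ i) a ≠ 0 := (map_ne_zero _).2 ha
  have h1 : (σ ^ (i + 1)) a ≠ 0 := (map_ne_zero _).2 ha
  rw [twistedProd_transfer_zero σ a (i + 1), twistedProd_transfer_one,
    twistedProd_transfer_zero σ a i, Finset.prod_range_succ _ (i + 1), Finset.prod_range_succ]
  field_simp
  ring

theorem transfer_zero_one_eq_sparseSum {K : Type*} [Field K] (σ : K →+* K) {a : K} (ha : a ≠ 0)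
    (m : ℕ) :
    twistedProd σ (transferMat a) (m + 1) 0 1 * ∏ j ∈ Finset.range (m + 1), (σ ^ j) a =
      sparseSum (fun i => -((σ ^ i) a) ^ 2) 1 m := by
  have h1 : twistedProd σ (transferMat a) (0 + 1) 0 1 *
      ∏ j ∈ Finset.range (0 + 1), (σ ^ j) a = 1 := by
    rw [twistedProd_transfer_zero]
    simp [twistedProd, ha]
  induction m using Nat.twoStepInduction with
  | zero => rw [h1, sparseSum_of_le _ (by norm_num)]
  | one =>
    rw [transfer_recurrence σ ha, h1, sparseSum_of_le _ le_rfl]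
    simp [twistedProd]
  | more m ih1 ih2 =>
    rw [transfer_recurrence σ ha, ih1, ih2, sparseSum_add_two _ (by omega)]
    ring

theorem transfer_zero_zero_eq_sparseSum {K : Type*} [Field K] (σ : K →+* K) {a : K} (ha : a ≠ 0)
    (m : ℕ) :
    twistedProd σ (transferMat a) (m + 2) 0 0 * ∏ j ∈ Finset.range (m + 2), (σ ^ j) a =
      -a ^ 2 * sparseSum (fun i => -((σ ^ i) a) ^ 2) 2 (m + 1) := by
  have h1 : twistedProd σ (transferMat a) (0 + 1) 0 0 = 0 := by
    rw [twistedProd_transfer_zero]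
    simp [twistedProd]
  have h2 : twistedProd σ (transferMat a) (0 + 2) 0 0 *
      ∏ j ∈ Finset.range (0 + 2), (σ ^ j) a = -a ^ 2 := by
    rw [transfer_recurrence σ ha, h1]
    simp [twistedProd]
  induction m using Nat.twoStepInduction with
  | zero => rw [h2, sparseSum_of_le _ (by norm_num), mul_one]
  | one =>
    rw [transfer_recurrence σ ha, h2, h1, sparseSum_of_le _ le_rfl]
    ring
  | more m ih1 ih2 =>
    rw [transfer_recurrence σ ha, ih1, ih2, 
      show m + 2 + 1 = m + 1 + 2 by ring, sparseSum_add_two (m := m + 1) _ (by omega)]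
    ring

end SparseSums

section Digits

theorem sum_three_pow_lt {n : ℕ} (e : ℕ → ℕ) (he : ∀ i, e i < 3) :
    ∑ i ∈ Finset.range n, e i * 3 ^ i < 3 ^ n := by
  induction n with
  | zero => simp
  | succ n ih =>
    rw [Finset.sum_range_succ, pow_succ]
    have := Nat.mul_le_mul_right (3 ^ n) (Nat.le_of_lt_succ (he n))
    omega

theorem digit_sum_three_pow {n : ℕ} (e : ℕ → ℕ) (he : ∀ i, e i < 3) {i : ℕ} (hi : i < n) :
    (∑ l ∈ Finset.range n, e l * 3 ^ l) / 3 ^ i % 3 = e i := by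
  have h := congrFun (finFunctionFinEquiv.left_inv (fun l : Fin n => (⟨e l, he l⟩ : Fin 3))) ⟨i, hi⟩
  have h' := congrArg Fin.val h
  simp only [finFunctionFinEquiv] at h'
  rw [Finset.sum_range]
  exact h'

theorem sum_digit_three_pow {n m : ℕ} (hm : m < 3 ^ n) :
    ∑ l ∈ Finset.range n, m / 3 ^ l % 3 * 3 ^ l = m := by
  have h := congrArg Fin.val (finFunctionFinEquiv.right_inv (⟨m, hm⟩ : Fin (3 ^ n)))
  rw [Finset.sum_range]
  simpa [finFunctionFinEquiv] using h

end Digits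

section PermutedDigits

theorem image_range_eq_range {n : ℕ} {pos : ℕ → ℕ} (hmaps : ∀ l < n, pos l < n)
    (hinj : Set.InjOn pos (Finset.range n : Set ℕ)) :
    (Finset.range n).image pos = Finset.range n := by
  refine Finset.eq_of_subset_of_card_le (fun i hi => ?_) ?_
  · obtain ⟨l, hl, rfl⟩ := Finset.mem_image.1 hi
    exact Finset.mem_range.2 (hmaps l (Finset.mem_range.1 hl))
  · rw [Finset.card_image_of_injOn hinj]

theorem digit_sum_three_pow_perm {n : ℕ} {pos : ℕ → ℕ} (hmaps : ∀ l < n, pos l < n)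
    (hinj : Set.InjOn pos (Finset.range n : Set ℕ)) (E : ℕ → ℕ) (hE : ∀ l, E l < 3) :
    ∑ l ∈ Finset.range n, E l * 3 ^ pos l < 3 ^ n ∧
      ∀ l < n, (∑ i ∈ Finset.range n, E i * 3 ^ pos i) / 3 ^ pos l % 3 = E l := by
  classical
  let e : ℕ → ℕ := fun i => E (Function.invFunOn pos (Finset.range n : Set ℕ) i)
  have he : ∀ l < n, e (pos l) = E l := fun l hl => by
    simp only [e]
    rw [hinj.leftInvOn_invFunOn (by simpa using hl)]
  have hsum : ∑ l ∈ Finset.range n, E l * 3 ^ pos l = ∑ i ∈ Finset.range n, e i * 3 ^ i := by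
    conv_rhs => rw [← image_range_eq_range hmaps hinj, Finset.sum_image hinj]
    exact Finset.sum_congr rfl fun l hl => by rw [he l (Finset.mem_range.1 hl)]
  rw [hsum]
  refine ⟨sum_three_pow_lt e fun i => hE _, fun l hl => ?_⟩
  rw [digit_sum_three_pow e (fun i => hE _) (hmaps l hl), he l hl]

theorem sum_digit_three_pow_perm {n : ℕ} {pos : ℕ → ℕ} (hmaps : ∀ l < n, pos l < n)
    (hinj : Set.InjOn pos (Finset.range n : Set ℕ)) {m : ℕ} (hm : m < 3 ^ n) :
    ∑ l ∈ Finset.range n, m / 3 ^ pos l % 3 * 3 ^ pos l = m := by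
  conv_rhs => rw [← sum_digit_three_pow hm, ← image_range_eq_range hmaps hinj,
    Finset.sum_image hinj]

theorem dig_natCast {n m : ℕ} (hm : m < 3 ^ n - 1) (i : ℕ) :
    dig n (m : ℤ) i = m / 3 ^ (i % n) % 3 := by
  have h : (m : ℤ) < (3 : ℤ) ^ n - 1 := by
    have h1 : (m : ℤ) < ((3 ^ n - 1 : ℕ) : ℤ) := by exact_mod_cast hm
    rwa [Nat.cast_sub (Nat.one_le_pow _ _ (by norm_num)), Nat.cast_pow] at h1
  rw [dig, Int.emod_eq_of_lt (by positivity) h, Int.toNat_natCast]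

theorem dig_mod (n : ℕ) (j : ℤ) (i : ℕ) : dig n j (i % n) = dig n j i := by
  rw [dig, dig, Nat.mod_mod]

theorem N2_eq_card {n : ℕ} {pos : ℕ → ℕ} (hmaps : ∀ l < n, pos l < n)
    (hinj : Set.InjOn pos (Finset.range n : Set ℕ)) (j : ℤ) :
    N2 n j = ((Finset.range n).filter fun l => dig n j (pos l) = 2).card := by
  conv_lhs => rw [N2, ← image_range_eq_range hmaps hinj, Finset.filter_image]
  exact Finset.card_image_of_injOn (hinj.mono (Finset.coe_subset.2 (Finset.filter_subset _ _)))

/-- The digit function taking the value `1` on `[w, ∞)`, `2` on `S` and `0` elsewhere. -/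
def digitOf (w : ℕ) (S : Finset ℕ) (l : ℕ) : ℕ := if w ≤ l then 1 else if l ∈ S then 2 else 0

theorem digitOf_lt (w : ℕ) (S : Finset ℕ) (l : ℕ) : digitOf w S l < 3 := by
  rw [digitOf]; split_ifs <;> norm_num

theorem sum_two_mul_three_pow (n : ℕ) : ∑ i ∈ Finset.range n, 2 * 3 ^ i = 3 ^ n - 1 := by
  induction n with
  | zero => simp
  | succ n ih =>
    have := Nat.one_le_pow n 3 (by norm_num)
    rw [Finset.sum_range_succ, ih, pow_succ]
    omega

theorem sum_digitOf_bounds {n w : ℕ} (hw0 : 0 < w) (hw : w < n) {pos : ℕ → ℕ}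
    (hmaps : ∀ l < n, pos l < n) (hinj : Set.InjOn pos (Finset.range n : Set ℕ))
    {S : Finset ℕ} (hS : S ⊆ Finset.range (w - 1)) :
    0 < ∑ l ∈ Finset.range n, digitOf w S l * 3 ^ pos l ∧
      ∑ l ∈ Finset.range n, digitOf w S l * 3 ^ pos l < 3 ^ n - 1 := by
  obtain ⟨h1, h2⟩ := digit_sum_three_pow_perm hmaps hinj _ (digitOf_lt w S)
  constructor
  · rw [Nat.pos_iff_ne_zero]
    intro h
    have := h2 w hw
    rw [h] at this
    simp [digitOf] at this
  · refine lt_of_le_of_ne (Nat.le_sub_one_of_lt h1) fun h => ?_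
    have h3 := h2 (w - 1) (by omega)
    have h4 : w - 1 ∉ S := fun h => by simpa using hS h
    rw [h, ← sum_two_mul_three_pow,
      digit_sum_three_pow (fun _ => 2) (by norm_num) (hmaps _ (by omega)), digitOf,
      if_neg (by omega), if_neg h4] at h3
    omega

theorem sum_over_digit_sets {F : Type*} [Field F] {n w : ℕ} (hw0 : 0 < w) (hw : w < n)
    {pos : ℕ → ℕ} (hmaps : ∀ l < n, pos l < n)
    (hinj : Set.InjOn pos (Finset.range n : Set ℕ)) (J : Finset ℤ) (T : Finset (Finset ℕ))
    (hT : ∀ S ∈ T, S ⊆ Finset.range (w - 1))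
    (hJ : ∀ j, j ∈ J ↔ 0 < j ∧ j < 3 ^ n - 1 ∧ (∀ l, w ≤ l → l < n → dig n j (pos l) = 1) ∧
      (∀ l < w, dig n j (pos l) = 0 ∨ dig n j (pos l) = 2) ∧
      ((Finset.range w).filter fun l => dig n j (pos l) = 2) ∈ T) (b : F) :
    ∑ j ∈ J, (-1 : F) ^ N2 n j * b ^ j =
      (∏ l ∈ Finset.Ico w n, b ^ 3 ^ pos l) * ∑ S ∈ T, ∏ l ∈ S, -(b ^ 3 ^ pos l) ^ 2 := by
  classical
  have hbound : ∀ j ∈ J, ∃ m : ℕ, m < 3 ^ n - 1 ∧ j = m := by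
    intro j hj
    obtain ⟨h1, h2, -⟩ := (hJ j).1 hj
    obtain ⟨m, rfl⟩ := Int.eq_ofNat_of_zero_le h1.le
    refine ⟨m, ?_, rfl⟩
    have h3 : (m : ℤ) < ((3 ^ n - 1 : ℕ) : ℤ) := by
      rw [Nat.cast_sub (Nat.one_le_pow _ _ (by norm_num)), Nat.cast_pow]
      exact h2
    exact_mod_cast h3
  have hdigit : ∀ j ∈ J, ∀ l < n, dig n j (pos l) =
      digitOf w ((Finset.range w).filter fun l => dig n j (pos l) = 2) l := by
    intro j hj l hl
    obtain ⟨-, -, h1, h2, -⟩ := (hJ j).1 hj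
    rw [digitOf]
    split_ifs with h3 h4
    · exact h1 l h3 hl
    · exact (Finset.mem_filter.1 h4).2
    · refine (h2 l (not_le.1 h3)).resolve_right fun h5 => h4 ?_
      exact Finset.mem_filter.2 ⟨Finset.mem_range.2 (not_le.1 h3), h5⟩
  have hsum : ∀ j ∈ J, j = ((∑ l ∈ Finset.range n,
      digitOf w ((Finset.range w).filter fun l => dig n j (pos l) = 2) l * 3 ^ pos l : ℕ) : ℤ) := by
    intro j hj
    obtain ⟨m, hm, hjm⟩ := hbound j hj
    conv_lhs => rw [hjm]
    rw [Nat.cast_inj]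
    rw [← sum_digit_three_pow_perm hmaps hinj (m := m) (by omega)]
    refine Finset.sum_congr rfl fun l hl => ?_
    rw [← hdigit j hj l (Finset.mem_range.1 hl), hjm, dig_natCast hm,
      Nat.mod_eq_of_lt (hmaps l (Finset.mem_range.1 hl))]
  have hback : ∀ S ∈ T, ∀ l < n,
      dig n ((∑ l ∈ Finset.range n, digitOf w S l * 3 ^ pos l : ℕ) : ℤ) (pos l) =
        digitOf w S l := by
    intro S hS l hl
    rw [dig_natCast (sum_digitOf_bounds hw0 hw hmaps hinj (hT S hS)).2,
      Nat.mod_eq_of_lt (hmaps l hl),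
      (digit_sum_three_pow_perm hmaps hinj _ (digitOf_lt w S)).2 l hl]
  have hset : ∀ S ∈ T, ((Finset.range w).filter fun l =>
      dig n ((∑ l ∈ Finset.range n, digitOf w S l * 3 ^ pos l : ℕ) : ℤ) (pos l) = 2) = S := by
    intro S hS
    ext l
    rw [Finset.mem_filter, Finset.mem_range]
    constructor
    · rintro ⟨h1, h2⟩
      rw [hback S hS l (by omega), digitOf, if_neg (by omega)] at h2
      by_contra h3
      rw [if_neg h3] at h2
      omega
    · intro h1
      have h2 : l < w := by
        have := Finset.mem_range.1 (hT S hS h1)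
        omega
      refine ⟨h2, ?_⟩
      rw [hback S hS l (by omega), digitOf, if_neg (by omega), if_pos h1]
  rw [Finset.mul_sum]
  refine Finset.sum_nbij' (fun j => (Finset.range w).filter fun l => dig n j (pos l) = 2)
    (fun S => ((∑ l ∈ Finset.range n, digitOf w S l * 3 ^ pos l : ℕ) : ℤ))
    (fun j hj => ((hJ j).1 hj).2.2.2.2) (fun S hS => ?_) (fun j hj => (hsum j hj).symm)
    hset (fun j hj => ?_)
  · obtain ⟨h1, h2⟩ := sum_digitOf_bounds hw0 hw hmaps hinj (hT S hS)
    refine (hJ _).2 ⟨by exact_mod_cast h1, ?_, fun l hl hln => ?_, fun l hl => ?_, ?_⟩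
    · have h3 : ((∑ l ∈ Finset.range n, digitOf w S l * 3 ^ pos l : ℕ) : ℤ) <
          ((3 ^ n - 1 : ℕ) : ℤ) := by exact_mod_cast h2
      rwa [Nat.cast_sub (Nat.one_le_pow _ _ (by norm_num)), Nat.cast_pow] at h3
    · rw [hback S hS l hln, digitOf, if_pos hl]
    · rw [hback S hS l (by omega), digitOf, if_neg (by omega)]
      split_ifs <;> simp
    · rw [hset S hS]
      exact hS
  · have hN : N2 n j = ((Finset.range w).filter fun l => dig n j (pos l) = 2).card := by
      rw [N2_eq_card hmaps hinj]
      congr 1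
      ext l
      simp only [Finset.mem_filter, Finset.mem_range]
      refine ⟨fun ⟨h1, h2⟩ => ⟨?_, h2⟩, fun ⟨h1, h2⟩ => ⟨by omega, h2⟩⟩
      by_contra h3
      have := ((hJ j).1 hj).2.2.1 l (not_lt.1 h3) h1
      omega
    have hS := hT _ ((hJ j).1 hj).2.2.2.2
    conv_lhs => rw [hsum j hj, ← hsum j hj, hN]
    conv_lhs => arg 2; rw [hsum j hj]
    generalize ((Finset.range w).filter fun l => dig n j (pos l) = 2) = S at hS ⊢
    rw [zpow_natCast, ← Finset.prod_pow_eq_pow_sum,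
      ← Finset.prod_range_mul_prod_Ico _ hw.le, mul_comm (∏ l ∈ Finset.range w, _) _,
      mul_left_comm]
    congr 1
    · refine Finset.prod_congr rfl fun l hl => ?_
      rw [digitOf, if_pos (Finset.mem_Ico.1 hl).1, one_mul]
    · have hSw : S ⊆ Finset.range w := hS.trans (Finset.range_mono (by omega))
      rw [← Finset.prod_subset hSw (fun l hl hlS => by
        rw [digitOf, if_neg (by simpa using hl), if_neg hlS, zero_mul, pow_zero]),
        ← Finset.prod_const, ← Finset.prod_mul_distrib]
      refine Finset.prod_congr rfl fun l hl => ?_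
      rw [digitOf, if_neg (by simpa using hSw hl), if_pos hl, mul_comm 2, pow_mul]
      ring

end PermutedDigits

section DigitConditions

open Classical in
/-- The subsets of `[r, m)` without two consecutive elements. -/
noncomputable def sparseSets (r m : ℕ) : Finset (Finset ℕ) :=
  (Finset.Ico r m).powerset.filter fun S => ∀ i ∈ S, i + 1 ∉ S

theorem mem_sparseSets {r m : ℕ} {S : Finset ℕ} :
    S ∈ sparseSets r m ↔ S ⊆ Finset.Ico r m ∧ ∀ i ∈ S, i + 1 ∉ S := by
  simp [sparseSets]

open Classical in
/-- The sets `{0} ∪ S`, where `S ⊆ [2, w - 1)` has no two consecutive elements. -/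
noncomputable def sparseSetsWithZero (w : ℕ) : Finset (Finset ℕ) :=
  if w = 1 then ∅ else (sparseSets 2 (w - 1)).image (insert 0)

theorem digit_condition_sparse_iff {n w : ℕ} (hw0 : 0 < w) (D : ℕ → ℕ) :
    ((∀ l, w ≤ l → l < n → D l = 1) ∧ D 0 = 0 ∧ D (w - 1) = 0 ∧
      (∀ l, 1 ≤ l → l ≤ w - 2 → D l = 0 ∨ D l = 2) ∧
      (∀ l, 1 ≤ l → l + 1 ≤ w - 2 → ¬(D l = 2 ∧ D (l + 1) = 2))) ↔
    ((∀ l, w ≤ l → l < n → D l = 1) ∧ (∀ l < w, D l = 0 ∨ D l = 2) ∧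
      ((Finset.range w).filter fun l => D l = 2) ∈ sparseSets 1 (w - 1)) := by
  refine and_congr_right fun _ => ?_
  rw [mem_sparseSets]
  constructor
  · rintro ⟨h0, h1, h2, h3⟩
    have hmem : ∀ l < w, D l = 2 → 1 ≤ l ∧ l < w - 1 := by
      intro l hl h
      have hl0 : l ≠ 0 := by rintro rfl; omega
      have hl1 : l ≠ w - 1 := by rintro rfl; omega
      omega
    refine ⟨fun l hl => ?_, fun l hl => ?_, fun l hl hl' => ?_⟩
    · by_cases hl0 : l = 0
      · exact Or.inl (hl0 ▸ h0)
      by_cases hl1 : l = w - 1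
      · exact Or.inl (hl1 ▸ h1)
      exact h2 l (by omega) (by omega)
    · rw [Finset.mem_filter, Finset.mem_range] at hl
      exact Finset.mem_Ico.2 (hmem l hl.1 hl.2)
    · rw [Finset.mem_filter, Finset.mem_range] at hl hl'
      have := hmem l hl.1 hl.2
      have := hmem _ hl'.1 hl'.2
      exact h3 l (by omega) (by omega) ⟨hl.2, hl'.2⟩
  · rintro ⟨h1, h2, h3⟩
    have hzero : ∀ l < w, ¬(1 ≤ l ∧ l < w - 1) → D l = 0 := fun l hl h =>
      (h1 l hl).resolve_right fun h4 => h (Finset.mem_Ico.1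
        (h2 (Finset.mem_filter.2 ⟨Finset.mem_range.2 hl, h4⟩)))
    refine ⟨hzero 0 hw0 (by omega), hzero _ (by omega) (by omega),
      fun l _ hl => h1 l (by omega), fun l hl0 hl h => ?_⟩
    exact h3 l (Finset.mem_filter.2 ⟨Finset.mem_range.2 (by omega), h.1⟩)
      (Finset.mem_filter.2 ⟨Finset.mem_range.2 (by omega), h.2⟩)

theorem digit_condition_sparse_zero_iff {n w : ℕ} (hw0 : 0 < w) (hwn : w < n) (D : ℕ → ℕ) :
    ((∀ l, w ≤ l → l < n → D l = 1) ∧ D 0 = 2 ∧ D 1 = 0 ∧ D (w - 1) = 0 ∧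
      (∀ l, 2 ≤ l → l ≤ w - 2 → D l = 0 ∨ D l = 2) ∧
      (∀ l, 2 ≤ l → l + 1 ≤ w - 2 → ¬(D l = 2 ∧ D (l + 1) = 2))) ↔
    ((∀ l, w ≤ l → l < n → D l = 1) ∧ (∀ l < w, D l = 0 ∨ D l = 2) ∧
      ((Finset.range w).filter fun l => D l = 2) ∈ sparseSetsWithZero w) := by
  classical
  refine and_congr_right fun _ => ?_
  rw [sparseSetsWithZero]
  split_ifs with hw1
  · subst hw1
    refine ⟨fun ⟨h0, _, h1, _⟩ => ?_, fun ⟨_, h⟩ => by simp at h⟩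
    simp only [Nat.sub_self] at h1
    omega
  have hw2 : 2 ≤ w := by omega
  constructor
  · rintro ⟨h0, h1, h1', h2, h3⟩
    have hmem : ∀ l < w, D l = 2 → l ≠ 0 → 2 ≤ l ∧ l < w - 1 := by
      intro l hl h hl0
      have hl1 : l ≠ w - 1 := by rintro rfl; omega
      have hl2 : l ≠ 1 := by rintro rfl; omega
      omega
    refine ⟨fun l hl => ?_, ?_⟩
    · by_cases hl0 : l = 0
      · exact Or.inr (hl0 ▸ h0)
      by_cases hl1 : l = w - 1
      · exact Or.inl (hl1 ▸ h1')
      by_cases hl2 : l = 1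
      · exact Or.inl (hl2 ▸ h1)
      exact h2 l (by omega) (by omega)
    · refine Finset.mem_image.2 ⟨((Finset.range w).filter fun l => D l = 2).erase 0, ?_,
        Finset.insert_erase (Finset.mem_filter.2 ⟨Finset.mem_range.2 hw0, h0⟩)⟩
      rw [mem_sparseSets]
      refine ⟨fun l hl => ?_, fun l hl hl' => ?_⟩
      · rw [Finset.mem_erase, Finset.mem_filter, Finset.mem_range] at hl
        exact Finset.mem_Ico.2 (hmem l hl.2.1 hl.2.2 hl.1)
      · rw [Finset.mem_erase, Finset.mem_filter, Finset.mem_range] at hl hl'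
        have := hmem l hl.2.1 hl.2.2 hl.1
        have := hmem _ hl'.2.1 hl'.2.2 hl'.1
        exact h3 l (by omega) (by omega) ⟨hl.2.2, hl'.2.2⟩
  · rintro ⟨h1, h2⟩
    obtain ⟨S, hS, hSeq⟩ := Finset.mem_image.1 h2
    obtain ⟨hS1, hS2⟩ := mem_sparseSets.1 hS
    have hiff : ∀ l < w, D l = 2 ↔ l = 0 ∨ l ∈ S := fun l hl => by
      have := Finset.ext_iff.1 hSeq l
      rw [Finset.mem_insert, Finset.mem_filter, Finset.mem_range] at this
      rw [this]
      simp [hl]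
    have hzero : ∀ l < w, l ≠ 0 → ¬(2 ≤ l ∧ l < w - 1) → D l = 0 := fun l hl hl0 h =>
      (h1 l hl).resolve_right fun h4 => h (Finset.mem_Ico.1
        (hS1 (((hiff l hl).1 h4).resolve_left hl0)))
    refine ⟨(hiff 0 hw0).2 (Or.inl rfl), hzero 1 hw2 (by omega) (by omega),
      hzero _ (by omega) (by omega) (by omega), fun l _ hl => h1 l (by omega),
      fun l hl0 hl h => ?_⟩
    exact hS2 l (((hiff l (by omega)).1 h.1).resolve_left (by omega))
      (((hiff _ (by omega)).1 h.2).resolve_left (by omega))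

theorem sum_sparseSets {K : Type*} [CommRing K] (x : ℕ → K) (r m : ℕ) :
    ∑ S ∈ sparseSets r m, ∏ i ∈ S, x i = sparseSum x r m := rfl

theorem sum_sparseSetsWithZero {K : Type*} [CommRing K] (x : ℕ → K) {w : ℕ} (hw : w ≠ 1) :
    ∑ S ∈ sparseSetsWithZero w, ∏ i ∈ S, x i = x 0 * sparseSum x 2 (w - 1) := by
  classical
  have h0 : ∀ S ∈ sparseSets 2 (w - 1), 0 ∉ S := fun S hS h => by
    have := (mem_sparseSets.1 hS).1 h
    simp at this
  rw [sparseSetsWithZero, if_neg hw, Finset.sum_image, ← sum_sparseSets, Finset.mul_sum]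
  · exact Finset.sum_congr rfl fun S hS => Finset.prod_insert (h0 S hS)
  · intro S hS S' hS' h
    rw [← Finset.erase_insert (h0 S hS), ← Finset.erase_insert (h0 S' hS')]
    exact congrArg (fun S => Finset.erase S 0) h

end DigitConditions

section DualValue

theorem dual_sum_eq {F : Type*} [Field F] {n w : ℕ} (hw0 : 0 < w) (hwn : w < n)
    {pos : ℕ → ℕ} (hmaps : ∀ l < n, pos l < n)
    (hinj : Set.InjOn pos (Finset.range n : Set ℕ)) (U V : Finset ℤ)
    (hU : ∀ j, j ∈ U ↔ 0 < j ∧ j < 3 ^ n - 1 ∧ (∀ l, w ≤ l → l < n → dig n j (pos l) = 1) ∧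
      (∀ l < w, dig n j (pos l) = 0 ∨ dig n j (pos l) = 2) ∧
      ((Finset.range w).filter fun l => dig n j (pos l) = 2) ∈ sparseSets 1 (w - 1))
    (hV : ∀ j, j ∈ V ↔ 0 < j ∧ j < 3 ^ n - 1 ∧ (∀ l, w ≤ l → l < n → dig n j (pos l) = 1) ∧
      (∀ l < w, dig n j (pos l) = 0 ∨ dig n j (pos l) = 2) ∧
      ((Finset.range w).filter fun l => dig n j (pos l) = 2) ∈ sparseSetsWithZero w)
    (σ : F →+* F) {b c e : F} (hc : c ≠ 0) (hb : ∀ l, (σ ^ l) c = b ^ 3 ^ pos l)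
    (he : e ^ 2 = 1) (hprod : ∏ l ∈ Finset.range n, b ^ 3 ^ pos l = e) :
    ∑ j ∈ U, (-1 : F) ^ (N2 n j + 1) * e * b ^ j + ∑ j ∈ V, (-1 : F) ^ N2 n j * e * b ^ j =
      -(twistedProd σ (transferMat c) w 0 1 - twistedProd σ (transferMat c) w 0 0) := by
  classical
  have hTU : ∀ S ∈ sparseSets 1 (w - 1), S ⊆ Finset.range (w - 1) := fun S hS i hi =>
    Finset.mem_range.2 (Finset.mem_Ico.1 ((mem_sparseSets.1 hS).1 hi)).2
  have hTV : ∀ S ∈ sparseSetsWithZero w, S ⊆ Finset.range (w - 1) := by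
    intro S hS i hi
    rw [sparseSetsWithZero] at hS
    split_ifs at hS with hw1
    · simp at hS
    obtain ⟨S', hS', rfl⟩ := Finset.mem_image.1 hS
    rw [Finset.mem_range]
    rcases Finset.mem_insert.1 hi with rfl | hi
    · omega
    · exact (Finset.mem_Ico.1 ((mem_sparseSets.1 hS').1 hi)).2
  have h1 := sum_over_digit_sets hw0 hwn hmaps hinj U _ hTU hU b
  have h2 := sum_over_digit_sets hw0 hwn hmaps hinj V _ hTV hV b
  simp only [← hb] at h1 h2 hprod
  have hsplit := Finset.prod_range_mul_prod_Ico (fun l => (σ ^ l) c) hwn.le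
  rw [hprod] at hsplit
  set p := ∏ l ∈ Finset.range w, (σ ^ l) c with hp
  set q := ∏ l ∈ Finset.Ico w n, (σ ^ l) c
  have hp0 : p ≠ 0 := Finset.prod_ne_zero_iff.2 fun l _ => (map_ne_zero _).2 hc
  have hU' : p * (e * q) = 1 := by linear_combination e * hsplit + he
  have e1 : ∑ j ∈ U, (-1 : F) ^ (N2 n j + 1) * e * b ^ j =
      -e * ∑ j ∈ U, (-1 : F) ^ N2 n j * b ^ j := by
    rw [Finset.mul_sum]
    exact Finset.sum_congr rfl fun j _ => by ring
  have e2 : ∑ j ∈ V, (-1 : F) ^ N2 n j * e * b ^ j =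
      e * ∑ j ∈ V, (-1 : F) ^ N2 n j * b ^ j := by
    rw [Finset.mul_sum]
    exact Finset.sum_congr rfl fun j _ => by ring
  have h01 : twistedProd σ (transferMat c) w 0 1 * p =
      ∑ S ∈ sparseSets 1 (w - 1), ∏ l ∈ S, -((σ ^ l) c) ^ 2 := by
    obtain ⟨m, rfl⟩ : ∃ m, w = m + 1 := ⟨w - 1, by omega⟩
    exact transfer_zero_one_eq_sparseSum σ hc m
  have h00 : twistedProd σ (transferMat c) w 0 0 * p =
      ∑ S ∈ sparseSetsWithZero w, ∏ l ∈ S, -((σ ^ l) c) ^ 2 := by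
    by_cases hw1 : w = 1
    · rw [sparseSetsWithZero, if_pos hw1, hw1, twistedProd_transfer_zero]
      simp [twistedProd]
    · rw [sum_sparseSetsWithZero _ hw1]
      obtain ⟨m, rfl⟩ : ∃ m, w = m + 2 := ⟨w - 2, by omega⟩
      exact transfer_zero_zero_eq_sparseSum σ hc m
  rw [e1, e2, h1, h2, ← h01, ← h00]
  linear_combination (twistedProd σ (transferMat c) w 0 0 -
    twistedProd σ (transferMat c) w 0 1) * hU'

end DualValue

section DigitPositions

theorem affine_mod_injOn {n k : ℕ} (hcop : Nat.Coprime n k) (s : ℕ) :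
    Set.InjOn (fun l => (s + k * l) % n) (Finset.range n : Set ℕ) := by
  intro i hi j hj hij
  have h1 : s + k * i ≡ s + k * j [MOD n] := hij
  have h2 : i ≡ j [MOD n] := Nat.ModEq.cancel_left_of_coprime hcop (Nat.ModEq.add_left_cancel' s h1)
  exact Nat.ModEq.eq_of_lt_of_lt h2 (Finset.mem_range.1 hi) (Finset.mem_range.1 hj)

theorem mem_U0fin_iff {n k w : ℕ} (hw0 : 0 < w) (hn : 0 < n) (j : ℤ) :
    j ∈ U0fin n k w ↔ 0 < j ∧ j < 3 ^ n - 1 ∧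
      (∀ l, w ≤ l → l < n → dig n j ((0 + k * l) % n) = 1) ∧
      (∀ l < w, dig n j ((0 + k * l) % n) = 0 ∨ dig n j ((0 + k * l) % n) = 2) ∧
      ((Finset.range w).filter fun l => dig n j ((0 + k * l) % n) = 2) ∈ sparseSets 1 (w - 1) := by
  have h := digit_condition_sparse_iff (n := n) hw0 fun l => dig n j (l * k)
  simp only [zero_mul] at h
  have h0 : j ∈ U0fin n k w ↔ j ∈ U0set n k w := by
    simp only [U0fin, Finset.mem_filter, Finset.mem_Ioo, and_iff_right_iff_imp]
    exact fun h => ⟨h.1, h.2.1⟩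
  simp only [h0, dig_mod, zero_add, mul_comm k, ← h, U0set, Set.mem_ofPred_eq,
    Nat.le_sub_one_iff_lt hn]

theorem mem_V0fin_iff {n k w : ℕ} (hw0 : 0 < w) (hwn : w < n) (j : ℤ) :
    j ∈ V0fin n k w ↔ 0 < j ∧ j < 3 ^ n - 1 ∧
      (∀ l, w ≤ l → l < n → dig n j ((0 + k * l) % n) = 1) ∧
      (∀ l < w, dig n j ((0 + k * l) % n) = 0 ∨ dig n j ((0 + k * l) % n) = 2) ∧
      ((Finset.range w).filter fun l => dig n j ((0 + k * l) % n) = 2) ∈ sparseSetsWithZero w := by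
  have h := digit_condition_sparse_zero_iff (n := n) hw0 hwn fun l => dig n j (l * k)
  simp only [zero_mul, one_mul] at h
  have h0 : j ∈ V0fin n k w ↔ j ∈ V0set n k w := by
    simp only [V0fin, Finset.mem_filter, Finset.mem_Ioo, and_iff_right_iff_imp]
    exact fun h => ⟨h.1, h.2.1⟩
  simp only [h0, dig_mod, zero_add, mul_comm k, ← h, V0set, Set.mem_ofPred_eq,
    Nat.le_sub_one_iff_lt (hw0.trans hwn)]

theorem dig_reflect {n k : ℕ} (hkn : k < n) (j : ℤ) {l : ℕ} (hl : l < n) :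
    dig n j ((2 * n - k + (2 * n - k) * l) % n) = dig n j ((n - 1 - l) * k) := by
  rw [dig_mod, ← dig_mod n j ((n - 1 - l) * k), ← dig_mod n j (2 * n - k + (2 * n - k) * l)]
  congr 1
  obtain ⟨r, rfl⟩ : ∃ r, n = l + 1 + r := ⟨n - (l + 1), by omega⟩
  obtain ⟨t, ht⟩ : ∃ t, l + 1 + r = k + t := ⟨l + 1 + r - k, by omega⟩
  have h1 : 2 * (l + 1 + r) - k = (l + 1 + r) + t := by omega
  have h2 : l + 1 + r - 1 - l = r := by omega
  rw [h1, h2]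
  have : l + 1 + r + t + (l + 1 + r + t) * l + k * (l + 1) ≡ r * k + k * (l + 1)
      [MOD (l + 1 + r)] := by
    have e1 : l + 1 + r + t + (l + 1 + r + t) * l + k * (l + 1) = (l + 1 + r) * (2 * (l + 1)) := by
      have : l + 1 + r + t + (l + 1 + r + t) * l + k * (l + 1) =
        (l + 1 + r + (k + t)) * (l + 1) := by ring
      rw [this, ← ht]; ring
    have e2 : r * k + k * (l + 1) = (l + 1 + r) * k := by ring
    rw [e1, e2]
    exact (Nat.modEq_zero_iff_dvd.2 (dvd_mul_right _ _)).trans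
      (Nat.modEq_zero_iff_dvd.2 (dvd_mul_right _ _)).symm
  exact Nat.ModEq.add_right_cancel' _ this

theorem reflect_conditions {n w : ℕ} {P : Prop} {D E : ℕ → ℕ} (hwn : w < n)
    (h : ∀ l < n, E l = D l) (T : Finset (Finset ℕ)) :
    (P ∧ (∀ l, n - w ≤ l → l < n → D l = 1) ∧ (∀ l < n - w, D l = 0 ∨ D l = 2) ∧
      ((Finset.range (n - w)).filter fun l => D l = 2) ∈ T) ↔
    (P ∧ (∀ l, n - w ≤ l → l < n → E l = 1) ∧ (∀ l < n - w, E l = 0 ∨ E l = 2) ∧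
      ((Finset.range (n - w)).filter fun l => E l = 2) ∈ T) := by
  have h3 : ((Finset.range (n - w)).filter fun l => D l = 2) =
      (Finset.range (n - w)).filter fun l => E l = 2 := by
    refine Finset.filter_congr fun l hl => ?_
    rw [h l (by have := Finset.mem_range.1 hl; omega)]
  rw [h3]
  refine and_congr_right fun _ => and_congr ?_ (and_congr ?_ Iff.rfl)
  · exact forall_congr' fun l => imp_congr_right fun _ => imp_congr_right fun hl => by rw [h l hl]
  · exact forall_congr' fun l => imp_congr_right fun hl => by rw [h l (by omega)]

theorem mem_U1set_iff {n k w : ℕ} (hw0 : 0 < w) (hwn : w < n) (j : ℤ) :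
    j ∈ U1set n k w ↔ (0 < j ∧ j < 3 ^ n - 1) ∧
      (∀ l, n - w ≤ l → l < n → dig n j ((n - 1 - l) * k) = 1) ∧
      dig n j ((n - 1 - 0) * k) = 0 ∧ dig n j ((n - 1 - (n - w - 1)) * k) = 0 ∧
      (∀ l, 1 ≤ l → l ≤ n - w - 2 → dig n j ((n - 1 - l) * k) = 0 ∨
        dig n j ((n - 1 - l) * k) = 2) ∧
      (∀ l, 1 ≤ l → l + 1 ≤ n - w - 2 → ¬(dig n j ((n - 1 - l) * k) = 2 ∧
        dig n j ((n - 1 - (l + 1)) * k) = 2)) := by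
  rw [show n - 1 - (n - w - 1) = w by omega, show n - 1 - 0 = n - 1 by omega]
  constructor
  · rintro ⟨h1, h2, h3, h4, h5, h6, h7⟩
    refine ⟨⟨h1, h2⟩, fun l _ _ => h3 _ (by omega), h5, h4, fun l _ _ => h6 _ (by omega) (by omega),
      fun l hl hl' h => h7 (n - 1 - (l + 1)) (by omega) (by omega) ⟨h.2, ?_⟩⟩
    rw [show n - 1 - (l + 1) + 1 = n - 1 - l by omega]; exact h.1
  · rintro ⟨⟨h1, h2⟩, h3, h5, h4, h6, h7⟩
    refine ⟨h1, h2, fun i hi => ?_, h4, h5, fun i hi hi' => ?_, fun i hi hi' h => ?_⟩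
    · have := h3 (n - 1 - i) (by omega) (by omega)
      rwa [show n - 1 - (n - 1 - i) = i by omega] at this
    · have := h6 (n - 1 - i) (by omega) (by omega)
      rwa [show n - 1 - (n - 1 - i) = i by omega] at this
    · have := h7 (n - 1 - (i + 1)) (by omega) (by omega)
      rw [show n - 1 - (n - 1 - (i + 1)) = i + 1 by omega,
        show n - 1 - (n - 1 - (i + 1) + 1) = i by omega] at this
      exact this ⟨h.2, h.1⟩

theorem mem_V1set_iff {n k w : ℕ} (hw0 : 0 < w) (hwn : w < n) (j : ℤ) :
    j ∈ V1set n k w ↔ (0 < j ∧ j < 3 ^ n - 1) ∧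
      (∀ l, n - w ≤ l → l < n → dig n j ((n - 1 - l) * k) = 1) ∧
      dig n j ((n - 1 - 0) * k) = 2 ∧ dig n j ((n - 1 - 1) * k) = 0 ∧
      dig n j ((n - 1 - (n - w - 1)) * k) = 0 ∧
      (∀ l, 2 ≤ l → l ≤ n - w - 2 → dig n j ((n - 1 - l) * k) = 0 ∨
        dig n j ((n - 1 - l) * k) = 2) ∧
      (∀ l, 2 ≤ l → l + 1 ≤ n - w - 2 → ¬(dig n j ((n - 1 - l) * k) = 2 ∧
        dig n j ((n - 1 - (l + 1)) * k) = 2)) := by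
  rw [show n - 1 - (n - w - 1) = w by omega, show n - 1 - 0 = n - 1 by omega,
    show n - 1 - 1 = n - 2 by omega]
  constructor
  · rintro ⟨h1, h2, h3, h4, h5, h6, h8, h7⟩
    refine ⟨⟨h1, h2⟩, fun l _ _ => h3 _ (by omega), h8, h5, h4,
      fun l _ _ => h6 _ (by omega) (by omega),
      fun l hl hl' h => h7 (n - 1 - (l + 1)) (by omega) (by omega) ⟨h.2, ?_⟩⟩
    rw [show n - 1 - (l + 1) + 1 = n - 1 - l by omega]; exact h.1
  · rintro ⟨⟨h1, h2⟩, h3, h8, h5, h4, h6, h7⟩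
    refine ⟨h1, h2, fun i hi => ?_, h4, h5, fun i hi hi' => ?_, h8, fun i hi hi' h => ?_⟩
    · have := h3 (n - 1 - i) (by omega) (by omega)
      rwa [show n - 1 - (n - 1 - i) = i by omega] at this
    · have := h6 (n - 1 - i) (by omega) (by omega)
      rwa [show n - 1 - (n - 1 - i) = i by omega] at this
    · have := h7 (n - 1 - (i + 1)) (by omega) (by omega)
      rw [show n - 1 - (n - 1 - (i + 1)) = i + 1 by omega,
        show n - 1 - (n - 1 - (i + 1) + 1) = i by omega] at this
      exact this ⟨h.2, h.1⟩

theorem mem_U1fin_iff {n k w : ℕ} (hkn : k < n) (hw0 : 0 < w) (hwn : w < n) (j : ℤ) :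
    j ∈ U1fin n k w ↔ 0 < j ∧ j < 3 ^ n - 1 ∧
      (∀ l, n - w ≤ l → l < n → dig n j ((2 * n - k + (2 * n - k) * l) % n) = 1) ∧
      (∀ l < n - w, dig n j ((2 * n - k + (2 * n - k) * l) % n) = 0 ∨
        dig n j ((2 * n - k + (2 * n - k) * l) % n) = 2) ∧
      ((Finset.range (n - w)).filter fun l =>
        dig n j ((2 * n - k + (2 * n - k) * l) % n) = 2) ∈ sparseSets 1 (n - w - 1) := by
  have h0 : j ∈ U1fin n k w ↔ j ∈ U1set n k w := by
    simp only [U1fin, Finset.mem_filter, Finset.mem_Ioo, and_iff_right_iff_imp]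
    exact fun h => ⟨h.1, h.2.1⟩
  rw [h0, mem_U1set_iff hw0 hwn, digit_condition_sparse_iff (n := n) (w := n - w) (by omega)
    fun l => dig n j ((n - 1 - l) * k)]
  exact (reflect_conditions hwn (fun l hl => (dig_reflect hkn j hl)) _).trans and_assoc

theorem mem_V1fin_iff {n k w : ℕ} (hkn : k < n) (hw0 : 0 < w) (hwn : w < n) (j : ℤ) :
    j ∈ V1fin n k w ↔ 0 < j ∧ j < 3 ^ n - 1 ∧
      (∀ l, n - w ≤ l → l < n → dig n j ((2 * n - k + (2 * n - k) * l) % n) = 1) ∧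
      (∀ l < n - w, dig n j ((2 * n - k + (2 * n - k) * l) % n) = 0 ∨
        dig n j ((2 * n - k + (2 * n - k) * l) % n) = 2) ∧
      ((Finset.range (n - w)).filter fun l =>
        dig n j ((2 * n - k + (2 * n - k) * l) % n) = 2) ∈ sparseSetsWithZero (n - w) := by
  have h0 : j ∈ V1fin n k w ↔ j ∈ V1set n k w := by
    simp only [V1fin, Finset.mem_filter, Finset.mem_Ioo, and_iff_right_iff_imp]
    exact fun h => ⟨h.1, h.2.1⟩
  rw [h0, mem_V1set_iff hw0 hwn, digit_condition_sparse_zero_iff (n := n) (w := n - w) (by omega)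
    (by omega) fun l => dig n j ((n - 1 - l) * k)]
  exact (reflect_conditions hwn (fun l hl => (dig_reflect hkn j hl)) _).trans and_assoc

/-- The number of multiples `ik`, `i < v`, whose residue lies in `[n - k, n)` counts the carries. -/
theorem card_filter_mul_mod_ge {n k : ℕ} (hkn : k < n) (v : ℕ) :
    ((Finset.range v).filter fun i => n - k ≤ i * k % n).card = v * k / n := by
  have hn : 0 < n := by omega
  induction v with
  | zero => simp
  | succ v ih =>
    rw [Finset.range_add_one, Finset.filter_insert]
    have h1 := Nat.div_add_mod (v * k) n
    have h2 := Nat.mod_lt (v * k) hn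
    rw [add_mul, one_mul]
    generalize v * k / n = q at *
    generalize v * k % n = r at *
    rw [← h1]
    split_ifs with h
    · rw [Finset.card_insert_of_notMem (by simp), ih,
        show n * q + r + k = n * (q + 1) + (r + k - n) by rw [Nat.mul_add_one]; omega,
        Nat.mul_add_div hn, Nat.div_eq_of_lt (by omega), add_zero]
    · rw [ih, add_assoc, Nat.mul_add_div hn, Nat.div_eq_of_lt (by omega), add_zero]

theorem card_Aset_inter {n k w : ℕ} (hkn : k < n) (hcop : Nat.Coprime n k) (hwn : w < n) :
    (Aset n k w ∩ Finset.Ico (n - k) n).card = w * k / n := by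
  rw [← card_filter_mul_mod_ge hkn w]
  have : Aset n k w ∩ Finset.Ico (n - k) n =
      ((Finset.range w).filter fun i => n - k ≤ i * k % n).image fun i => i * k % n := by
    ext x
    simp only [Aset, Finset.mem_inter, Finset.mem_image, Finset.mem_range, Finset.mem_Ico,
      Finset.mem_filter]
    constructor
    · rintro ⟨⟨i, hi, rfl⟩, h, _⟩
      exact ⟨i, ⟨hi, h⟩, rfl⟩
    · rintro ⟨i, ⟨hi, h⟩, rfl⟩
      exact ⟨⟨i, hi, rfl⟩, h, Nat.mod_lt _ (by omega)⟩
  rw [this, Finset.card_image_of_injOn]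
  intro i hi j hj hij
  have hi' := (Finset.mem_filter.1 hi).1
  have hj' := (Finset.mem_filter.1 hj).1
  rw [Finset.mem_range] at hi' hj'
  refine affine_mod_injOn hcop 0 ?_ ?_ ?_
  · simp; omega
  · simp; omega
  · simpa [mul_comm k] using hij

end DigitPositions

section Dual

theorem eExp_pos {n : ℕ} (hn : 0 < n) (k : ℕ) (j : ℤ) : 0 < eExp n k j := by
  have h3 : (1 : ℕ) < 3 ^ n := Nat.one_lt_pow hn.ne' (by norm_num)
  have h3' : (0 : ℤ) < 3 ^ n - 1 := by
    have : (1 : ℤ) < 3 ^ n := by exact_mod_cast h3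
    omega
  rw [eExp]
  split_ifs with h
  · omega
  · have := Int.emod_nonneg (-(j * cmD k)) h3'.ne'
    omega

theorem exists_eExp_eq {n : ℕ} (hn : 0 < n) (k : ℕ) (j : ℤ) :
    ∃ t : ℤ, (eExp n k j : ℤ) = -(((3 ^ k + 1) / 2 : ℕ) * j) + ((3 ^ n - 1 : ℕ) : ℤ) * t := by
  have h3 : (1 : ℕ) < 3 ^ n := Nat.one_lt_pow hn.ne' (by norm_num)
  have hq : ((3 ^ n - 1 : ℕ) : ℤ) = 3 ^ n - 1 := by
    rw [Nat.cast_sub h3.le]; push_cast; rfl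
  have hd : (((3 ^ k + 1) / 2 : ℕ) : ℤ) = cmD k := by
    rw [cmD]; push_cast; rfl
  have h3' : (0 : ℤ) < 3 ^ n - 1 := by rw [← hq]; omega
  have hdiv := Int.mul_ediv_add_emod (-(j * cmD k)) ((3 : ℤ) ^ n - 1)
  rw [hd, mul_comm (cmD k), hq, eExp]
  split_ifs with h
  · refine ⟨1 - -(j * cmD k) / (3 ^ n - 1), ?_⟩
    rw [hq]
    linear_combination hdiv - h
  · refine ⟨-(-(j * cmD k) / (3 ^ n - 1)), ?_⟩
    rw [Int.toNat_of_nonneg (Int.emod_nonneg _ h3'.ne')]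
    linear_combination hdiv

variable {F : Type*} [Field F] [Fintype F]

theorem zpow_mul_pow_eExp {n : ℕ} (hn : 0 < n) (hcard : Fintype.card F = 3 ^ n) (k : ℕ) (a : F)
    {x : F} (hx : x ≠ 0) (j : ℤ) :
    a ^ j * x ^ eExp n k j = (a * x⁻¹ ^ ((3 ^ k + 1) / 2)) ^ j := by
  obtain ⟨t, ht⟩ := exists_eExp_eq hn k j
  have h1 : x ^ (3 ^ n - 1) = 1 := by rw [← hcard]; exact FiniteField.pow_card_sub_one_eq_one x hx
  rw [← zpow_natCast x, ht, zpow_add₀ hx, zpow_mul x _ t, zpow_natCast, h1, one_zpow, mul_one,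
    zpow_neg, zpow_mul, zpow_natCast, mul_zpow, inv_pow, inv_zpow]

/-- The element whose trace is the dual function, for the given index sets. -/
noncomputable def dualSum (n : ℕ) (U V : Finset ℤ) (b : F) : F :=
  ∑ j ∈ U, (-1 : F) ^ (N2 n j + 1) * (qchar b : F) * b ^ j +
    ∑ j ∈ V, (-1 : F) ^ N2 n j * (qchar b : F) * b ^ j

variable [Algebra (ZMod 3) F]

theorem pow_half_eq_qchar {n : ℕ} (hcard : Fintype.card F = 3 ^ n) {b : F} (hb : b ≠ 0) :
    b ^ ((3 ^ n - 1) / 2) = (qchar b : F) := by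
  classical
  have hodd : Odd (3 ^ n) := Odd.pow (by decide)
  rw [qchar_eq_quadraticChar hb, quadraticChar_eq_pow_of_char_ne_two' (ringChar_ne_two F), hcard]
  obtain ⟨r, hr⟩ := hodd
  congr 1
  omega

theorem prod_pow_three_pow {n : ℕ} (hcard : Fintype.card F = 3 ^ n) {pos : ℕ → ℕ}
    (hmaps : ∀ l < n, pos l < n) (hinj : Set.InjOn pos (Finset.range n : Set ℕ)) {b : F}
    (hb : b ≠ 0) : ∏ l ∈ Finset.range n, b ^ 3 ^ pos l = (qchar b : F) := by
  rw [← Finset.prod_image (f := fun i => b ^ 3 ^ i) hinj, image_range_eq_range hmaps hinj,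
    ← pow_half_eq_qchar hcard hb]
  have h := prod_frobPow_pow_half 1 b n
  simpa [frobPow_pow_apply] using h

theorem qchar_pow_three_pow (b : F) (hb : b ≠ 0) (s : ℕ) : qchar (b ^ 3 ^ s) = qchar b := by
  obtain ⟨r, hr⟩ : Odd (3 ^ s) := Odd.pow (by decide)
  rw [hr, pow_succ', pow_mul', qchar_mul_sq b (pow_ne_zero _ hb)]

theorem cmSum_one_eq_dualSum {n : ℕ} (hcard : Fintype.card F = 3 ^ n) {k w m : ℕ} (hk : Odd k)
    (hcop : Nat.Coprime n k) (hm : k * w = 1 + n * m) (hme : Even m) (hw0 : 0 < w) (hwn : w < n)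
    (s : ℕ) {b : F} (hb : b ≠ 0) (U V : Finset ℤ)
    (hU : ∀ j, j ∈ U ↔ 0 < j ∧ j < 3 ^ n - 1 ∧
      (∀ l, w ≤ l → l < n → dig n j ((s + k * l) % n) = 1) ∧
      (∀ l < w, dig n j ((s + k * l) % n) = 0 ∨ dig n j ((s + k * l) % n) = 2) ∧
      ((Finset.range w).filter fun l => dig n j ((s + k * l) % n) = 2) ∈ sparseSets 1 (w - 1))
    (hV : ∀ j, j ∈ V ↔ 0 < j ∧ j < 3 ^ n - 1 ∧
      (∀ l, w ≤ l → l < n → dig n j ((s + k * l) % n) = 1) ∧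
      (∀ l < w, dig n j ((s + k * l) % n) = 0 ∨ dig n j ((s + k * l) % n) = 2) ∧
      ((Finset.range w).filter fun l => dig n j ((s + k * l) % n) = 2) ∈ sparseSetsWithZero w) :
    cmSum k (b ^ 3 ^ s) 1 = qchar b * traceGauss F * traceChar F (dualSum n U V b) := by
  have hn : 0 < n := by omega
  have hmaps : ∀ l < n, (s + k * l) % n < n := fun l _ => Nat.mod_lt _ hn
  have hinj := affine_mod_injOn hcop s
  have hbs : b ^ 3 ^ s ≠ 0 := pow_ne_zero _ hb
  have he : (qchar b : F) ^ 2 = 1 := by exact_mod_cast congrArg (Int.cast : ℤ → F) (qchar_sq b)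
  have hpow : ∀ l, (frobPow F k ^ l) (b ^ 3 ^ s) = b ^ 3 ^ ((s + k * l) % n) := by
    intro l
    rw [pow_three_pow_mod hcard, frobPow_pow_apply, pow_add, pow_mul b]
  rw [cmSum_one_eq hn hcard hk hcop hm hme hbs, qchar_pow_three_pow b hb,
    ← dual_sum_eq hw0 hwn hmaps hinj U V hU hV (frobPow F k) hbs hpow he
      (prod_pow_three_pow hcard hmaps hinj hb), dualSum]

theorem cmSum_reflect {n k : ℕ} (hcard : Fintype.card F = 3 ^ n) (hk : Odd k) (hkn : k < n)
    (b : F) : cmSum (2 * n - k) (b ^ 3 ^ (2 * n - k)) 1 = cmSum k b 1 := by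
  have hk' : Odd (2 * n - k) := Nat.Even.sub_odd (by omega) (even_two_mul n) hk
  obtain ⟨t, ht⟩ := three_pow_odd_mod hk
  obtain ⟨t', ht'⟩ := three_pow_odd_mod hk'
  obtain ⟨s, hs⟩ := exists_pow_even_eq (n := n) even_two
  have hmul : 3 ^ k * 3 ^ (2 * n - k) = 3 ^ (n * 2) := by rw [← pow_add]; congr 1; omega
  have hexp : (3 ^ k + 1) / 2 * 3 ^ (2 * n - k) =
      (3 ^ n - 1) * s + (3 ^ (2 * n - k) + 1) / 2 := by
    rw [hs, ht, ht'] at hmul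
    rw [ht, ht', show (8 * t + 3 + 1) / 2 = 4 * t + 2 by omega,
      show (8 * t' + 3 + 1) / 2 = 4 * t' + 2 by omega]
    nlinarith
  refine Finset.sum_congr rfl fun x _ => ?_
  have hx : x ^ ((3 ^ (2 * n - k) + 1) / 2) = (x ^ ((3 ^ k + 1) / 2)) ^ 3 ^ (2 * n - k) := by
    rw [← pow_mul, hexp]
    by_cases h0 : x = 0
    · rw [h0, zero_pow (by omega), zero_pow (by omega)]
    · rw [pow_add, pow_mul, ← hcard, FiniteField.pow_card_sub_one_eq_one x h0, one_pow, one_mul]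
  rw [AddChar.map_add_eq_mul, AddChar.map_add_eq_mul, hx, ← mul_pow, ← frobPow_apply,
    traceChar_frobPow]

theorem cmSum_one_eq_of_even {n k w : ℕ} (hcard : Fintype.card F = 3 ^ n) (hk : Odd k)
    (hcop : Nat.Coprime n k) (hw0 : 0 < w) (hwn : w < n) (hm : w * k = 1 + n * (w * k / n))
    (hme : Even (w * k / n)) {b : F} (hb : b ≠ 0) :
    cmSum k b 1 = qchar b * traceGauss F *
      traceChar F (dualSum n (U0fin n k w) (V0fin n k w) b) := by
  have h := cmSum_one_eq_dualSum hcard hk hcop ((mul_comm k w).trans hm) hme hw0 hwn 0 hb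
    (U0fin n k w) (V0fin n k w) (mem_U0fin_iff hw0 (hw0.trans hwn)) (mem_V0fin_iff hw0 hwn)
  rwa [pow_zero, pow_one] at h

theorem cmSum_one_eq_of_odd {n k w : ℕ} (hcard : Fintype.card F = 3 ^ n) (hk : Odd k)
    (hkn : k < n) (hcop : Nat.Coprime n k) (hw0 : 0 < w) (hwn : w < n)
    (hm : w * k = 1 + n * (w * k / n)) (hmo : Odd (w * k / n)) {b : F} (hb : b ≠ 0) :
    cmSum k b 1 = qchar b * traceGauss F *
      traceChar F (dualSum n (U1fin n k w) (V1fin n k w) b) := by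
  have hk' : Odd (2 * n - k) := Nat.Even.sub_odd (by omega) (even_two_mul n) hk
  have hcop' : Nat.Coprime n (2 * n - k) := by
    have h1 := Nat.gcd_dvd_left n (2 * n - k)
    have h2 := Nat.dvd_sub (h1.mul_left 2) (Nat.gcd_dvd_right n (2 * n - k))
    rw [show 2 * n - (2 * n - k) = k by omega] at h2
    exact Nat.dvd_one.1 (hcop ▸ Nat.dvd_gcd h1 h2)
  generalize w * k / n = m at hm hmo
  obtain ⟨m', hm', hme'⟩ : ∃ m', (2 * n - k) * (n - w) = 1 + n * m' ∧ Even m' := by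
    have hz : ((2 * n - k : ℕ) : ℤ) * ((n - w : ℕ) : ℤ) = 1 + n * (2 * (n - w) + m - k) := by
      have : (w : ℤ) * k = 1 + n * m := by exact_mod_cast hm
      rw [Nat.cast_sub (by omega), Nat.cast_sub hwn.le]
      push_cast
      linear_combination this
    have hpos : (0 : ℤ) < ((2 * n - k : ℕ) : ℤ) * ((n - w : ℕ) : ℤ) := by
      have h1 : 0 < 2 * n - k := by omega
      have h2 : 0 < n - w := by omega
      positivity
    have hnn : (0 : ℤ) ≤ 2 * (n - w) + m - k := by
      by_contra hneg
      have : (n : ℤ) * (2 * (n - w) + m - k) < 0 :=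
        mul_neg_of_pos_of_neg (by exact_mod_cast hw0.trans hwn) (not_le.1 hneg)
      omega
    refine ⟨(2 * (n - w) + m) - k, ?_, ?_⟩
    · zify [hwn.le, show k ≤ 2 * (n - w) + m by omega]
      rw [← hz, Nat.cast_sub hwn.le]
    · exact Nat.Odd.sub_odd (Even.add_odd (even_two_mul _) hmo) hk
  rw [← cmSum_reflect hcard hk hkn b]
  exact cmSum_one_eq_dualSum hcard hk' hcop' hm' hme' (by omega) (by omega) _ hb _ _
    (mem_U1fin_iff hkn hw0 hwn) (mem_V1fin_iff hkn hw0 hwn)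

theorem trace_dualSum {n k : ℕ} (hn : 0 < n) (hcard : Fintype.card F = 3 ^ n) (hk : Odd k) (a : F)
    {x : F} (hx : x ≠ 0) (U V : Finset ℤ) :
    (∑ j ∈ U, Algebra.trace (ZMod 3) F
        ((((-1 : ℤ) ^ (N2 n j + 1) * qchar a : ℤ) : F) * a ^ j * x ^ eExp n k j)) +
      (∑ j ∈ V, Algebra.trace (ZMod 3) F
        ((((-1 : ℤ) ^ (N2 n j) * qchar a : ℤ) : F) * a ^ j * x ^ eExp n k j)) =
    Algebra.trace (ZMod 3) F (dualSum n U V (a * x⁻¹ ^ ((3 ^ k + 1) / 2))) := by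
  rw [dualSum, map_add, map_sum, map_sum, qchar_mul_pow hk a (inv_ne_zero hx)]
  simp only [mul_assoc _ (a ^ (_ : ℤ)) _, zpow_mul_pow_eExp hn hcard k a hx]
  push_cast
  rfl

end Dual

theorem stmt15 (n k : ℕ) (hn : 2 ≤ n) (hkodd : Odd k) (hk0 : 0 < k) (hkn : k < n)
    (hgcd : Nat.gcd n k = 1) (w : ℕ) (hw0 : 0 < w) (hwn : w < n) (hwk : w * k ≡ 1 [MOD n])
    (F : Type*) [Field F] [Fintype F] [Algebra (ZMod 3) F]
    (hcard : Fintype.card F = 3 ^ n)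
    (a : F) (ha : a ≠ 0) (g : F → ZMod 3)
    (hg : ∀ x : F, g x =
      if Even ((Aset n k w ∩ Finset.Ico (n - k) n).card) then
        (∑ j ∈ U0fin n k w, Algebra.trace (ZMod 3) F
          ((((-1 : ℤ) ^ (N2 n j + 1) * qchar a : ℤ) : F) * a ^ j * x ^ eExp n k j)) +
        (∑ j ∈ V0fin n k w, Algebra.trace (ZMod 3) F
          ((((-1 : ℤ) ^ (N2 n j) * qchar a : ℤ) : F) * a ^ j * x ^ eExp n k j))
      else
        (∑ j ∈ U1fin n k w, Algebra.trace (ZMod 3) F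
          ((((-1 : ℤ) ^ (N2 n j + 1) * qchar a : ℤ) : F) * a ^ j * x ^ eExp n k j)) +
        (∑ j ∈ V1fin n k w, Algebra.trace (ZMod 3) F
          ((((-1 : ℤ) ^ (N2 n j) * qchar a : ℤ) : F) * a ^ j * x ^ eExp n k j))) :
    ∀ lam : F,
      (∑ x : F, omega3 ^ ((Algebra.trace (ZMod 3) F
          (a * x ^ ((3 ^ k + 1) / 2 : ℕ) + lam * x)).val)) =
        (-1 : ℂ) ^ (n + 1) * (qchar a : ℂ) * Complex.I ^ n *
          ((Real.sqrt 3 : ℂ)) ^ n * omega3 ^ ((g lam).val) := by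
  intro lam
  have hn0 : 0 < n := by omega
  have hcop : Nat.Coprime n k := hgcd
  suffices h : cmSum k a lam = qchar a * traceGauss F * omega3 ^ (g lam).val by
    simp only [cmSum, traceChar_apply] at h
    rw [h, traceGauss_eq hn0 hcard]
    ring
  have hm : w * k = 1 + n * (w * k / n) := by
    have h1 : w * k % n = 1 := by
      have := hwk
      rwa [Nat.ModEq, Nat.mod_eq_of_lt (by omega : 1 < n)] at this
    have := Nat.div_add_mod (w * k) n
    omega
  rw [card_Aset_inter hkn hcop hwn] at hg
  by_cases hlam : lam = 0
  · subst hlam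
    have hg0 : g 0 = 0 := by
      rw [hg]
      simp [zero_pow (eExp_pos hn0 k _).ne']
    rw [hg0, cmSum_zero hkodd hcop hcard ha]
    simp
  have hinv : lam⁻¹ ≠ 0 := inv_ne_zero hlam
  have hb : a * lam⁻¹ ^ ((3 ^ k + 1) / 2) ≠ 0 := mul_ne_zero ha (pow_ne_zero _ hinv)
  rw [← cmSum_scale k a lam hinv, inv_mul_cancel₀ hlam, ← qchar_mul_pow hkodd a hinv, hg]
  split_ifs with hpar
  · rw [trace_dualSum hn0 hcard hkodd a hlam, ← traceChar_apply]
    exact cmSum_one_eq_of_even hcard hkodd hcop hw0 hwn hm hpar hb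
  · rw [trace_dualSum hn0 hcard hkodd a hlam, ← traceChar_apply]
    exact cmSum_one_eq_of_odd hcard hkodd hkn hcop hw0 hwn hm (Nat.not_even_iff_odd.1 hpar) hb
end

section
/- If |A ∩ {n−k, …, n−1}| is even, then max_{j ∈ U_0 ∪ V_0} wt(−jd) = w + 1 (equivalently min_{j ∈ U_0 ∪ V_0} wt(j) = n − w), and if k > 1 then w + 1 > 2; if |A ∩ {n−k, …, n−1}| is odd, then max_{j ∈ U_1 ∪ V_1} wt(−jd) = n + 1 − w (equivalently min_{j ∈ U_1 ∪ V_1} wt(j) = w), and n + 1 − w > 2. Consequently the algebraic degree of the dual g of the Coulter–Matthews bent function is w+1 in the even case and n+1−w in the odd case, and it exceeds 2 whenever k > 1. -/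
/-! ### Ternary expansions -/

lemma sum_ternary_lt (n : ℕ) (b : ℕ → ℕ) (hb : ∀ r, b r ≤ 2) :
    ∑ r ∈ Finset.range n, b r * 3 ^ r < 3 ^ n := by
  induction n with
  | zero => simp
  | succ n ih =>
    rw [Finset.sum_range_succ, pow_succ]
    have := Nat.mul_le_mul_right (3 ^ n) (hb n)
    omega

lemma sum_ternary_lt_pred (n : ℕ) (b : ℕ → ℕ) (hb : ∀ r, b r ≤ 2) (hne : ∃ r < n, b r < 2) :
    ∑ r ∈ Finset.range n, b r * 3 ^ r + 1 < 3 ^ n := by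
  obtain ⟨r, hr, hr2⟩ := hne
  have h2 : ∀ m, ∑ r ∈ Finset.range m, 2 * 3 ^ r + 1 = 3 ^ m := by
    intro m
    induction m with
    | zero => simp
    | succ m ih => rw [Finset.sum_range_succ, pow_succ]; omega
  have hlt : ∑ r ∈ Finset.range n, b r * 3 ^ r < ∑ r ∈ Finset.range n, 2 * 3 ^ r :=
    Finset.sum_lt_sum (fun i _ => Nat.mul_le_mul_right _ (hb i))
      ⟨r, Finset.mem_range.2 hr, Nat.mul_lt_mul_of_pos_right hr2 (by positivity)⟩
  have := h2 n
  omega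

lemma sum_ternary_digit (n : ℕ) (b : ℕ → ℕ) (hb : ∀ r, b r ≤ 2) (i : ℕ) (hi : i < n) :
    (∑ r ∈ Finset.range n, b r * 3 ^ r) / 3 ^ i % 3 = b i := by
  induction n generalizing b i with
  | zero => omega
  | succ n ih =>
    have hs : ∑ r ∈ Finset.range (n + 1), b r * 3 ^ r
        = 3 * (∑ r ∈ Finset.range n, b (r + 1) * 3 ^ r) + b 0 := by
      rw [Finset.sum_range_succ', Finset.mul_sum]
      simp only [pow_succ, pow_zero, mul_one]
      congr 1
      exact Finset.sum_congr rfl fun r _ => by ring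
    rw [hs]
    have h0 := hb 0
    rcases i with _ | i
    · simp only [pow_zero, Nat.div_one]; omega
    · rw [pow_succ', ← Nat.div_div_eq_div_mul]
      have : (3 * (∑ r ∈ Finset.range n, b (r + 1) * 3 ^ r) + b 0) / 3
          = ∑ r ∈ Finset.range n, b (r + 1) * 3 ^ r := by omega
      rw [this]
      exact ih (fun r => b (r + 1)) (fun r => hb _) i (by omega)

lemma sum_digits_ternary (n m : ℕ) (hm : m < 3 ^ n) :
    ∑ r ∈ Finset.range n, (m / 3 ^ r % 3) * 3 ^ r = m := by
  induction n generalizing m with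
  | zero => simp at hm; simp [hm]
  | succ n ih =>
    have h3 : m / 3 < 3 ^ n := by rw [pow_succ] at hm; omega
    have h := ih (m / 3) h3
    rw [Finset.sum_range_succ']
    have : ∑ r ∈ Finset.range n, m / 3 ^ (r + 1) % 3 * 3 ^ (r + 1)
        = 3 * ∑ r ∈ Finset.range n, m / 3 / 3 ^ r % 3 * 3 ^ r := by
      rw [Finset.mul_sum]
      refine Finset.sum_congr rfl fun r _ => ?_
      rw [pow_succ', Nat.div_div_eq_div_mul]
      ring
    rw [this, h]
    simp only [pow_zero, Nat.div_one, mul_one]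
    omega

lemma dig_le_two (n : ℕ) (j : ℤ) (i : ℕ) : dig n j i ≤ 2 := by
  unfold dig; omega

lemma dig_congr {n : ℕ} (j : ℤ) {i i' : ℕ} (h : i ≡ i' [MOD n]) : dig n j i = dig n j i' := by
  unfold dig; rw [h]

lemma dig_of_modEq (n : ℕ) (b : ℕ → ℕ) (hb : ∀ r, b r ≤ 2) (hne : ∃ r < n, b r < 2) (x : ℤ)
    (hx : ((3 : ℤ) ^ n - 1) ∣ ((∑ r ∈ Finset.range n, b r * 3 ^ r : ℕ) : ℤ) - x) (i : ℕ) :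
    dig n x i = b (i % n) := by
  have hlt := sum_ternary_lt_pred n b hb hne
  have hn : 0 < n := by obtain ⟨r, hr, -⟩ := hne; omega
  unfold dig
  rw [Int.ModEq.eq (Int.modEq_iff_dvd.2 hx),
    Int.emod_eq_of_lt (by positivity) (by zify at hlt; push_cast; linarith), Int.toNat_natCast]
  exact sum_ternary_digit n b hb _ (Nat.mod_lt _ hn)

lemma sum_dig (n : ℕ) (j : ℤ) (h0 : 0 ≤ j) (hj : j < 3 ^ n - 1) :
    ∑ r ∈ Finset.range n, (dig n j r : ℤ) * 3 ^ r = j := by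
  lift j to ℕ using h0
  have hlt : j < 3 ^ n := by zify; linarith
  have h := sum_digits_ternary n j hlt
  conv_rhs => rw [← h]
  push_cast
  refine Finset.sum_congr rfl fun r hr => ?_
  unfold dig
  rw [Int.emod_eq_of_lt (by positivity) hj, Nat.mod_eq_of_lt (Finset.mem_range.1 hr)]
  simp

/-! ### Multiplication by `3 ^ k` modulo `2 * (3 ^ n - 1)` -/

lemma sum_shift_periodic (n k : ℕ) (g : ℕ → ℤ) (hg : ∀ r, g (r + n) = g r) :
    ∑ r ∈ Finset.range n, g (r + k) * 3 ^ (r + k) =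
      ∑ r ∈ Finset.range n, g r * 3 ^ r
        + (3 ^ n - 1) * ∑ s ∈ Finset.range k, g s * 3 ^ s := by
  have h1 := Finset.sum_range_add (fun r => g r * (3 : ℤ) ^ r) k n
  have h2 := Finset.sum_range_add (fun r => g r * (3 : ℤ) ^ r) n k
  have h3 : ∑ s ∈ Finset.range k, g (n + s) * (3 : ℤ) ^ (n + s)
      = 3 ^ n * ∑ s ∈ Finset.range k, g s * 3 ^ s := by
    rw [Finset.mul_sum]
    refine Finset.sum_congr rfl fun s _ => ?_
    rw [add_comm n s, hg]; ring
  rw [add_comm k n, h2, h3] at h1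
  simp only [add_comm k] at h1
  linarith

lemma odd_sum_mul_three_pow (k : ℕ) (g : ℕ → ℤ) (h : Odd (∑ s ∈ Finset.range k, g s)) :
    Odd (∑ s ∈ Finset.range k, g s * 3 ^ s) := by
  have : ∑ s ∈ Finset.range k, g s * 3 ^ s
      = ∑ s ∈ Finset.range k, g s + ∑ s ∈ Finset.range k, g s * (3 ^ s - 1) := by
    rw [← Finset.sum_add_distrib]
    exact Finset.sum_congr rfl fun s _ => by ring
  rw [this]
  refine h.add_even (Finset.even_sum _ fun s _ => Even.mul_left ?_ _)
  exact Odd.sub_odd (Odd.pow (by decide)) odd_one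

lemma two_mul_cmD (k : ℕ) : 2 * cmD k = 3 ^ k + 1 := by
  unfold cmD
  have h : Even ((3 : ℤ) ^ k + 1) := Odd.add_odd (Odd.pow (by decide)) odd_one
  exact Int.two_mul_ediv_two_of_even h

lemma three_pow_sub_one_eq_sum (n : ℕ) (hn : 2 ≤ n) :
    ∑ r ∈ Finset.range n, ((if r = 0 then 5 else if r = 1 then 1 else 2 : ℕ) : ℤ) * 3 ^ r
      = 3 ^ n - 1 := by
  induction n, hn using Nat.le_induction with
  | base => simp [Finset.sum_range_succ]
  | succ m hm ih =>
    rw [Finset.sum_range_succ, ih, if_neg (by omega), if_neg (by omega)]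
    push_cast; ring

lemma sum_carry_pattern (n : ℕ) (hn : 2 ≤ n) :
    ∑ r ∈ Finset.range n, (if r = 0 then 5 else if r = 1 then 1 else 2 : ℕ) = 2 * (n + 1) := by
  induction n, hn using Nat.le_induction with
  | base => simp [Finset.sum_range_succ]
  | succ m hm ih =>
    rw [Finset.sum_range_succ, ih, if_neg (by omega), if_neg (by omega)]
    ring

lemma sum_shift_periodic_nat (n k : ℕ) (g : ℕ → ℕ) (hg : ∀ r, g (r + n) = g r) :
    ∑ r ∈ Finset.range n, g (r + k) = ∑ r ∈ Finset.range n, g r := by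
  have h1 := Finset.sum_range_add g k n
  have h2 := Finset.sum_range_add g n k
  have h3 : ∑ s ∈ Finset.range k, g (n + s) = ∑ s ∈ Finset.range k, g s :=
    Finset.sum_congr rfl fun s _ => by rw [add_comm, hg]
  rw [add_comm k n, h2, h3] at h1
  simp only [add_comm k] at h1
  omega

/-- If digitwise `2 * b + j + 3 ^ k * j` follows the pattern `5, 1, 2, …, 2` and multiplication of
`j` by `3 ^ k` wraps an odd number of units, then `b` is the expansion of `-(j * d)`. -/
lemma wt_add_wt_of_digits (n k : ℕ) (hn : 2 ≤ n) (hkn : k < n) (j : ℤ) (h0 : 0 ≤ j)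
    (hj : j < 3 ^ n - 1) (b : ℕ → ℕ) (hb : ∀ r, b r ≤ 2)
    (hpat : ∀ r < n, 2 * b r + dig n j r + dig n j (r + (n - k))
      = if r = 0 then 5 else if r = 1 then 1 else 2)
    (hodd : Odd (∑ s ∈ Finset.range k, dig n j (s + (n - k)))) :
    wt n (-(j * cmD k)) + wt n j = n + 1 := by
  have hper : ∀ r, dig n j (r + n) = dig n j r := fun r => dig_congr j (by simp [Nat.ModEq])
  have hb1 : b 1 < 2 := by have := hpat 1 (by omega); simp at this; omega
  have hjs := sum_dig n j h0 hj
  have hshift := sum_shift_periodic n k (fun r => (dig n j (r + (n - k)) : ℤ)) (fun r => by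
    rw [← hper (r + (n - k))]; congr 2; omega)
  have hl : ∑ r ∈ Finset.range n, (dig n j (r + k + (n - k)) : ℤ) * 3 ^ (r + k) = 3 ^ k * j := by
    conv_rhs => rw [← hjs]
    rw [Finset.mul_sum]
    refine Finset.sum_congr rfl fun r _ => ?_
    rw [show r + k + (n - k) = r + n by omega, hper]; ring
  have hM := odd_sum_mul_three_pow k (fun s => (dig n j (s + (n - k)) : ℤ)) (by
    exact_mod_cast hodd)
  obtain ⟨q, hq⟩ := hM
  simp only at hshift hq
  rw [hl, hq] at hshift
  have hE : 2 * ∑ r ∈ Finset.range n, (b r : ℤ) * 3 ^ r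
      + ∑ r ∈ Finset.range n, (dig n j r : ℤ) * 3 ^ r
      + ∑ r ∈ Finset.range n, (dig n j (r + (n - k)) : ℤ) * 3 ^ r = 3 ^ n - 1 := by
    rw [← three_pow_sub_one_eq_sum n hn, Finset.mul_sum, ← Finset.sum_add_distrib,
      ← Finset.sum_add_distrib]
    refine Finset.sum_congr rfl fun r hr => ?_
    rw [← hpat r (Finset.mem_range.1 hr)]
    push_cast; ring
  have hdvd : ((3 : ℤ) ^ n - 1) ∣
      ((∑ r ∈ Finset.range n, b r * 3 ^ r : ℕ) : ℤ) - -(j * cmD k) := by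
    refine ⟨q + 1, ?_⟩
    push_cast
    have h2 : 2 * (j * cmD k) = j * (3 ^ k + 1) := by rw [← two_mul_cmD]; ring
    rw [hjs] at hE
    linarith
  have hwt : wt n (-(j * cmD k)) = ∑ r ∈ Finset.range n, b r :=
    Finset.sum_congr rfl fun r hr => by
      rw [dig_of_modEq n b hb ⟨1, by omega, hb1⟩ _ hdvd, Nat.mod_eq_of_lt (Finset.mem_range.1 hr)]
  have hsum : 2 * ∑ r ∈ Finset.range n, b r + ∑ r ∈ Finset.range n, dig n j r
      + ∑ r ∈ Finset.range n, dig n j (r + (n - k)) = 2 * (n + 1) := by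
    rw [← sum_carry_pattern n hn, Finset.mul_sum, ← Finset.sum_add_distrib,
      ← Finset.sum_add_distrib]
    exact Finset.sum_congr rfl fun r hr => hpat r (Finset.mem_range.1 hr)
  rw [sum_shift_periodic_nat n (n - k) (dig n j) hper] at hsum
  rw [hwt]
  unfold wt
  omega

/-! ### Reindexing the digits by multiples of `k` -/

lemma mul_right_inj_mod {n k : ℕ} (hgcd : Nat.gcd n k = 1) {i i' : ℕ} (hi : i < n) (hi' : i' < n)
    (h : i * k % n = i' * k % n) : i = i' := by
  have h1 : i ≡ i' [MOD n] := Nat.ModEq.cancel_right_of_coprime hgcd h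
  rwa [Nat.ModEq, Nat.mod_eq_of_lt hi, Nat.mod_eq_of_lt hi'] at h1

lemma mem_Aset_iff {n k w : ℕ} (hgcd : Nat.gcd n k = 1) (hwn : w < n) {i : ℕ} (hi : i < n) :
    i * k % n ∈ Aset n k w ↔ i < w := by
  simp only [Aset, Finset.mem_image, Finset.mem_range]
  constructor
  · rintro ⟨i', hi', h⟩
    have := mul_right_inj_mod hgcd (by omega) hi h
    omega
  · exact fun h => ⟨i, h, rfl⟩

lemma exists_mul_mod_eq {n k w : ℕ} (hwk : w * k ≡ 1 [MOD n]) {r : ℕ} (hr : r < n) :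
    ∃ i < n, i * k % n = r := by
  refine ⟨r * w % n, Nat.mod_lt _ (by omega), ?_⟩
  have h : r * w % n * k ≡ r [MOD n] := by
    calc r * w % n * k ≡ r * w * k [MOD n] := (Nat.mod_modEq _ _).mul_right _
      _ = r * (w * k) := by ring
      _ ≡ r * 1 [MOD n] := hwk.mul_left _
      _ = r := by ring
  rwa [Nat.ModEq, Nat.mod_eq_of_lt hr] at h

lemma wt_eq_sum_mul {n k w : ℕ} (hgcd : Nat.gcd n k = 1) (hwk : w * k ≡ 1 [MOD n]) (j : ℤ) :
    wt n j = ∑ i ∈ Finset.range n, dig n j (i * k) := by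
  unfold wt
  symm
  refine Finset.sum_bij (fun i _ => i * k % n) ?_ ?_ ?_ ?_
  · intro i hi
    exact Finset.mem_range.2 (Nat.mod_lt _ (by rw [Finset.mem_range] at hi; omega))
  · intro i hi i' hi' h
    exact mul_right_inj_mod hgcd (Finset.mem_range.1 hi) (Finset.mem_range.1 hi') h
  · intro r hr
    obtain ⟨i, hi, h⟩ := exists_mul_mod_eq hwk (Finset.mem_range.1 hr)
    exact ⟨i, Finset.mem_range.2 hi, h⟩
  · intro i _
    exact dig_congr j (Nat.mod_modEq _ _).symm

lemma wt_add_wt_of_mul_digits {n k w : ℕ} (hn : 2 ≤ n) (hkn : k < n)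
    (hgcd : Nat.gcd n k = 1) (hw0 : 0 < w) (hwn : w < n) (hwk : w * k ≡ 1 [MOD n])
    (j : ℤ) (h0 : 0 ≤ j) (hj : j < 3 ^ n - 1)
    (hz : dig n j 0 + dig n j ((n - 1) * k) = 1 ∨ dig n j 0 + dig n j ((n - 1) * k) = 3)
    (hw : dig n j (w * k) + dig n j ((w - 1) * k) = 1)
    (h : ∀ i, 0 < i → i < n → i ≠ w → dig n j (i * k) + dig n j ((i - 1) * k) = 0 ∨
      dig n j (i * k) + dig n j ((i - 1) * k) = 2)
    (hodd : Odd (∑ r ∈ Finset.Ico (n - k) n, dig n j r)) :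
    wt n (-(j * cmD k)) + wt n j = n + 1 := by
  have key : ∀ r < n, ∃ b ≤ 2, 2 * b + dig n j r + dig n j (r + (n - k))
      = if r = 0 then 5 else if r = 1 then 1 else 2 := by
    intro r hr
    obtain ⟨i, hi, hir⟩ := exists_mul_mod_eq hwk hr
    have hr1 : dig n j r = dig n j (i * k) :=
      dig_congr j (by rw [← hir]; exact Nat.mod_modEq _ _)
    rcases Nat.eq_zero_or_pos i with rfl | hipos
    · have hr0 : r = 0 := by rw [← hir]; simp
      subst hr0
      have hr2 : dig n j (0 + (n - k)) = dig n j ((n - 1) * k) := by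
        refine dig_congr j (Nat.ModEq.add_right_cancel' k ?_)
        have e1 : 0 + (n - k) + k = n * 1 := by omega
        have e2 : (n - 1) * k + k = n * k := by
          obtain ⟨m, rfl⟩ : ∃ m, n = m + 1 := ⟨n - 1, by omega⟩
          simp; ring
        rw [e1, e2]
        simp [Nat.ModEq]
      rw [hr2]
      rcases hz with hz | hz
      · exact ⟨2, le_rfl, by simp; omega⟩
      · exact ⟨1, by omega, by simp; omega⟩
    · have hr0 : r ≠ 0 := by
        rintro rfl
        have := mul_right_inj_mod hgcd hi (i' := 0) (by omega) (by simpa using hir)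
        omega
      have hr2 : dig n j (r + (n - k)) = dig n j ((i - 1) * k) := by
        refine dig_congr j (Nat.ModEq.add_right_cancel' k ?_)
        have e1 : r + (n - k) + k = r + n := by omega
        have e2 : (i - 1) * k + k = i * k := by
          obtain ⟨m, rfl⟩ : ∃ m, i = m + 1 := ⟨i - 1, by omega⟩
          simp; ring
        rw [e1, e2, Nat.ModEq, hir, Nat.add_mod_right, Nat.mod_eq_of_lt hr]
      have h1 : w * k % n = 1 := by rw [hwk, Nat.mod_eq_of_lt (by omega)]
      rw [if_neg hr0, hr1, hr2]
      by_cases hiw : i = w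
      · subst hiw
        rw [if_pos (by omega)]
        exact ⟨0, by omega, by omega⟩
      · have hr1' : r ≠ 1 := by
          rintro rfl
          exact hiw (mul_right_inj_mod hgcd hi hwn (by omega))
        rw [if_neg hr1']
        rcases h i hipos hi hiw with h | h
        · exact ⟨1, by omega, by omega⟩
        · exact ⟨0, by omega, by omega⟩
  choose! b hb hpat using key
  refine wt_add_wt_of_digits n k hn hkn j h0 hj (fun r => if r < n then b r else 0) ?_ ?_ ?_
  · intro r
    split_ifs with hr
    · exact hb r hr
    · omega
  · intro r hr
    simpa [hr] using hpat r hr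
  · rw [Finset.sum_Ico_eq_sum_range] at hodd
    rw [show n - (n - k) = k by omega] at hodd
    simpa only [add_comm] using hodd

lemma sum_dig_parity {n k w : ℕ} (hwk : w * k ≡ 1 [MOD n]) (j : ℤ) (ε : ℕ → ℕ)
    (hε : ∀ i < n, dig n j (i * k) ≡ ε (i * k % n) [MOD 2]) :
    ∑ r ∈ Finset.Ico (n - k) n, dig n j r ≡ ∑ r ∈ Finset.Ico (n - k) n, ε r [MOD 2] := by
  refine Nat.ModEq.sum fun r hr => ?_
  obtain ⟨i, hi, rfl⟩ := exists_mul_mod_eq hwk (Finset.mem_Ico.1 hr).2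
  rw [dig_congr j (Nat.mod_modEq (i * k) n)]
  exact hε i hi

/-- Weights when the digits are `1` exactly on the second block `w ≤ i < n`. -/
lemma wt_add_wt_of_ones_right {n k w : ℕ} (hn : 2 ≤ n) (hkodd : Odd k) (hkn : k < n)
    (hgcd : Nat.gcd n k = 1) (hw0 : 0 < w) (hwn : w < n) (hwk : w * k ≡ 1 [MOD n])
    (heven : Even ((Aset n k w ∩ Finset.Ico (n - k) n).card))
    (j : ℤ) (h0 : 0 ≤ j) (hj : j < 3 ^ n - 1)
    (h1 : ∀ i, w ≤ i → i < n → dig n j (i * k) = 1)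
    (hlast : dig n j ((w - 1) * k) = 0)
    (h02 : ∀ i < w, dig n j (i * k) = 0 ∨ dig n j (i * k) = 2)
    (hcons : ∀ i, i + 1 < w → ¬(dig n j (i * k) = 2 ∧ dig n j ((i + 1) * k) = 2)) :
    wt n (-(j * cmD k)) + wt n j = n + 1 := by
  refine wt_add_wt_of_mul_digits hn hkn hgcd hw0 hwn hwk j h0 hj ?_ ?_ ?_ ?_
  · have a := h02 0 hw0
    have b := h1 (n - 1) (by omega) (by omega)
    rw [zero_mul] at a
    omega
  · have := h1 w le_rfl hwn
    omega
  · intro i hi hin hiw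
    rcases lt_or_ge i w with hlt | hge
    · have a := h02 i hlt
      have b := h02 (i - 1) (by omega)
      have c := hcons (i - 1) (by omega)
      rw [show i - 1 + 1 = i by omega] at c
      omega
    · have a := h1 i hge hin
      have b := h1 (i - 1) (by omega) (by omega)
      omega
  · have hp := sum_dig_parity hwk j (fun r => if r ∈ Aset n k w then 0 else 1) (by
      intro i hi
      simp only [mem_Aset_iff hgcd hwn hi]
      split_ifs with hlt
      · rcases h02 i hlt with h | h
        · rw [h]
        · rw [h]; decide
      · rw [h1 i (by omega) hi])
    have hc : ∑ r ∈ Finset.Ico (n - k) n, (if r ∈ Aset n k w then 0 else 1)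
        + (Aset n k w ∩ Finset.Ico (n - k) n).card = k := by
      rw [Finset.inter_comm, ← Finset.filter_mem_eq_inter, Finset.card_filter,
        ← Finset.sum_add_distrib]
      rw [Finset.sum_congr rfl (g := fun _ => 1) (fun r _ => by split_ifs <;> rfl)]
      simp
      omega
    rw [Nat.odd_iff, hp]
    rw [Nat.odd_iff] at hkodd
    rw [Nat.even_iff] at heven
    omega

/-- Weights when the digits are `1` exactly on the first block `i < w`. -/
lemma wt_add_wt_of_ones_left {n k w : ℕ} (hn : 2 ≤ n) (hkn : k < n)
    (hgcd : Nat.gcd n k = 1) (hw0 : 0 < w) (hwn : w < n) (hwk : w * k ≡ 1 [MOD n])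
    (hnot : ¬ Even ((Aset n k w ∩ Finset.Ico (n - k) n).card))
    (j : ℤ) (h0 : 0 ≤ j) (hj : j < 3 ^ n - 1)
    (h1 : ∀ i < w, dig n j (i * k) = 1)
    (hfirst : dig n j (w * k) = 0)
    (h02 : ∀ i, w ≤ i → i < n → dig n j (i * k) = 0 ∨ dig n j (i * k) = 2)
    (hcons : ∀ i, w ≤ i → i + 1 < n → ¬(dig n j (i * k) = 2 ∧ dig n j ((i + 1) * k) = 2)) :
    wt n (-(j * cmD k)) + wt n j = n + 1 := by
  refine wt_add_wt_of_mul_digits hn hkn hgcd hw0 hwn hwk j h0 hj ?_ ?_ ?_ ?_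
  · have a := h1 0 hw0
    have b := h02 (n - 1) (by omega) (by omega)
    rw [zero_mul] at a
    omega
  · have := h1 (w - 1) (by omega)
    omega
  · intro i hi hin hiw
    rcases lt_or_ge i w with hlt | hge
    · have a := h1 i hlt
      have b := h1 (i - 1) (by omega)
      omega
    · have a := h02 i hge hin
      have b := h02 (i - 1) (by omega) (by omega)
      have c := hcons (i - 1) (by omega) (by omega)
      rw [show i - 1 + 1 = i by omega] at c
      omega
  · have hp := sum_dig_parity hwk j (fun r => if r ∈ Aset n k w then 1 else 0) (by
      intro i hi
      simp only [mem_Aset_iff hgcd hwn hi]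
      split_ifs with hlt
      · rw [h1 i hlt]
      · rcases h02 i (by omega) hi with h | h
        · rw [h]
        · rw [h]; decide)
    rw [← Finset.card_filter, Finset.filter_mem_eq_inter, Finset.inter_comm] at hp
    rw [Nat.odd_iff, hp]
    rwa [Nat.not_even_iff] at hnot

lemma zero_or_two_of_mem_zero {n k w : ℕ} (hw0 : 0 < w) {j : ℤ}
    (hj : j ∈ U0set n k w ∪ V0set n k w) :
    0 < j ∧ j < 3 ^ n - 1 ∧ (∀ i, w ≤ i → i < n → dig n j (i * k) = 1) ∧
      dig n j ((w - 1) * k) = 0 ∧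
      (∀ i < w, dig n j (i * k) = 0 ∨ dig n j (i * k) = 2) ∧
      (∀ i, i + 1 < w → ¬(dig n j (i * k) = 2 ∧ dig n j ((i + 1) * k) = 2)) := by
  rcases hj with ⟨a, b, h1, hz, hl, h02, hc⟩ | ⟨a, b, h1, hz, hk, hl, h02, hc⟩
  · refine ⟨a, b, fun i h h' => h1 i h (by omega), hl, fun i hi => ?_, fun i hi => ?_⟩
    · rcases Nat.eq_zero_or_pos i with rfl | hp
      · left; rwa [zero_mul]
      · rcases Nat.lt_or_ge (w - 2) i with h | h
        · left; rwa [show i = w - 1 by omega]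
        · exact h02 i hp h
    · rcases Nat.eq_zero_or_pos i with rfl | hp
      · rw [zero_mul]; omega
      · rcases Nat.lt_or_ge (w - 2) (i + 1) with h | h
        · rw [show i + 1 = w - 1 by omega]; omega
        · exact hc i hp h
  · refine ⟨a, b, fun i h h' => h1 i h (by omega), hl, fun i hi => ?_, fun i hi => ?_⟩
    · rcases Nat.eq_zero_or_pos i with rfl | hp
      · right; rwa [zero_mul]
      · rcases Nat.lt_or_ge (w - 2) i with h | h
        · left; rwa [show i = w - 1 by omega]
        · rcases Nat.lt_or_ge i 2 with h2 | h2
          · left; rwa [show i = 1 by omega, one_mul]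
          · exact h02 i h2 h
    · rcases Nat.eq_zero_or_pos i with rfl | hp
      · rw [zero_add, one_mul]; omega
      · rcases Nat.lt_or_ge (w - 2) (i + 1) with h | h
        · rw [show i + 1 = w - 1 by omega]; omega
        · rcases Nat.lt_or_ge i 2 with h2 | h2
          · rw [show i = 1 by omega, one_mul]; omega
          · exact hc i h2 h

lemma zero_or_two_of_mem_one {n k w : ℕ} (hw0 : 0 < w) (hwn : w < n) {j : ℤ}
    (hj : j ∈ U1set n k w ∪ V1set n k w) :
    0 < j ∧ j < 3 ^ n - 1 ∧ (∀ i < w, dig n j (i * k) = 1) ∧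
      dig n j (w * k) = 0 ∧
      (∀ i, w ≤ i → i < n → dig n j (i * k) = 0 ∨ dig n j (i * k) = 2) ∧
      (∀ i, w ≤ i → i + 1 < n → ¬(dig n j (i * k) = 2 ∧ dig n j ((i + 1) * k) = 2)) := by
  rcases hj with ⟨a, b, h1, hf, hl, h02, hc⟩ | ⟨a, b, h1, hf, hl2, h02, hl, hc⟩
  · refine ⟨a, b, fun i h => h1 i (by omega), hf, fun i hi hi' => ?_, fun i hi hi' => ?_⟩
    · rcases eq_or_lt_of_le hi with rfl | hp
      · left; exact hf
      · rcases Nat.lt_or_ge (n - 2) i with h | h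
        · left; rwa [show i = n - 1 by omega]
        · exact h02 i hp h
    · rcases eq_or_lt_of_le hi with rfl | hp
      · omega
      · rcases Nat.lt_or_ge (n - 2) (i + 1) with h | h
        · rw [show i + 1 = n - 1 by omega]; omega
        · exact hc i hp h
  · refine ⟨a, b, fun i h => h1 i (by omega), hf, fun i hi hi' => ?_, fun i hi hi' => ?_⟩
    · rcases eq_or_lt_of_le hi with rfl | hp
      · left; exact hf
      · rcases Nat.lt_or_ge (n - 3) i with h | h
        · rcases Nat.lt_or_ge (n - 2) i with h2 | h2
          · right; rwa [show i = n - 1 by omega]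
          · left; rwa [show i = n - 2 by omega]
        · exact h02 i hp h
    · rcases eq_or_lt_of_le hi with rfl | hp
      · omega
      · rcases Nat.lt_or_ge (n - 3) (i + 1) with h | h
        · rcases Nat.lt_or_ge (n - 2) (i + 1) with h2 | h2
          · rw [show i = n - 2 by omega]; omega
          · rw [show i + 1 = n - 2 by omega]; omega
        · exact hc i hp h

/-- There is an integer with any prescribed `0`/`1` digits, as long as both values occur. -/
lemma exists_dig_eq {n : ℕ} (b : ℕ → ℕ) (hb : ∀ r, b r ≤ 1) (h0 : ∃ r < n, b r = 0)
    (h1 : ∃ r < n, b r = 1) :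
    ∃ j : ℤ, 0 < j ∧ j < 3 ^ n - 1 ∧ ∀ i, dig n j i = b (i % n) := by
  have hb2 : ∀ r, b r ≤ 2 := fun r => (hb r).trans (by omega)
  have hne : ∃ r < n, b r < 2 := by
    obtain ⟨r, hr, h⟩ := h0
    exact ⟨r, hr, by omega⟩
  refine ⟨((∑ r ∈ Finset.range n, b r * 3 ^ r : ℕ) : ℤ), ?_, ?_, fun i => ?_⟩
  · obtain ⟨r, hr, h⟩ := h1
    rw [Nat.cast_pos]
    exact Finset.sum_pos' (fun _ _ => Nat.zero_le _)
      ⟨r, Finset.mem_range.2 hr, by rw [h]; positivity⟩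
  · have := sum_ternary_lt_pred n b hb2 hne
    zify at this
    push_cast
    linarith
  · exact dig_of_modEq n b hb2 hne _ (by simp) i

lemma sum_range_ite_lt {n w : ℕ} (hwn : w ≤ n) (x y : ℕ) :
    ∑ i ∈ Finset.range n, (if i < w then x else y) = w * x + (n - w) * y := by
  obtain ⟨m, rfl⟩ := Nat.exists_eq_add_of_le hwn
  rw [Finset.sum_range_add, Finset.sum_congr rfl (g := fun _ => x)
    (fun i hi => if_pos (Finset.mem_range.1 hi))]
  simp

lemma card_Aset {n k w : ℕ} (hgcd : Nat.gcd n k = 1) (hwn : w < n) : (Aset n k w).card = w := by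
  unfold Aset
  rw [Finset.card_image_of_injOn, Finset.card_range]
  intro i hi i' hi' h
  rw [Finset.mem_coe, Finset.mem_range] at hi hi'
  exact mul_right_inj_mod hgcd (by omega) (by omega) h

lemma even_card_of_eq_pred {n k w : ℕ} (hkodd : Odd k) (hkn : k < n)
    (hgcd : Nat.gcd n k = 1) (hw0 : 0 < w) (hwk : w * k ≡ 1 [MOD n]) (hw : w + 1 = n) :
    Even ((Aset n k w ∩ Finset.Ico (n - k) n).card) := by
  have hk0 : 0 < k := hkodd.pos
  have hdvd : n ∣ k + 1 := by
    have h : w * k + k ≡ 1 + k [MOD n] := hwk.add_right k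
    have e : w * k + k = n * k := by rw [← hw]; ring
    rw [e] at h
    have h2 : 1 + k ≡ 0 [MOD n] := h.symm.trans (by simp [Nat.ModEq])
    rw [add_comm]
    exact (Nat.modEq_zero_iff_dvd).1 h2
  have hkn' : k + 1 = n := le_antisymm hkn (Nat.le_of_dvd (by omega) hdvd)
  have hA : Aset n k w ∩ Finset.Ico (n - k) n = (Aset n k w).erase 0 := by
    ext r
    simp only [Finset.mem_inter, Finset.mem_Ico, Finset.mem_erase]
    constructor
    · rintro ⟨h, h1, -⟩
      exact ⟨by omega, h⟩
    · rintro ⟨h, hr⟩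
      refine ⟨hr, by omega, ?_⟩
      simp only [Aset, Finset.mem_image] at hr
      obtain ⟨i, -, rfl⟩ := hr
      exact Nat.mod_lt _ (by omega)
  have h0 : 0 ∈ Aset n k w := by
    simp only [Aset, Finset.mem_image, Finset.mem_range]
    exact ⟨0, hw0, by simp⟩
  rw [hA, Finset.card_erase_of_mem h0, card_Aset hgcd (by omega)]
  have : w = k := by omega
  rw [this]
  exact hkodd.tsub_odd odd_one

/-- The maximum of `wt(-jd)` over `U_0 ∪ V_0` (resp. `U_1 ∪ V_1`) is `w+1`
(resp. `n+1-w`), equivalently the minimum of `wt(j)` is `n-w` (resp. `w`);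
this maximum is the algebraic degree of the dual of the Coulter-Matthews bent
function, and it exceeds 2 whenever `k > 1`. -/
theorem stmt16 (n k : ℕ) (hn : 2 ≤ n) (hkodd : Odd k) (hk0 : 0 < k) (hkn : k < n)
    (hgcd : Nat.gcd n k = 1) (w : ℕ) (hw0 : 0 < w) (hwn : w < n) (hwk : w * k ≡ 1 [MOD n]) :
    (Even ((Aset n k w ∩ Finset.Ico (n - k) n).card) →
      (∀ j ∈ U0set n k w ∪ V0set n k w, wt n (-(j * cmD k)) ≤ w + 1) ∧
      (∃ j ∈ U0set n k w ∪ V0set n k w, wt n (-(j * cmD k)) = w + 1) ∧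
      (∀ j ∈ U0set n k w ∪ V0set n k w, n - w ≤ wt n j) ∧
      (∃ j ∈ U0set n k w ∪ V0set n k w, wt n j = n - w) ∧
      (1 < k → 2 < w + 1)) ∧
    (¬ Even ((Aset n k w ∩ Finset.Ico (n - k) n).card) →
      (∀ j ∈ U1set n k w ∪ V1set n k w, wt n (-(j * cmD k)) ≤ n + 1 - w) ∧
      (∃ j ∈ U1set n k w ∪ V1set n k w, wt n (-(j * cmD k)) = n + 1 - w) ∧
      (∀ j ∈ U1set n k w ∪ V1set n k w, w ≤ wt n j) ∧
      (∃ j ∈ U1set n k w ∪ V1set n k w, wt n j = w) ∧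
      2 < n + 1 - w) := by
  have hblock : ∀ x y : ℕ, ∀ i < n,
      (if i * k % n % n ∈ Aset n k w then x else y) = if i < w then x else y := fun x y i hi => by
    rw [Nat.mod_mod]; simp only [mem_Aset_iff hgcd hwn hi]
  have hA0 : 0 * k % n ∈ Aset n k w := (mem_Aset_iff hgcd hwn (by omega)).2 hw0
  have hAw : w * k % n ∉ Aset n k w := fun h => lt_irrefl _ ((mem_Aset_iff hgcd hwn hwn).1 h)
  have hlt : ∀ i, i * k % n < n := fun i => Nat.mod_lt _ (by omega)
  constructor
  · intro heven
    have hsum : ∀ j ∈ U0set n k w ∪ V0set n k w, wt n (-(j * cmD k)) + wt n j = n + 1 := by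
      intro j hj
      obtain ⟨a, b, h1, hl, h02, hc⟩ := zero_or_two_of_mem_zero hw0 hj
      exact wt_add_wt_of_ones_right hn hkodd hkn hgcd hw0 hwn hwk heven j a.le b h1 hl h02 hc
    have hmin : ∀ j ∈ U0set n k w ∪ V0set n k w, n - w ≤ wt n j := by
      intro j hj
      obtain ⟨-, -, h1, -⟩ := zero_or_two_of_mem_zero hw0 hj
      rw [wt_eq_sum_mul hgcd hwk]
      have h := sum_range_ite_lt hwn.le 0 1
      rw [mul_zero, zero_add, mul_one] at h
      rw [← h]
      refine Finset.sum_le_sum fun i hi => ?_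
      split_ifs with hiw
      · exact Nat.zero_le _
      · rw [h1 i (by omega) (Finset.mem_range.1 hi)]
    have hex : ∃ j ∈ U0set n k w ∪ V0set n k w, wt n j = n - w := by
      obtain ⟨j, hj0, hj, hd⟩ := exists_dig_eq (n := n)
        (fun r => if r ∈ Aset n k w then 0 else 1) (fun r => by split_ifs <;> omega)
        ⟨_, hlt 0, if_pos hA0⟩ ⟨_, hlt w, if_neg hAw⟩
      have hd' : ∀ i < n, dig n j (i * k) = if i < w then 0 else 1 := fun i hi => by
        rw [hd, ← hblock 0 1 i hi, Nat.mod_mod]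
      have hd0 : ∀ i < w, dig n j (i * k) = 0 := fun i hi => by
        rw [hd' i (by omega), if_pos hi]
      refine ⟨j, Or.inl ⟨hj0, hj, fun i h h' => ?_, ?_, hd0 _ (by omega), fun i h h' => ?_,
        fun i h h' => ?_⟩, ?_⟩
      · rw [hd' i (by omega), if_neg (by omega)]
      · simpa using hd0 0 hw0
      · exact Or.inl (hd0 i (by omega))
      · rw [hd0 i (by omega)]; omega
      · rw [wt_eq_sum_mul hgcd hwk,
          Finset.sum_congr rfl fun i hi => hd' i (Finset.mem_range.1 hi),
          sum_range_ite_lt hwn.le]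
        omega
    refine ⟨fun j hj => ?_, ?_, hmin, hex, fun hk1 => ?_⟩
    · have := hsum j hj
      have := hmin j hj
      omega
    · obtain ⟨j, hj, h⟩ := hex
      have := hsum j hj
      exact ⟨j, hj, by omega⟩
    · by_contra hcon
      have hw1 : w = 1 := by omega
      rw [hw1, one_mul, Nat.ModEq, Nat.mod_eq_of_lt hkn, Nat.mod_eq_of_lt (by omega)] at hwk
      omega
  · intro hnot
    have hsum : ∀ j ∈ U1set n k w ∪ V1set n k w, wt n (-(j * cmD k)) + wt n j = n + 1 := by
      intro j hj
      obtain ⟨a, b, h1, hf, h02, hc⟩ := zero_or_two_of_mem_one hw0 hwn hj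
      exact wt_add_wt_of_ones_left hn hkn hgcd hw0 hwn hwk hnot j a.le b h1 hf h02 hc
    have hmin : ∀ j ∈ U1set n k w ∪ V1set n k w, w ≤ wt n j := by
      intro j hj
      obtain ⟨-, -, h1, -⟩ := zero_or_two_of_mem_one hw0 hwn hj
      rw [wt_eq_sum_mul hgcd hwk]
      have h := sum_range_ite_lt hwn.le 1 0
      rw [mul_zero, add_zero, mul_one] at h
      conv_lhs => rw [← h]
      refine Finset.sum_le_sum fun i hi => ?_
      split_ifs with hiw
      · rw [h1 i hiw]
      · exact Nat.zero_le _
    have hex : ∃ j ∈ U1set n k w ∪ V1set n k w, wt n j = w := by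
      obtain ⟨j, hj0, hj, hd⟩ := exists_dig_eq (n := n)
        (fun r => if r ∈ Aset n k w then 1 else 0) (fun r => by split_ifs <;> omega)
        ⟨_, hlt w, if_neg hAw⟩ ⟨_, hlt 0, if_pos hA0⟩
      have hd' : ∀ i < n, dig n j (i * k) = if i < w then 1 else 0 := fun i hi => by
        rw [hd, ← hblock 1 0 i hi, Nat.mod_mod]
      have hd0 : ∀ i, w ≤ i → i < n → dig n j (i * k) = 0 := fun i hi hi' => by
        rw [hd' i hi', if_neg (by omega)]
      refine ⟨j, Or.inl ⟨hj0, hj, fun i h => ?_, hd0 _ le_rfl hwn, hd0 _ (by omega) (by omega),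
        fun i h h' => ?_, fun i h h' => ?_⟩, ?_⟩
      · rw [hd' i (by omega), if_pos (by omega)]
      · exact Or.inl (hd0 i (by omega) (by omega))
      · rw [hd0 i (by omega) (by omega)]; omega
      · rw [wt_eq_sum_mul hgcd hwk,
          Finset.sum_congr rfl fun i hi => hd' i (Finset.mem_range.1 hi),
          sum_range_ite_lt hwn.le]
        omega
    refine ⟨fun j hj => ?_, ?_, hmin, hex, ?_⟩
    · have := hsum j hj
      have := hmin j hj
      omega
    · obtain ⟨j, hj, h⟩ := hex
      have := hsum j hj
      exact ⟨j, hj, by omega⟩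
    · by_contra hcon
      exact hnot (even_card_of_eq_pred hkodd hkn hgcd hw0 hwk (by omega))
end

section
/- If k divides n+1 and k > 1, then w = (n+1)/k and |A ∩ {n−k, n−k+1, …, n−1}| = 1. -/
theorem stmt17 (n k : ℕ) (hn : 2 ≤ n) (hkodd : Odd k) (hk0 : 0 < k) (hkn : k < n)
    (hgcd : Nat.gcd n k = 1) (w : ℕ) (hw0 : 0 < w) (hwn : w < n) (hwk : w * k ≡ 1 [MOD n])
    (hdvd : k ∣ n + 1) (hk1 : 1 < k) :
    w = (n + 1) / k ∧ (Aset n k w ∩ Finset.Ico (n - k) n).card = 1 := by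
  obtain ⟨m, hm⟩ := hdvd
  have hmn : m < n := by nlinarith
  have hmk : m * k ≡ 1 [MOD n] := by
    rw [mul_comm, ← hm]
    simp [Nat.ModEq]
  have hwm : w = m :=
    Nat.ModEq.eq_of_lt_of_lt (Nat.ModEq.cancel_right_of_coprime hgcd (hwk.trans hmk.symm)) hwn hmn
  subst hwm
  refine ⟨by rw [hm, Nat.mul_div_cancel_left _ hk0], ?_⟩
  have hlast : (w - 1) * k + k = n + 1 := by
    rw [hm, ← Nat.succ_mul, Nat.succ_eq_add_one, Nat.sub_add_cancel hw0, mul_comm]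
  have hmod : ∀ i < w, i * k % n = i * k := fun i hi => by
    have : i * k ≤ (w - 1) * k := Nat.mul_le_mul_right k (by omega)
    exact Nat.mod_eq_of_lt (by omega)
  rw [Finset.card_eq_one]
  refine ⟨(w - 1) * k, ?_⟩
  ext x
  simp only [Aset, Finset.mem_inter, Finset.mem_image, Finset.mem_range, Finset.mem_Ico,
    Finset.mem_singleton]
  constructor
  · rintro ⟨⟨i, hi, rfl⟩, hlow, -⟩
    rw [hmod i hi] at hlow ⊢
    by_contra hne
    have hlt : i + 1 ≤ w - 1 := by
      have : i ≠ w - 1 := fun h => hne (by rw [h])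
      omega
    have := Nat.mul_le_mul_right k hlt
    rw [Nat.succ_mul] at this
    omega
  · rintro rfl
    exact ⟨⟨w - 1, by omega, hmod _ (by omega)⟩, by omega, by omega⟩
end
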